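/- Let q be a prime power, n ≥ 3 and m₁, m₂ positive integers. If q^{n/2} ≥ (m₁ + m₂ + 1) · W(qⁿ−1)² · W_q(xⁿ−1), then for each f ∈ Υ_{qⁿ}(m₁,m₂) there exists α ∈ F_{qⁿ}, primitive and normal over F_q, such that f(α) ∈ F_{qⁿ} is also a primitive element. -/

import Mathlib

open Polynomial

noncomputable section

/-- An element of a finite field is *primitive* if it generates the multiplicative group. -/
def IsPrimitiveElem {L : Type} [Field L] [Fintype L] (α : L) : Prop :=
  orderOf α = Fintype.card L - 1

/-- `β` is a *normal element* of `L` over `K`, where `n = [L : K]`: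
the conjugates `β, β^q, …, β^(q^(n-1))` form a `K`-basis of `L`. -/
def IsNormalElem (K : Type) {L : Type} [Field K] [Fintype K] [Field L] [Algebra K L]
    (n : ℕ) (β : L) : Prop :=
  LinearIndependent K (fun i : Fin n => β ^ Fintype.card K ^ (i : ℕ)) ∧
    Submodule.span K (Set.range fun i : Fin n => β ^ Fintype.card K ^ (i : ℕ)) = ⊤

/-- The set `Υ_Q(m₁, m₂)` of rational functions over the field `F` with `Q` elements. -/
def Upsilon (F : Type) [Field F] [Fintype F] (m₁ m₂ : ℕ) : Set (RatFunc F) :=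
  {f | ∃ f₁ f₂ : F[X], f₂ ≠ 0 ∧
      f = algebraMap F[X] (RatFunc F) f₁ / algebraMap F[X] (RatFunc F) f₂ ∧
      f₁.natDegree ≤ m₁ ∧ f₂.natDegree ≤ m₂ ∧ IsCoprime f₁ f₂ ∧
      ∃ (k : ℕ) (g : F[X]), 0 < k ∧ g.Monic ∧ Irreducible g ∧ g ≠ X ∧
        Nat.gcd k (Fintype.card F - 1) = 1 ∧
        g ^ k ∣ f₁ * f₂ ∧ ¬ g ^ (k + 1) ∣ f₁ * f₂}

/-- Evaluation of a rational function at a point of the same field (`0` if undefined). -/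
def ratEval {F : Type} [Field F] (f : RatFunc F) (α : F) : F :=
  f.eval (RingHom.id F) α

/-- `α` is `s`-free. -/
def IsFree {F : Type} [Field F] (s : ℕ) (α : F) : Prop :=
  α ≠ 0 ∧ ∀ d : ℕ, d ∣ s → d ≠ 1 → ¬ ∃ β : F, β ^ d = α

/-- The `F_q[x]`-module action `h ∘ β = ∑ hᵢ β^(qⁱ)` on `L`. -/
def polyAct {K L : Type} [Field K] [Fintype K] [Field L] [Algebra K L]
    (h : K[X]) (β : L) : L :=
  h.sum fun i a => algebraMap K L a * β ^ Fintype.card K ^ i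

/-- `α` is `g`-free with respect to the `F_q[x]`-module structure of `L`. -/
def IsPolyFree (K : Type) {L : Type} [Field K] [Fintype K] [Field L] [Algebra K L]
    (g : K[X]) (α : L) : Prop :=
  ∀ h : K[X], h.Monic → h ∣ g → (∃ lam : L, α = polyAct h lam) → h = 1

/-- `N_f(e₁, e₂, g)`: the number of `α ∈ L` such that `α` is `e₁`-free,
`f(α)` is `e₂`-free and `α` is `g`-free. -/
def NElems (K : Type) {L : Type} [Field K] [Fintype K] [Field L] [Fintype L] [Algebra K L]
    (f : RatFunc L) (e₁ e₂ : ℕ) (g : K[X]) : ℕ :=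
  Nat.card {α : L | IsFree e₁ α ∧ IsFree e₂ (ratEval f α) ∧ IsPolyFree K g α}

/-- `W(ℓ)`: the number of squarefree divisors of `ℓ`. -/
def Wnat (ℓ : ℕ) : ℕ := (ℓ.divisors.filter Squarefree).card

/-- `W_q(g)`: the number of monic squarefree divisors of `g` in `F_q[x]`. -/
def Wpoly {K : Type} [Field K] (g : K[X]) : ℕ :=
  Nat.card {h : K[X] // h.Monic ∧ Squarefree h ∧ h ∣ g}

/-- `Φ(g) = |(F_q[x]/(g))ˣ|`. -/
def PhiPoly {K : Type} [Field K] (g : K[X]) : ℕ :=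
  Nat.card ((K[X] ⧸ Ideal.span ({g} : Set K[X]))ˣ)

/-- `(q, n) ∈ B(m₁, m₂)`: for every `f ∈ Υ_{qⁿ}(m₁, m₂)` there is a primitive element
`α` of `F_{qⁿ}`, normal over `F_q`, with `f(α)` also primitive. -/
def memB (m₁ m₂ q n : ℕ) : Prop :=
  ∀ (K L : Type) [Field K] [Field L] [Fintype K] [Fintype L] [Algebra K L],
    Fintype.card K = q → Fintype.card L = q ^ n →
    ∀ f ∈ Upsilon L m₁ m₂,
      ∃ α : L, IsPrimitiveElem α ∧ IsNormalElem K n α ∧ IsPrimitiveElem (ratEval f α)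

/-- `𝔑(q, n)`: the number of primitive elements of `F_{qⁿ}` that are normal over `F_q`. -/
def NNum (K L : Type) [Field K] [Fintype K] [Field L] [Fintype L] [Algebra K L] (n : ℕ) : ℕ :=
  Nat.card {α : L | IsPrimitiveElem α ∧ IsNormalElem K n α}

end



theorem wl_kummer_irred_aux {K E : Type*} [Field K] [Field E] [IsAlgClosed E] (i : K →+* E) {d : ℕ} {ζ : K} (hd : 0 < d)
    (hζ : IsPrimitiveRoot ζ d) (a : K) (ha0 : a ≠ 0)
    (ha : ∀ l : ℕ, l.Prime → l ∣ d → ∀ b : K, b ^ l ≠ a) :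
    Irreducible (X ^ d - C a : K[X]) := by
  classical
  have hne : (X ^ d - C a : K[X]) ≠ 0 := (monic_X_pow_sub_C a hd.ne').ne_zero
  have hnu : ¬ IsUnit (X ^ d - C a : K[X]) := by
    apply Polynomial.not_isUnit_of_natDegree_pos
    rw [natDegree_X_pow_sub_C]; exact hd
  obtain ⟨P, hP, hPd⟩ := WfDvdMonoid.exists_irreducible_factor hnu hne
  have hPdeg : 0 < P.natDegree := hP.natDegree_pos
  -- roots
  have hsplit : (P.map i).Splits := IsAlgClosed.splits _
  have hroot : ∀ x ∈ (P.map i).roots, x ^ d = i a := by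
    intro x hx
    have h1 : (P.map i).eval x = 0 := (mem_roots'.mp hx).2
    obtain ⟨c, hc⟩ := hPd
    have := congrArg (fun p => (p.map i).eval x) hc
    simp [h1] at this
    exact sub_eq_zero.mp this
  have hcard : Multiset.card (P.map i).roots = P.natDegree := by
    rw [← hsplit.natDegree_eq_card_roots, natDegree_map]
  obtain ⟨α, hα⟩ : ∃ α, α ∈ (P.map i).roots := by
    apply Multiset.card_pos_iff_exists_mem.mp; omega
  have hα0 : α ≠ 0 := by
    rintro rfl
    have := hroot _ hα
    rw [zero_pow hd.ne'] at this
    exact ha0 ((map_eq_zero i).mp this.symm)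
  have hζ' : IsPrimitiveRoot (i ζ) d := hζ.map_of_injective i.injective
  have hrel : ∀ x ∈ (P.map i).roots, ∃ k : K, x = i k * α := by
    intro x hx
    have : (x / α) ^ d = 1 := by
      rw [div_pow, hroot x hx, hroot α hα, div_self]
      exact (map_ne_zero i).mpr ha0
    have hz : NeZero d := ⟨hd.ne'⟩
    obtain ⟨k, -, hk⟩ := hζ'.eq_pow_of_pow_eq_one this
    refine ⟨ζ ^ k, ?_⟩
    rw [map_pow, hk]; field_simp
  have hprod : ∀ s : Multiset E, (∀ x ∈ s, ∃ k : K, x = i k * α) →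
      ∃ k : K, s.prod = i k * α ^ (Multiset.card s) := by
    intro s
    induction s using Multiset.induction_on with
    | empty => intro _; exact ⟨1, by simp⟩
    | cons x s ih =>
      intro h
      obtain ⟨k, hk⟩ := ih (fun y hy => h y (Multiset.mem_cons_of_mem hy))
      obtain ⟨k', hk'⟩ := h x (Multiset.mem_cons_self x s)
      refine ⟨k' * k, ?_⟩
      rw [Multiset.prod_cons, hk, hk', Multiset.card_cons, map_mul]; ring
  obtain ⟨k, hk⟩ := hprod _ hrel
  have hk0 : i k ≠ 0 := by
    intro h0
    rw [h0, zero_mul, Multiset.prod_eq_zero_iff] at hk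
    have := hroot 0 hk
    rw [zero_pow hd.ne'] at this
    exact ha0 ((map_eq_zero i).mp this.symm)
  have hc0 := hsplit.coeff_zero_eq_leadingCoeff_mul_prod_roots
  have hmem : α ^ P.natDegree ∈ i.fieldRange := by
    rw [hk, hcard] at hc0
    rw [coeff_map, leadingCoeff_map] at hc0
    have hl : i P.leadingCoeff ≠ 0 := by simpa using hP.ne_zero
    have e : α ^ P.natDegree = i (P.coeff 0) / ((-1) ^ P.natDegree * i P.leadingCoeff * i k) := by
      rw [hc0, natDegree_map]; field_simp
    rw [e]
    refine div_mem ⟨_, rfl⟩ (mul_mem (mul_mem (pow_mem (neg_mem (one_mem _)) _) ⟨_, rfl⟩) ⟨_, rfl⟩)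
  have hmem2 : α ^ d ∈ i.fieldRange := by rw [hroot α hα]; exact ⟨_, rfl⟩
  have hg : α ^ (Nat.gcd P.natDegree d) ∈ i.fieldRange := by
    have : α ^ (Nat.gcd P.natDegree d) =
        (α ^ P.natDegree) ^ (Nat.gcdA P.natDegree d) * (α ^ d) ^ (Nat.gcdB P.natDegree d) := by
      rw [← zpow_natCast, Nat.gcd_eq_gcd_ab, zpow_add₀ hα0, zpow_mul, zpow_mul, zpow_natCast,
        zpow_natCast]
    rw [this]
    exact mul_mem (zpow_mem hmem _) (zpow_mem hmem2 _)
  have hgd : Nat.gcd P.natDegree d = d := by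
    by_contra hne'
    obtain ⟨t, ht⟩ := Nat.gcd_dvd_right P.natDegree d
    have ht1 : t ≠ 1 := by rintro rfl; omega
    obtain ⟨l, hl, hlt⟩ := Nat.exists_prime_and_dvd ht1
    obtain ⟨u, rfl⟩ := hlt
    obtain ⟨b, hb⟩ := hg
    refine ha l hl ?_ (b ^ u) ?_
    · rw [ht]; exact ⟨Nat.gcd P.natDegree d * u, by ring⟩
    · apply i.injective
      rw [← hroot α hα, map_pow, map_pow, hb]
      conv_rhs => rw [ht]
      rw [← pow_mul, ← pow_mul]; ring_nf
  have hdle : d ≤ P.natDegree := Nat.le_of_dvd hPdeg (hgd ▸ Nat.gcd_dvd_left _ _)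
  have hassoc : Associated P (X ^ d - C a) := by
    apply associated_of_dvd_of_natDegree_le hPd hne
    rw [natDegree_X_pow_sub_C]; exact hdle
  exact hassoc.irreducible hP

theorem wl_kummer_irred {K : Type*} [Field K] {d : ℕ} {ζ : K} (hd : 0 < d)
    (hζ : IsPrimitiveRoot ζ d) (a : K) (ha0 : a ≠ 0)
    (ha : ∀ l : ℕ, l.Prime → l ∣ d → ∀ b : K, b ^ l ≠ a) :
    Irreducible (X ^ d - C a : K[X]) :=
  wl_kummer_irred_aux (algebraMap K (AlgebraicClosure K)) hd hζ a ha0 ha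


theorem wl_natDegree_det_le {R : Type*} [CommRing R] {n : Type*} [Fintype n] [DecidableEq n]
    (M : Matrix n n R[X]) (b : n → ℕ) (hb : ∀ i j, (M i j).natDegree ≤ b j) :
    M.det.natDegree ≤ ∑ j, b j := by
  rw [Matrix.det_apply]
  apply natDegree_sum_le_of_forall_le
  intro σ _
  refine (natDegree_smul_le _ _).trans ?_
  exact (natDegree_prod_le _ _).trans (Finset.sum_le_sum fun i _ => hb _ _)

theorem wl_natDegree_resultant_le {R : Type*} [CommRing R] (f g : R[X][X]) (m n a b : ℕ)
    (hf : ∀ i, (f.coeff i).natDegree ≤ a) (hg : ∀ i, (g.coeff i).natDegree ≤ b) :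
    (resultant f g m n).natDegree ≤ m * b + n * a := by
  unfold resultant
  refine (wl_natDegree_det_le _ (fun j => Fin.addCases (fun _ => b) (fun _ => a) j) ?_).trans ?_
  · intro i j
    refine Fin.addCases (fun j => ?_) (fun j => ?_) j
    · simp only [sylvester, Matrix.of_apply, Fin.addCases_left]
      split_ifs
      · exact hg _
      · simp
    · simp only [sylvester, Matrix.of_apply, Fin.addCases_right]
      split_ifs
      · exact hf _
      · simp
  · rw [Fin.sum_univ_add]; simp

/-- substitution `Y ↦ X ^ r`, `X ↦ X`. -/
noncomputable def wlPhi {E : Type*} [Field E] (r : ℕ) : E[X][X] →+* E[X] :=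
  eval₂RingHom (expand E r : E[X] →ₐ[E] E[X]).toRingHom X

theorem wlPhi_C {E : Type*} [Field E] (r : ℕ) (f : E[X]) : wlPhi r (C f) = expand E r f := by
  simp [wlPhi]

theorem wlPhi_map {E : Type*} [Field E] (r : ℕ) (f : E[X]) : wlPhi r (f.map C) = f := by
  simp only [wlPhi, coe_eval₂RingHom, eval₂_map]
  have : ((expand E r : E[X] →ₐ[E] E[X]).toRingHom).comp (C : E →+* E[X]) = C := by
    ext a; simp
  rw [this, eval₂_C_X]

theorem wlPhi_inj {E : Type*} [Field E] {r : ℕ} (f : E[X][X]) (hf : f.natDegree < r)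
    (h : wlPhi r f = 0) : f = 0 := by
  have hr : 0 < r := by omega
  ext u v
  simp only [coeff_zero]
  by_cases hu : u < r
  swap
  · have hlt : f.natDegree < u := by omega
    rw [coeff_eq_zero_of_natDegree_lt hlt]; simp
  have h1 : wlPhi r f = ∑ i ∈ Finset.range r, expand E r (f.coeff i) * X ^ i := by
    simp only [wlPhi, coe_eval₂RingHom]
    rw [eval₂_eq_sum_range' _ hf]; rfl
  have h2 := congrArg (fun p => p.coeff (v * r + u)) (h1.symm.trans h)
  simp only [finsetSum_coeff, coeff_mul_X_pow', coeff_zero] at h2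
  rw [Finset.sum_eq_single u] at h2
  · simpa [coeff_expand hr, hr.ne'] using h2
  · intro i hi hne
    have hi : i < r := Finset.mem_range.mp hi
    split_ifs with hle
    · rw [coeff_expand hr, if_neg]
      intro hd
      have e1 : (v * r + u - i + i) % r = u := by
        rw [Nat.sub_add_cancel hle, Nat.mul_comm, Nat.mul_add_mod, Nat.mod_eq_of_lt hu]
      rw [Nat.add_mod, Nat.mod_eq_zero_of_dvd hd, zero_add, Nat.mod_mod, Nat.mod_eq_of_lt hi] at e1
      exact hne e1
    · rfl
  · intro hh; exact absurd (Finset.mem_range.mpr hu) hh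

theorem wl_not_power {E : Type*} [Field E] (F : E[X]) (hF0 : F ≠ 0) (l : ℕ) 
    (hp : ∃ (β : E) (e : ℕ) (G : E[X]), F = (X - C β) ^ e * G ∧ G.eval β ≠ 0 ∧ ¬ l ∣ e)
    (b : FractionRing E[X][X]) :
    b ^ l ≠ algebraMap E[X][X] _ (C F) / algebraMap E[X][X] _ (F.map C) := by
  obtain ⟨β, e, G, hFe, hG, hl⟩ := hp
  obtain ⟨A, B, hB, rfl⟩ := IsFractionRing.div_surjective (A := E[X][X]) b
  have hB0 : B ≠ 0 := nonZeroDivisors.ne_zero hB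
  have hinj := IsFractionRing.injective E[X][X] (FractionRing E[X][X])
  have hFm : F.map (C : E →+* E[X]) ≠ 0 := (Polynomial.map_ne_zero_iff C_injective).mpr hF0
  have hFC : (C F : E[X][X]) ≠ 0 := C_ne_zero.mpr hF0
  intro h
  rw [div_pow, div_eq_div_iff, ← map_pow, ← map_pow, ← map_mul, ← map_mul] at h
  rotate_left
  · exact pow_ne_zero _ ((map_ne_zero_iff _ hinj).mpr hB0)
  · exact (map_ne_zero_iff _ hinj).mpr hFm
  have h := hinj h
  have hA0 : A ^ l ≠ 0 := by
    intro h0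
    rw [h0, zero_mul] at h
    exact mul_ne_zero hFC (pow_ne_zero _ hB0) h.symm
  have h' := congrArg (rootMultiplicity (C β)) h
  rw [rootMultiplicity_mul (mul_ne_zero hA0 hFm),
    rootMultiplicity_mul (mul_ne_zero hFC (pow_ne_zero _ hB0)), rootMultiplicity_C] at h'
  have hpow : ∀ P : E[X][X], P ≠ 0 → l ∣ rootMultiplicity (C β) (P ^ l) := by
    intro P hP
    have : ∀ n : ℕ, rootMultiplicity (C β) (P ^ n) = n * rootMultiplicity (C β) P := by
      intro n
      induction n with
      | zero => rw [pow_zero, ← C_1, rootMultiplicity_C, zero_mul]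
      | succ n ih =>
        rw [pow_succ, rootMultiplicity_mul (mul_ne_zero (pow_ne_zero _ hP) hP), ih]; ring
    rw [this]; exact dvd_mul_right _ _
  have he : rootMultiplicity (C β) (F.map C) = e := by
    rw [hFe]
    simp only [Polynomial.map_mul, Polynomial.map_pow, Polynomial.map_sub, map_X, map_C]
    have hGe : (G.map C).eval (C β) ≠ 0 := by
      rw [eval_map, eval₂_at_apply]; exact C_ne_zero.mpr hG
    have hG0 : (G.map (C : E →+* E[X])) ≠ 0 := by
      intro h0; rw [h0] at hGe; simp at hGe
    rw [rootMultiplicity_mul (mul_ne_zero (pow_ne_zero _ (X_sub_C_ne_zero _)) hG0),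
      rootMultiplicity_X_sub_C_pow, rootMultiplicity_eq_zero hGe, add_zero]
  rw [he] at h'
  apply hl
  have hA : A ≠ 0 := by
    rintro rfl
    by_cases hl0 : l = 0
    · subst hl0
      simp at h'
      simp [← h'] at hl
    · exact hA0 (zero_pow hl0)
  rw [zero_add] at h'
  exact (Nat.dvd_add_right (hpow A hA)).mp (h' ▸ hpow B hB0)

theorem wl_nonvanish {E : Type*} [Field E] {d r J B N e : ℕ} {ζ : E} (hd : 0 < d)
    (hζ : IsPrimitiveRoot ζ d) (F : E[X]) (hF0 : F ≠ 0) (hFN : F.natDegree ≤ N)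
    (hr : d * e + 1 = r) (hexp : expand E r F = F ^ r)
    (hp : ∀ l : ℕ, l.Prime → l ∣ d →
      ∃ (β : E) (e : ℕ) (G : E[X]), F = (X - C β) ^ e * G ∧ G.eval β ≠ 0 ∧ ¬ l ∣ e)
    (hB : d * B + d * N < r) (h : Fin d → Fin J → E[X])
    (hdeg : ∀ i j, (h i j).natDegree ≤ B)
    (hsum : ∑ i, ∑ j, h i j * X ^ (r * (j : ℕ)) * F ^ (e * (i : ℕ)) = 0) :
    ∀ i j, h i j = 0 := by
  classical
  set c : Fin d → E[X][X] := fun i => ∑ j, (h i j).map C * C (X ^ (j : ℕ)) with hc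
  set H : E[X][X][X] := ∑ i : Fin d, C (c i) * X ^ (i : ℕ) with hH
  have hFm : F.map (C : E →+* E[X]) ≠ 0 := (Polynomial.map_ne_zero_iff C_injective).mpr hF0
  have hcoeff : ∀ i : Fin d, H.coeff i = c i := by
    intro i
    simp only [hH, finsetSum_coeff, coeff_C_mul, coeff_X_pow]
    rw [Finset.sum_eq_single i]
    · simp
    · intro b _ hb; simp [Fin.val_inj, hb.symm]
    · simp
  have hHdeg : H.degree < d := by
    exact degree_sum_fin_lt c
  have hcoeff' : ∀ k, ¬ k < d → H.coeff k = 0 := by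
    intro k hk
    apply coeff_eq_zero_of_degree_lt
    exact hHdeg.trans_le (by exact_mod_cast Nat.le_of_not_lt hk)
  have hcdeg : ∀ i, (c i).natDegree ≤ B := by
    intro i
    apply natDegree_sum_le_of_forall_le
    intro j _
    refine natDegree_mul_le.trans ?_
    rw [natDegree_C, add_zero]
    exact natDegree_map_le.trans (hdeg i j)
  set G : E[X][X][X] := C (F.map C) * X ^ d - C (C F) with hG
  have hGdeg : G.natDegree = d := by
    rw [hG, natDegree_sub_C, natDegree_C_mul_X_pow _ _ hFm]
  have hGc : ∀ k, (G.coeff k).natDegree ≤ N := by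
    intro k
    rw [hG, coeff_sub, coeff_C_mul, coeff_X_pow, coeff_C]
    refine (natDegree_sub_le _ _).trans (max_le ?_ ?_)
    · split_ifs
      · rw [mul_one]; exact natDegree_map_le.trans hFN
      · simp
    · split_ifs <;> simp
  have hHc : ∀ k, (H.coeff k).natDegree ≤ B := by
    intro k
    by_cases hk : k < d
    · have := hcoeff ⟨k, hk⟩; simp only at this; rw [this]; exact hcdeg _
    · rw [hcoeff' k hk]; simp
  have hHnd : H.natDegree ≤ d := by
    apply natDegree_le_of_degree_le hHdeg.le
  have hres : (resultant H G).natDegree < r := by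
    refine (wl_natDegree_resultant_le H G _ _ B N hHc hGc).trans_lt ?_
    rw [hGdeg]
    have : H.natDegree * N ≤ d * N := Nat.mul_le_mul_right _ hHnd
    omega
  have hres0 : resultant H G = 0 := by
    apply wlPhi_inj _ hres
    obtain ⟨p, q, -, -, hpq⟩ := exists_mul_add_mul_eq_C_resultant H G le_rfl le_rfl
      (Or.inr (by rw [hGdeg]; omega))
    have := congrArg (eval₂RingHom (wlPhi r) (F ^ e)) hpq
    simp only [map_add, map_mul, coe_eval₂RingHom, eval₂_C] at this
    rw [← this]
    have e1 : eval₂ (wlPhi r) (F ^ e) H = 0 := by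
      rw [← hsum, hH, eval₂_finsetSum]
      refine Finset.sum_congr rfl fun i _ => ?_
      rw [eval₂_mul, eval₂_C, eval₂_pow, eval₂_X, hc, map_sum, Finset.sum_mul]
      refine Finset.sum_congr rfl fun j _ => ?_
      rw [map_mul, wlPhi_map, wlPhi_C, map_pow, expand_X, ← pow_mul, ← pow_mul]
    have e2 : eval₂ (wlPhi r) (F ^ e) G = 0 := by
      rw [hG, eval₂_sub, eval₂_mul, eval₂_C, eval₂_C, eval₂_pow, eval₂_X, wlPhi_map, wlPhi_C,
        hexp, ← hr]
      ring
    rw [e1, e2]; simp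
  -- pass to fraction field
  let ι := algebraMap E[X][X] (FractionRing E[X][X])
  have hinj : Function.Injective ι := IsFractionRing.injective _ _
  have hres1 : resultant (H.map ι) (G.map ι) = 0 := by
    rw [natDegree_map_eq_of_injective hinj, natDegree_map_eq_of_injective hinj, resultant_map_map,
      hres0, map_zero]
  have hnc := (resultant_eq_zero_iff.mp hres1).2
  have hιF : ι (F.map C) ≠ 0 := (map_ne_zero_iff _ hinj).mpr hFm
  have hirr : Irreducible (X ^ d - C (ι (C F) / ι (F.map C)) : (FractionRing E[X][X])[X]) := by
    refine wl_kummer_irred hd (hζ.map_of_injective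
      (f := ι.comp ((C : E[X] →+* E[X][X]).comp (C : E →+* E[X]))) ?_) _ ?_ ?_
    · exact RingHom.injective _
    · exact div_ne_zero ((map_ne_zero_iff _ hinj).mpr (C_ne_zero.mpr hF0)) hιF
    · intro l hl hld b
      exact wl_not_power F hF0 l (hp l hl hld) b
  have hGe : G.map ι = C (ι (F.map C)) * (X ^ d - C (ι (C F) / ι (F.map C))) := by
    rw [mul_sub, ← C_mul, mul_div_cancel₀ _ hιF]
    simp [hG]
  have hH0 : H.map ι = 0 := by
    by_contra hne
    apply hnc
    rw [hGe]
    apply IsCoprime.symm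
    apply IsCoprime.mul_left
    · obtain ⟨v, hv⟩ := isUnit_C.mpr hιF.isUnit
      rw [← hv]
      exact ⟨(v⁻¹ : _ˣ).1, 0, by simp⟩
    · rw [hirr.coprime_iff_not_dvd]
      intro hdvd
      have := natDegree_le_of_dvd hdvd hne
      rw [natDegree_X_pow_sub_C, natDegree_map_eq_of_injective hinj] at this
      have h0 : H ≠ 0 := by rintro h0; rw [h0] at hne; simp at hne
      have h3 := (natDegree_lt_iff_degree_lt h0).mpr hHdeg
      omega
  have hHz : H = 0 := (Polynomial.map_eq_zero_iff hinj).mp hH0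
  intro i j
  have hci : c i = 0 := by rw [← hcoeff, hHz, coeff_zero]
  ext u
  have := congrArg (fun p => (p.coeff u).coeff j) hci
  simp only [hc, finsetSum_coeff, coeff_mul_C, coeff_map, coeff_zero, coeff_C_mul, coeff_X_pow]
    at this
  rw [Finset.sum_eq_single j] at this
  · simpa using this
  · intro b _ hb; simp [Fin.val_inj, hb.symm]
  · simp


/-- the residue-class section of a polynomial, evaluated at `X ^ M`. -/
noncomputable def wlSec {E : Type*} [Field E] (M V u : ℕ) : E[X] →ₗ[E] E[X] :=
  ∑ w ∈ Finset.range V, (monomial (M * w)) ∘ₗ (lcoeff E (u + M * w))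

theorem wlSec_apply {E : Type*} [Field E] (M V u : ℕ) (P : E[X]) :
    wlSec M V u P = ∑ w ∈ Finset.range V, C (P.coeff (u + M * w)) * X ^ (M * w) := by
  simp [wlSec, C_mul_X_pow_eq_monomial]

theorem wlSec_sum {E : Type*} [Field E] {M V : ℕ} (hM : 0 < M) (P : E[X])
    (hP : P.natDegree < M * V) :
    P = ∑ u ∈ Finset.range M, X ^ u * wlSec M V u P := by
  ext n
  simp only [wlSec_apply, finsetSum_coeff, coeff_X_pow_mul', coeff_C_mul, coeff_X_pow]
  rw [Finset.sum_eq_single (n % M)]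
  · rw [if_pos (Nat.mod_le n M), Finset.sum_eq_single (n / M)]
    · have h1 := Nat.mod_add_div n M
      rw [h1, if_pos (by omega), mul_one]
    · intro w _ hw
      rw [if_neg, mul_zero]
      intro h
      have h1 := Nat.mod_add_div n M
      have h2 : M * (n / M) = M * w := by have := Nat.mod_le n M; omega
      exact hw (Nat.eq_of_mul_eq_mul_left hM h2).symm
    · intro hw
      have h1 := Nat.mod_add_div n M
      rw [h1, coeff_eq_zero_of_natDegree_lt, zero_mul]
      rw [Finset.mem_range, not_lt] at hw
      have := Nat.mul_le_mul_left M hw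
      omega
  · intro u hu hne
    rw [Finset.mem_range] at hu
    split_ifs with hle
    · apply Finset.sum_eq_zero
      intro w _
      rw [if_neg, mul_zero]
      intro h
      apply hne
      have : n = u + M * w := by omega
      rw [this, Nat.add_mul_mod_self_left, Nat.mod_eq_of_lt hu]
    · rfl
  · intro h
    exact absurd (Finset.mem_range.mpr (Nat.mod_lt _ hM)) h

theorem wl_div {E : Type*} [Field E] {p s : ℕ} [Fact p.Prime] [CharP E p]
    {d c M J V : ℕ} (hMp : M = p ^ s) (hd : 0 < d)
    (F : E[X]) (ζ x : E) (hx : x ^ (M * M) = x) (hζ : F.eval x ^ (c * (M + 1)) = ζ)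
    (hFx : F.eval x ≠ 0)
    (h : Fin d → Fin J → E[X])
    (hdeg : ∀ i j, (h i j * F ^ (c * (i : ℕ))).natDegree < M * V)
    (hker : ∀ u < M, ∑ i : Fin d, ∑ j : Fin J, wlSec M V u (h i j * F ^ (c * (i : ℕ))) *
      (C (ζ ^ (i : ℕ)) * X ^ (j : ℕ) * F ^ ((d - 1 - i) * c)) = 0) :
    (X - C x) ^ M ∣ ∑ i, ∑ j, h i j * X ^ (M * M * (j : ℕ)) * F ^ (c * (M + 1) * (i : ℕ)) := by
  have hM : 0 < M := by rw [hMp]; exact pow_pos (Fact.out : p.Prime).pos _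
  set I : Ideal E[X] := Ideal.span {(X - C x) ^ M} with hI
  set π := Ideal.Quotient.mk I with hπ
  have hker0 : ∀ P : E[X], π P = 0 ↔ (X - C x) ^ M ∣ P := by
    intro P; rw [hπ, Ideal.Quotient.eq_zero_iff_mem, hI, Ideal.mem_span_singleton]
  have hpowM : ∀ P : E[X], π P ^ M = π (C (P.eval x ^ M)) := by
    intro P
    rw [← map_pow, ← sub_eq_zero, ← map_sub, hker0, C_pow, hMp, ← sub_pow_char_pow]
    exact pow_dvd_pow_of_dvd (X_sub_C_dvd_sub_C_eval) _
  have hsec : ∀ (P : E[X]) (u : ℕ), π (wlSec M V u P) = π (C ((wlSec M V u P).eval x)) := by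
    intro P u
    rw [wlSec_apply, eval_finsetSum, map_sum, map_sum, map_sum]
    refine Finset.sum_congr rfl fun w _ => ?_
    rw [map_mul, pow_mul, map_pow, map_pow, hpowM, ← map_pow, ← map_mul, ← C_pow, ← C_mul]
    simp
  have hxj : ∀ j : ℕ, x ^ (M * M * j) = x ^ j := by
    intro j; rw [pow_mul, hx]
  rw [← hker0]
  have hu : IsUnit (π (C (F.eval x ^ ((d - 1) * c)))) := by
    apply IsUnit.map; exact isUnit_C.mpr (pow_ne_zero _ hFx).isUnit
  rw [← hu.mul_right_eq_zero]
  have key : ∀ (i : Fin d) (j : Fin J),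
      π (C (F.eval x ^ ((d - 1) * c))) *
        π (h i j * X ^ (M * M * (j : ℕ)) * F ^ (c * (M + 1) * (i : ℕ))) =
      ∑ u ∈ Finset.range M, π (X ^ u) * π (C ((wlSec M V u (h i j * F ^ (c * (i : ℕ))) *
      (C (ζ ^ (i : ℕ)) * X ^ (j : ℕ) * F ^ ((d - 1 - i) * c))).eval x)) := by
    intro i j
    have e1 : π (h i j * X ^ (M * M * (j : ℕ)) * F ^ (c * (M + 1) * (i : ℕ))) =
        π (h i j * F ^ (c * (i : ℕ))) * π (C (x ^ (j : ℕ) * F.eval x ^ (M * (c * i)))) := by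
      have a1 : π (X ^ (M * M * (j : ℕ))) = π (C (x ^ (j : ℕ))) := by
        rw [← hxj, mul_assoc, pow_mul, map_pow, map_pow, hpowM, ← map_pow, ← C_pow, eval_X,
          ← pow_mul]
      have a2 : π (F ^ (c * (M + 1) * (i : ℕ))) =
          π (C (F.eval x ^ (M * (c * i)))) * π (F ^ (c * (i : ℕ))) := by
        rw [show c * (M + 1) * (i : ℕ) = M * (c * i) + c * i by ring, pow_add, map_mul, pow_mul,
          map_pow, map_pow, hpowM, ← map_pow, ← C_pow, ← pow_mul]
      rw [map_mul, map_mul, a1, a2, C_mul, map_mul, map_mul]; ring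
    rw [e1]
    conv_lhs => rw [wlSec_sum hM _ (hdeg i j)]
    rw [map_sum, Finset.sum_mul, Finset.mul_sum]
    refine Finset.sum_congr rfl fun u _ => ?_
    rw [map_mul, hsec]
    have e2 : F.eval x ^ ((d - 1) * c) * F.eval x ^ (M * (c * i)) =
        ζ ^ (i : ℕ) * F.eval x ^ ((d - 1 - i) * c) := by
      rw [← hζ, ← pow_mul, ← pow_add, ← pow_add]
      congr 1
      obtain ⟨t, ht⟩ : ∃ t, d = i + 1 + t := ⟨d - (i + 1), by have := i.2; omega⟩
      have h1 : d - 1 - i = t := by omega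
      have h2 : d - 1 = i + t := by omega
      rw [h1, h2]; ring
    have e3 : (wlSec M V u (h i j * F ^ (c * (i : ℕ))) *
      (C (ζ ^ (i : ℕ)) * X ^ (j : ℕ) * F ^ ((d - 1 - i) * c))).eval x =
        F.eval x ^ ((d - 1) * c) * ((wlSec M V u (h i j * F ^ (c * (i : ℕ)))).eval x *
          (x ^ (j : ℕ) * F.eval x ^ (M * (c * i)))) := by
      have : F.eval x ^ ((d - 1) * c) * ((wlSec M V u (h i j * F ^ (c * (i : ℕ)))).eval x *
          (x ^ (j : ℕ) * F.eval x ^ (M * (c * i)))) =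
          (F.eval x ^ ((d - 1) * c) * F.eval x ^ (M * (c * i))) *
          ((wlSec M V u (h i j * F ^ (c * (i : ℕ)))).eval x * x ^ (j : ℕ)) := by ring
      rw [this, e2]
      simp; ring
    rw [e3]
    generalize (wlSec M V u (h i j * F ^ (c * (i : ℕ)))).eval x = A
    simp only [C_mul, map_mul]
    ring
  rw [map_sum, Finset.mul_sum]
  simp_rw [map_sum, Finset.mul_sum, key]
  have : ∀ u ∈ Finset.range M, ∑ i : Fin d, ∑ j : Fin J,
      π (X ^ u) * π (C ((wlSec M V u (h i j * F ^ (c * (i : ℕ))) *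
      (C (ζ ^ (i : ℕ)) * X ^ (j : ℕ) * F ^ ((d - 1 - i) * c))).eval x)) = 0 := by
    intro u hu
    have := congrArg (fun P => π (X ^ u) * π (C (P.eval x))) (hker u (Finset.mem_range.mp hu))
    simp only [eval_finsetSum, map_sum, Finset.mul_sum] at this
    rw [this]; simp
  rw [← Finset.sum_eq_zero this, Finset.sum_comm]
  conv_rhs => rw [Finset.sum_comm]
  rw [Finset.sum_comm]
  refine Finset.sum_congr rfl fun i _ => ?_
  rw [Finset.sum_comm]


theorem wlSec_natDegree {E : Type*} [Field E] (M V u : ℕ) (P : E[X]) :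
    (wlSec M V u P).natDegree ≤ M * (V - 1) := by
  rw [wlSec_apply]
  apply natDegree_sum_le_of_forall_le
  intro w hw
  refine (natDegree_C_mul_X_pow_le _ _).trans ?_
  rw [Finset.mem_range] at hw
  exact Nat.mul_le_mul_left _ (by omega)

theorem wl_exists_kernel {E : Type*} [Field E] {d J B M V Ecnt c : ℕ} (F : E[X]) (ζ : E)
    (hcount : M * Ecnt < d * (J * B)) (hE : M * (V - 1) + (J + (d - 1) * c * F.natDegree) ≤ Ecnt)
    (hB : 0 < B) :
    ∃ h : Fin d → Fin J → E[X], (∀ i j, (h i j).natDegree ≤ B - 1) ∧ (∃ i j, h i j ≠ 0) ∧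
    ∀ u < M, ∑ i : Fin d, ∑ j : Fin J, wlSec M V u (h i j * F ^ (c * (i : ℕ))) *
      (C (ζ ^ (i : ℕ)) * X ^ (j : ℕ) * F ^ ((d - 1 - i) * c)) = 0 := by
  classical
  let hL : Fin d → Fin J → ((Fin d × Fin J × Fin B → E) →ₗ[E] E[X]) := fun i j =>
    ∑ k : Fin B, (monomial (k : ℕ)) ∘ₗ (LinearMap.proj (i, j, k))
  let Ψ : ℕ → ((Fin d × Fin J × Fin B → E) →ₗ[E] E[X]) := fun u =>
    ∑ i : Fin d, ∑ j : Fin J,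
      (LinearMap.mulRight E (C (ζ ^ (i : ℕ)) * X ^ (j : ℕ) * F ^ ((d - 1 - i) * c))) ∘ₗ
      (wlSec M V u) ∘ₗ (LinearMap.mulRight E (F ^ (c * (i : ℕ)))) ∘ₗ hL i j
  let T : (Fin d × Fin J × Fin B → E) →ₗ[E] (Fin M × Fin Ecnt → E) :=
    LinearMap.pi fun ue => (lcoeff E (ue.2 : ℕ)) ∘ₗ Ψ (ue.1 : ℕ)
  have hne : LinearMap.ker T ≠ ⊥ := by
    apply LinearMap.ker_ne_bot_of_finrank_lt
    simpa using hcount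
  obtain ⟨a, haT, ha0⟩ := (Submodule.ne_bot_iff _).mp hne
  have hLco : ∀ i j (k : Fin B), (hL i j a).coeff k = a (i, j, k) := by
    intro i j k
    simp only [hL, LinearMap.sum_apply, LinearMap.comp_apply, finsetSum_coeff, coeff_monomial,
      LinearMap.proj_apply]
    rw [Finset.sum_eq_single k]
    · simp
    · intro b _ hb
      rw [if_neg]
      exact fun h => hb (Fin.ext h)
    · simp
  have hLdeg : ∀ i j, (hL i j a).natDegree ≤ B - 1 := by
    intro i j
    simp only [hL, LinearMap.sum_apply, LinearMap.comp_apply]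
    apply natDegree_sum_le_of_forall_le
    intro k _
    refine (natDegree_monomial_le _).trans ?_
    have := k.2; omega
  refine ⟨fun i j => hL i j a, hLdeg, ?_, ?_⟩
  · by_contra hcon
    push Not at hcon
    apply ha0
    ext ⟨i, j, k⟩
    rw [← hLco, hcon]; simp
  · intro u hu
    have hΨ : ∑ i : Fin d, ∑ j : Fin J, wlSec M V u (hL i j a * F ^ (c * (i : ℕ))) *
      (C (ζ ^ (i : ℕ)) * X ^ (j : ℕ) * F ^ ((d - 1 - i) * c)) = Ψ u a := by
      simp only [Ψ, LinearMap.sum_apply, LinearMap.comp_apply, LinearMap.mulRight_apply]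
    have hdeg : (Ψ u a).natDegree < Ecnt ∨ Ψ u a = 0 := by
      by_cases hJ : J = 0
      · right
        subst hJ
        simp [Ψ]
      left
      refine lt_of_le_of_lt ?_ (Nat.sub_one_lt (show Ecnt ≠ 0 by omega))
      rw [← hΨ]
      apply natDegree_sum_le_of_forall_le
      intro i _
      apply natDegree_sum_le_of_forall_le
      intro j _
      have h1 := wlSec_natDegree M V u (hL i j a * F ^ (c * (i : ℕ)))
      have h2 : (C (ζ ^ (i : ℕ)) * X ^ (j : ℕ)).natDegree ≤ J - 1 := by
        refine (natDegree_C_mul_X_pow_le _ _).trans ?_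
        have := j.2; omega
      have h3 : (F ^ ((d - 1 - i) * c)).natDegree ≤ (d - 1) * c * F.natDegree := by
        refine natDegree_pow_le.trans ?_
        apply Nat.mul_le_mul_right
        apply Nat.mul_le_mul_right
        omega
      have h4 := (natDegree_mul_le (p := C (ζ ^ (i : ℕ)) * X ^ (j : ℕ))
        (q := F ^ ((d - 1 - i) * c)))
      refine (natDegree_mul_le).trans ?_
      omega
    rw [hΨ]
    rcases hdeg with hdeg | hdeg
    · ext e
      rw [coeff_zero]
      by_cases he : e < Ecnt
      · have := congrFun (LinearMap.mem_ker.mp haT) (⟨u, hu⟩, ⟨e, he⟩)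
        simpa [T] using this
      · exact coeff_eq_zero_of_natDegree_lt (by omega)
    · exact hdeg

theorem wl_stepanov {E : Type*} [Field E] {p s : ℕ} [Fact p.Prime] [CharP E p]
    {d c M N : ℕ} (hMp : M = p ^ s) (hd : 0 < d) (hM : M = d * c + 1)
    {ζ0 : E} (hζ0 : IsPrimitiveRoot ζ0 d)
    (F : E[X]) (hF0 : F ≠ 0) (hFN : F.natDegree ≤ N)
    (hexp : expand E (M * M) F = F ^ (M * M))
    (hp : ∀ l : ℕ, l.Prime → l ∣ d → ∃ (β : E) (e : ℕ) (G : E[X]),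
      F = (X - C β) ^ e * G ∧ G.eval β ≠ 0 ∧ ¬ l ∣ e)
    (hlarge : 2 * (2 * N + 3 + d * N) ≤ M)
    (ζ : E) (hζ : ζ ≠ 0) (A : Finset E)
    (hA : ∀ x ∈ A, x ^ (M * M) = x ∧ F.eval x ^ (c * (M + 1)) = ζ) :
    A.card ≤ M * (c + 3 * N + 2) := by
  have hc : 0 < c := by
    rcases Nat.eq_zero_or_pos c with rfl | h
    · omega
    · exact h
  have hdc : (d - 1) * c + c = d * c := by
    obtain ⟨t, rfl⟩ : ∃ t, d = t + 1 := ⟨d - 1, by omega⟩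
    simp; ring
  have hcM : c < M := by nlinarith
  have hBN : N + 1 ≤ c * (M + 1) := by nlinarith
  obtain ⟨b, hb⟩ : ∃ b, c * (M + 1) = b + 1 + N := ⟨c * (M + 1) - (N + 1), by omega⟩
  have hMM : d * (c * (M + 1)) + 1 = M * M := by rw [hM]; ring
  have hdcN : (d - 1) * c * F.natDegree ≤ M * N :=
    Nat.mul_le_mul (by omega) hFN
  obtain ⟨h, hdeg, hne, hker⟩ := wl_exists_kernel (d := d) (J := c + 2 * N + 2) (B := b + 1)
    (M := M) (V := c + N + 1) (Ecnt := M * (c + 2 * N) + (c + 2 * N + 2)) (c := c) F ζ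
    (by
      have e1 : d * ((c + 2 * N + 2) * (b + 1)) + (c + 2 * N + 2) * (1 + d * N)
          = (c + 2 * N + 2) * (M * M) := by
        rw [← hMM, hb]; ring
      have e2 : M * (M * (c + 2 * N) + (c + 2 * N + 2)) + (c + 2 * N + 2) * (1 + d * N) <
          (c + 2 * N + 2) * (M * M) := by
        have : (c + 2 * N + 2) * (M + (1 + d * N)) < 2 * (M * M) := by
          have h1 : (c + 2 * N + 2) * (M + (1 + d * N)) ≤ (M + (2 * N + 2)) * (M + (1 + d * N)) :=
            Nat.mul_le_mul_right _ (by omega)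
          nlinarith
        nlinarith
      omega)
    (by
      have : M * (c + N + 1 - 1) = M * (c + N) := rfl
      rw [this]
      nlinarith) (by omega)
  simp only [Nat.add_sub_cancel] at hdeg
  set Φ : E[X] := ∑ i, ∑ j, h i j * X ^ (M * M * (j : ℕ)) * F ^ (c * (M + 1) * (i : ℕ)) with hΦ
  have hΦ0 : Φ ≠ 0 := by
    intro h0
    obtain ⟨i, j, hij⟩ := hne
    apply hij
    refine wl_nonvanish (B := b) (N := N) (e := c * (M + 1)) hd hζ0 F hF0 hFN hMM hexp hp ?_ h hdeg h0 i j
    rw [← hMM, hb]; nlinarith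
  have hdvd : ∏ x ∈ A, (X - C x) ^ M ∣ Φ := by
    apply Finset.prod_dvd_of_coprime
    · intro x _ y _ hxy
      apply IsCoprime.pow
      exact isCoprime_X_sub_C_of_isUnit_sub (sub_ne_zero.mpr hxy).isUnit
    · intro x hx
      obtain ⟨h1, h2⟩ := hA x hx
      refine wl_div (V := c + N + 1) hMp hd F ζ x h1 h2 ?_ h ?_ hker
      · intro h0
        rw [h0, zero_pow (by positivity)] at h2
        exact hζ h2.symm
      · intro i j
        refine lt_of_le_of_lt natDegree_mul_le ?_
        have h3 : (F ^ (c * (i : ℕ))).natDegree ≤ M * N := by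
          refine natDegree_pow_le.trans (Nat.mul_le_mul ?_ hFN)
          have : c * (i : ℕ) ≤ c * d := Nat.mul_le_mul_left _ i.2.le
          nlinarith
        have := hdeg i j
        nlinarith
  have hΦdeg : Φ.natDegree ≤ (M * M) * (c + 2 * N + 2 + N) := by
    apply natDegree_sum_le_of_forall_le
    intro i _
    apply natDegree_sum_le_of_forall_le
    intro j _
    refine natDegree_mul_le.trans ?_
    have h1 : (h i j * X ^ (M * M * (j : ℕ))).natDegree ≤ b + M * M * (c + 2 * N + 1) := by
      refine natDegree_mul_le.trans (Nat.add_le_add (hdeg i j) ?_)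
      rw [natDegree_X_pow]
      apply Nat.mul_le_mul_left
      have := j.2; omega
    have h2 : (F ^ (c * (M + 1) * (i : ℕ))).natDegree ≤ M * M * N := by
      refine natDegree_pow_le.trans (Nat.mul_le_mul ?_ hFN)
      have : c * (M + 1) * (i : ℕ) ≤ c * (M + 1) * d := Nat.mul_le_mul_left _ i.2.le
      nlinarith
    have h3 : b ≤ M * M := by nlinarith
    nlinarith
  have h5 := natDegree_le_of_dvd hdvd hΦ0
  rw [natDegree_prod _ _ (fun x _ => pow_ne_zero _ (X_sub_C_ne_zero x))] at h5
  simp only [natDegree_pow, natDegree_X_sub_C, mul_one, Finset.sum_const, smul_eq_mul] at h5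
  have h6 : M * A.card ≤ M * (M * (c + 3 * N + 2)) := by nlinarith
  exact Nat.le_of_mul_le_mul_left h6 (by omega)


/-- the points of the algebraically closed field `E` fixed by `x ↦ x ^ (Q ^ m)`. -/
noncomputable def wlOm (L E : Type*) [Field L] [Fintype L] [Field E] (m : ℕ) : Finset E :=
  by classical exact (X ^ (Fintype.card L ^ m) - X : E[X]).roots.toFinset

/-- inverse of the inclusion `L → E`. -/
noncomputable def wlInv (L : Type*) {E : Type*} [Field L] [Field E] [Algebra L E] (y : E) : L :=
  Function.invFun (algebraMap L E) y

section
variable {L E : Type*} [Field L] [Fintype L] [Field E] [Algebra L E]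

theorem wlInv_algebraMap (a : L) : wlInv L (algebraMap L E a) = a :=
  Function.leftInverse_invFun (algebraMap L E).injective a

theorem wl_card_gt : 1 < Fintype.card L := Fintype.one_lt_card

theorem wl_poly_ne {m : ℕ} (hm : 0 < m) : (X ^ (Fintype.card L ^ m) - X : E[X]) ≠ 0 :=
  FiniteField.X_pow_card_pow_sub_X_ne_zero E hm.ne' wl_card_gt

theorem wl_mem_Om {m : ℕ} (hm : 0 < m) (x : E) :
    x ∈ wlOm L E m ↔ x ^ (Fintype.card L ^ m) = x := by
  classical
  rw [wlOm, Multiset.mem_toFinset, mem_roots (wl_poly_ne (L := L) hm)]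
  simp [sub_eq_zero]

theorem wl_charP : ∃ p f : ℕ, p.Prime ∧ CharP E p ∧ CharP L p ∧ 0 < f ∧ Fintype.card L = p ^ f := by
  obtain ⟨p, hp⟩ := CharP.exists L
  obtain ⟨n, hn1, hn2⟩ := FiniteField.card L p
  have hpE : CharP E p := charP_of_injective_algebraMap (algebraMap L E).injective p
  exact ⟨p, n, hn1, hpE, hp, n.2, hn2⟩

theorem wl_card_Om [IsAlgClosed E] {m : ℕ} (hm : 0 < m) :
    (wlOm L E m).card = Fintype.card L ^ m := by
  classical
  obtain ⟨p, f, hp, hE, -, hf, hQ⟩ := wl_charP (L := L) (E := E)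
  have hsep : (X ^ (Fintype.card L ^ m) - X : E[X]).Separable := by
    apply galois_poly_separable p
    rw [hQ, ← pow_mul]
    exact dvd_pow_self _ (by positivity)
  rw [wlOm, Multiset.toFinset_card_of_nodup (nodup_roots hsep)]
  have h1 := (IsAlgClosed.splits (X ^ (Fintype.card L ^ m) - X : E[X])).natDegree_eq_card_roots
  rw [← h1, FiniteField.X_pow_card_pow_sub_X_natDegree_eq E hm.ne' wl_card_gt]

theorem wl_inv_spec {y : E} (hy : y ^ Fintype.card L = y) : algebraMap L E (wlInv L y) = y := by
  classical
  apply Function.invFun_eq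
  by_contra hcon
  push Not at hcon
  have hP := wl_poly_ne (L := L) (E := E) one_pos
  have h1 : (insert y (Finset.univ.image (algebraMap L E))) ⊆ wlOm L E 1 := by
    intro z hz
    rw [wl_mem_Om one_pos, pow_one]
    rw [Finset.mem_insert, Finset.mem_image] at hz
    rcases hz with rfl | ⟨a, -, rfl⟩
    · exact hy
    · rw [← map_pow, FiniteField.pow_card]
  have h2 := Finset.card_le_card h1
  rw [Finset.card_insert_of_notMem, Finset.card_image_of_injective _ (algebraMap L E).injective,
    Finset.card_univ] at h2
  · have h3 : (wlOm L E 1).card ≤ Fintype.card L := by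
      rw [wlOm]
      refine (Multiset.toFinset_card_le _).trans ((card_roots' _).trans ?_)
      rw [FiniteField.X_pow_card_pow_sub_X_natDegree_eq E one_ne_zero wl_card_gt, pow_one]
    omega
  · simp only [Finset.mem_image, Finset.mem_univ, true_and, not_exists]
    exact hcon

theorem wl_frob_add (i : ℕ) (x y : E) :
    (x + y) ^ (Fintype.card L ^ i) = x ^ (Fintype.card L ^ i) + y ^ (Fintype.card L ^ i) := by
  obtain ⟨p, f, hp, hE, -, hf, hQ⟩ := wl_charP (L := L) (E := E)
  have : Fact p.Prime := ⟨hp⟩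
  rw [hQ, ← pow_mul, add_pow_char_pow]

theorem wl_frob_sub (i : ℕ) (x y : E) :
    (x - y) ^ (Fintype.card L ^ i) = x ^ (Fintype.card L ^ i) - y ^ (Fintype.card L ^ i) := by
  obtain ⟨p, f, hp, hE, -, hf, hQ⟩ := wl_charP (L := L) (E := E)
  have : Fact p.Prime := ⟨hp⟩
  rw [hQ, ← pow_mul, sub_pow_char_pow]

theorem wl_frob_sum {ι : Type*} (s : Finset ι) (g : ι → E) (i : ℕ) :
    (∑ j ∈ s, g j) ^ (Fintype.card L ^ i) = ∑ j ∈ s, g j ^ (Fintype.card L ^ i) := by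
  classical
  induction s using Finset.induction_on with
  | empty => simp [Fintype.card_ne_zero]
  | insert a s ha ih => rw [Finset.sum_insert ha, Finset.sum_insert ha, wl_frob_add, ih]

theorem wl_expand (F : L[X]) (i : ℕ) :
    expand L (Fintype.card L ^ i) F = F ^ (Fintype.card L ^ i) := by
  induction i with
  | zero => simp
  | succ i ih => rw [pow_succ, expand_mul, FiniteField.expand_card, map_pow, ih, pow_mul]

theorem wl_aeval_frob (F : L[X]) (i : ℕ) (x : E) :
    aeval x F ^ (Fintype.card L ^ i) = aeval (x ^ (Fintype.card L ^ i)) F := by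
  rw [← map_pow, ← wl_expand, expand_aeval]

theorem wl_chi_expand (χ : MulChar L ℂ) (hχ : χ ≠ 1) :
    ∃ (ω : L) (ξ : ℂ), IsPrimitiveRoot ω (orderOf χ) ∧ ‖ξ‖ = 1 ∧
      ∑ i ∈ Finset.range (orderOf χ), ξ ^ i = 0 ∧
      ∀ a : L, a ≠ 0 → ∃ i < orderOf χ, χ a = ξ ^ i ∧
        a ^ ((Fintype.card L - 1) / orderOf χ) = ω ^ i := by
  classical
  obtain ⟨γ, hγ⟩ := IsCyclic.exists_generator (α := Lˣ)
  set d := orderOf χ with hd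
  have hdpos : 0 < d := orderOf_pos χ
  have hdQ : d ∣ Fintype.card L - 1 := MulChar.orderOf_dvd_card_sub_one L χ
  obtain ⟨e, he⟩ := hdQ
  have hQ1 := wl_card_gt (L := L)
  have hee : (Fintype.card L - 1) / d = e := by rw [he]; exact Nat.mul_div_cancel_left e hdpos
  have hordγ : orderOf γ = Fintype.card L - 1 := by
    rw [orderOf_eq_card_of_forall_mem_zpowers hγ, Nat.card_eq_fintype_card, Fintype.card_units]
  have hξd : χ γ ^ d = 1 := by
    rw [← MulChar.pow_apply_coe, hd, pow_orderOf_eq_one]; simp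
  have hξ1 : χ γ ≠ 1 := by
    intro h
    apply hχ
    rw [MulChar.eq_iff hγ, h]; simp
  refine ⟨((γ ^ e : Lˣ) : L), χ γ, ?_, ?_, ?_, ?_⟩
  · rw [IsPrimitiveRoot.coe_units_iff]
    have h1 := IsPrimitiveRoot.orderOf γ
    rw [hordγ, he] at h1
    exact h1.pow (by rw [← he]; omega) (mul_comm _ _)
  · exact Complex.norm_eq_one_of_pow_eq_one hξd hdpos.ne'
  · have := mul_neg_geom_sum (χ γ) d
    rw [hξd, sub_self] at this
    rcases mul_eq_zero.mp this with h | h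
    · exact absurd (sub_eq_zero.mp h).symm hξ1
    · exact h
  · intro a ha
    obtain ⟨k, hk⟩ := (mem_powers_iff_mem_zpowers).mpr (hγ (Units.mk0 a ha))
    have hk' : (γ : L) ^ k = a := by
      have := congrArg (Units.val) hk
      simpa using this
    refine ⟨k % d, Nat.mod_lt _ hdpos, ?_, ?_⟩
    · rw [← hk', map_pow, ← pow_mod_orderOf]
      rw [← pow_mod_orderOf (χ γ) (k % d)]
      congr 1
      rw [Nat.mod_mod_of_dvd _ (orderOf_dvd_of_pow_eq_one hξd)]
    · rw [hee, ← hk', ← pow_mul, Units.val_pow_eq_pow_val, ← pow_mul]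
      rw [← Units.val_pow_eq_pow_val, ← Units.val_pow_eq_pow_val]
      congr 1
      rw [pow_eq_pow_iff_modEq, hordγ, he, mul_comm k e, mul_comm d e]
      exact (Nat.mod_modEq k d).symm.mul_left' e

end


/-- the exponent `1 + Q + ... + Q ^ (m - 1)` of the norm. -/
def wlNm (L : Type*) [Fintype L] (m : ℕ) : ℕ := ∑ i ∈ Finset.range m, Fintype.card L ^ i

section
variable {L E : Type*} [Field L] [Fintype L] [Field E] [Algebra L E]

theorem wlNm_mul (m : ℕ) : (Fintype.card L - 1) * wlNm L m + 1 = Fintype.card L ^ m := by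
  have h1 := wl_card_gt (L := L)
  have h := Nat.geomSum_eq (m := Fintype.card L) h1 m
  have h2 : Fintype.card L - 1 ∣ Fintype.card L ^ m - 1 := by
    simpa using Nat.sub_dvd_pow_sub_pow (Fintype.card L) 1 m
  have h3 : 1 ≤ Fintype.card L ^ m := Nat.one_le_pow _ _ (by omega)
  rw [wlNm, h, Nat.mul_div_cancel' h2]
  omega

theorem wl_norm_fixed {m : ℕ} {y : E} (hy : y ^ (Fintype.card L ^ m) = y) :
    (y ^ wlNm L m) ^ Fintype.card L = y ^ wlNm L m := by
  by_cases h0 : y = 0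
  · subst h0
    rw [← pow_mul]
    rcases Nat.eq_zero_or_pos (wlNm L m) with h | h
    · simp [h]
    · rw [zero_pow h.ne', zero_pow]
      exact Nat.mul_ne_zero h.ne' Fintype.card_ne_zero
  · have h1 := wl_card_gt (L := L)
    have h2 : y ^ ((Fintype.card L - 1) * wlNm L m) = 1 := by
      have := wlNm_mul (L := L) m
      rw [← this, pow_succ] at hy
      exact (mul_eq_right₀ h0).mp hy
    rw [← pow_mul]
    have h3 : wlNm L m * Fintype.card L = (Fintype.card L - 1) * wlNm L m + wlNm L m := by
      obtain ⟨t, ht⟩ : ∃ t, Fintype.card L = t + 1 := ⟨Fintype.card L - 1, by omega⟩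
      rw [ht]; simp; ring
    rw [h3, pow_add, h2, one_mul]

theorem wl_char_bound [IsAlgClosed E] (χ : MulChar L ℂ) (hχ : χ ≠ 1) (F : L[X]) (hF0 : F ≠ 0)
    (hp : ∀ l : ℕ, l.Prime → l ∣ orderOf χ → ∃ (β : E) (e : ℕ) (G : E[X]),
      F.map (algebraMap L E) = (X - C β) ^ e * G ∧ G.eval β ≠ 0 ∧ ¬ l ∣ e) :
    ∃ (K : ℝ) (s0 : ℕ), ∀ s ≥ s0,
      ‖∑ x ∈ wlOm L E (2 * s), χ (wlInv L ((aeval x F) ^ wlNm L (2 * s)))‖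
        ≤ K * (Fintype.card L : ℝ) ^ s := by
  classical
  obtain ⟨ω, ξ, hω, hξ, hξs, hχω⟩ := wl_chi_expand χ hχ
  obtain ⟨p, f, hpp, hE, -, hf, hQ⟩ := wl_charP (L := L) (E := E)
  have : Fact p.Prime := ⟨hpp⟩
  set d := orderOf χ with hd
  have hdpos : 0 < d := orderOf_pos χ
  obtain ⟨e, he⟩ : d ∣ Fintype.card L - 1 := MulChar.orderOf_dvd_card_sub_one L χ
  have hQ1 := wl_card_gt (L := L)
  have hee : (Fintype.card L - 1) / d = e := by rw [he]; exact Nat.mul_div_cancel_left e hdpos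
  rw [hee] at hχω
  have hepos : 0 < e := by
    rcases Nat.eq_zero_or_pos e with h | h
    · rw [h] at he; omega
    · exact h
  set N := F.natDegree with hN
  refine ⟨d * (3 * N + 2) + N, 2 * (2 * N + 3 + d * N), fun s hs => ?_⟩
  have hs0 : 0 < s := by omega
  set M := Fintype.card L ^ s with hM
  have hMs : s < M := Nat.lt_pow_self hQ1
  have hMM : M * M = Fintype.card L ^ (2 * s) := by rw [hM]; ring
  obtain ⟨c, hc⟩ : ∃ c, M = d * c + 1 :=
    ⟨e * wlNm L s, by rw [hM, ← wlNm_mul (L := L) s, he]; ring⟩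
  have hexpo : c * (M + 1) = wlNm L (2 * s) * e := by
    apply Nat.eq_of_mul_eq_mul_left hdpos
    have h1 := wlNm_mul (L := L) (2 * s)
    rw [← hMM, he] at h1
    have h2 : M * M = d * (c * (M + 1)) + 1 := by
      conv_lhs => rw [hc]
      conv_rhs => rw [hc]
      ring
    have h3 : d * (wlNm L (2 * s) * e) = d * e * wlNm L (2 * s) := by ring
    omega
  have hω' : IsPrimitiveRoot (algebraMap L E ω) d :=
    hω.map_of_injective (algebraMap L E).injective
  set A : ℕ → Finset E := fun i => (wlOm L E (2 * s)).filter
    (fun x => (aeval x F) ^ (c * (M + 1)) = algebraMap L E (ω ^ i)) with hA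
  set U : ℕ := M * (c + 3 * N + 2) with hU
  have hω0 : ω ≠ 0 := hω.ne_zero hdpos.ne'
  have hAU : ∀ i, (A i).card ≤ U := by
    intro i
    refine wl_stepanov (p := p) (s := f * s) (d := d) (c := c) (M := M) (N := N) ?_ hdpos hc hω'
      (F.map (algebraMap L E)) ?_ ?_ ?_ hp (by omega) (algebraMap L E (ω ^ i)) ?_ (A i) ?_
    · rw [hM, hQ, pow_mul]
    · exact (Polynomial.map_ne_zero_iff (algebraMap L E).injective).mpr hF0
    · exact natDegree_map_le
    · rw [hMM, ← map_expand, wl_expand, Polynomial.map_pow]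
    · simpa using pow_ne_zero i hω0
    · intro x hx
      rw [hA, Finset.mem_filter, wl_mem_Om (by omega), ← hMM] at hx
      refine ⟨hx.1, ?_⟩
      rw [eval_map_algebraMap]
      exact hx.2
  -- pointwise description
  have hpt : ∀ x ∈ wlOm L E (2 * s), aeval x F ≠ 0 → ∃ i < d,
      χ (wlInv L ((aeval x F) ^ wlNm L (2 * s))) = ξ ^ i ∧
      ∀ j < d, ((aeval x F) ^ (c * (M + 1)) = algebraMap L E (ω ^ j) ↔ j = i) := by
    intro x hx h0
    rw [wl_mem_Om (by omega)] at hx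
    have hfix : (aeval x F) ^ (Fintype.card L ^ (2 * s)) = aeval x F := by
      rw [wl_aeval_frob, hx]
    have hsp := wl_inv_spec (wl_norm_fixed hfix)
    set a := wlInv L ((aeval x F) ^ wlNm L (2 * s)) with ha
    have ha0 : a ≠ 0 := by
      intro h
      rw [h, map_zero] at hsp
      exact pow_ne_zero _ h0 hsp.symm
    obtain ⟨i, hi, h1, h2⟩ := hχω a ha0
    refine ⟨i, hi, h1, fun j hj => ?_⟩
    rw [hexpo, pow_mul, ← hsp, ← map_pow, h2, (algebraMap L E).injective.eq_iff]
    exact ⟨fun h => (hω.pow_inj hi hj h).symm, fun h => by rw [h]⟩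
  have hz : ∀ x, aeval x F = 0 → ∀ j, (aeval x F) ^ (c * (M + 1)) ≠ algebraMap L E (ω ^ j) := by
    intro x hx j
    rw [hx, zero_pow]
    · intro h
      exact pow_ne_zero j hω0 ((map_eq_zero _).mp h.symm)
    · have : 0 < wlNm L (2 * s) := by
        rcases Nat.eq_zero_or_pos (wlNm L (2 * s)) with h | h
        · have h1 := wlNm_mul (L := L) (2 * s)
          rw [h, ← hMM] at h1
          nlinarith
        · exact h
      rw [hexpo]
      positivity
  have hsum : ∑ x ∈ wlOm L E (2 * s), χ (wlInv L ((aeval x F) ^ wlNm L (2 * s))) =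
      ∑ i ∈ Finset.range d, ((A i).card : ℂ) * ξ ^ i := by
    have : ∀ i ∈ Finset.range d, ((A i).card : ℂ) * ξ ^ i = ∑ x ∈ wlOm L E (2 * s),
        if (aeval x F) ^ (c * (M + 1)) = algebraMap L E (ω ^ i) then ξ ^ i else 0 := by
      intro i _
      rw [← Finset.sum_filter, Finset.sum_const, nsmul_eq_mul]
    rw [Finset.sum_congr rfl this, Finset.sum_comm]
    refine Finset.sum_congr rfl fun x hx => ?_
    by_cases h0 : aeval x F = 0
    · rw [Finset.sum_eq_zero]
      · have hi0 : wlInv L (0 : E) = (0 : L) := by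
          rw [← map_zero (algebraMap L E)]; exact wlInv_algebraMap 0
        rw [h0, zero_pow, hi0]
        · exact MulChar.map_nonunit χ not_isUnit_zero
        · intro h
          have h1 := wlNm_mul (L := L) (2 * s)
          rw [h, ← hMM] at h1
          nlinarith
      · intro i _
        rw [if_neg (hz x h0 i)]
    · obtain ⟨i, hi, h1, h2⟩ := hpt x hx h0
      rw [h1, Finset.sum_eq_single i]
      · rw [if_pos ((h2 i hi).mpr rfl)]
      · intro j hj hji
        rw [if_neg]
        rw [h2 j (Finset.mem_range.mp hj)]; exact hji
      · intro h; exact absurd (Finset.mem_range.mpr hi) h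
  have hcard : M * M ≤ ∑ i ∈ Finset.range d, (A i).card + N := by
    have h1 : (wlOm L E (2 * s)) ⊆ (Finset.range d).biUnion A ∪
        (F.map (algebraMap L E)).roots.toFinset := by
      intro x hx
      rw [Finset.mem_union]
      by_cases h0 : aeval x F = 0
      · right
        rw [Multiset.mem_toFinset, mem_roots
          ((Polynomial.map_ne_zero_iff (algebraMap L E).injective).mpr hF0)]
        rw [IsRoot, eval_map_algebraMap]; exact h0
      · left
        obtain ⟨i, hi, h1, h2⟩ := hpt x hx h0
        rw [Finset.mem_biUnion]
        exact ⟨i, Finset.mem_range.mpr hi, Finset.mem_filter.mpr ⟨hx, (h2 i hi).mpr rfl⟩⟩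
    have h2 := Finset.card_le_card h1
    rw [wl_card_Om (by omega), ← hMM] at h2
    refine h2.trans ((Finset.card_union_le _ _).trans (Nat.add_le_add Finset.card_biUnion_le ?_))
    refine (Multiset.toFinset_card_le _).trans ((card_roots' _).trans natDegree_map_le)
  have hS : ∑ i ∈ Finset.range d, ((A i).card : ℂ) * ξ ^ i =
      - ∑ i ∈ Finset.range d, ((U - (A i).card : ℝ) : ℂ) * ξ ^ i := by
    rw [← sub_eq_zero, sub_neg_eq_add, ← Finset.sum_add_distrib]
    calc _ = ∑ i ∈ Finset.range d, (U : ℂ) * ξ ^ i := by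
          refine Finset.sum_congr rfl fun i _ => ?_
          push_cast; ring
      _ = 0 := by rw [← Finset.mul_sum, hξs, mul_zero]
  rw [hsum, hS, norm_neg]
  have hb : ‖∑ i ∈ Finset.range d, ((U - (A i).card : ℝ) : ℂ) * ξ ^ i‖ ≤
      ∑ i ∈ Finset.range d, ((U : ℝ) - (A i).card) := by
    refine (norm_sum_le _ _).trans (Finset.sum_le_sum fun i _ => ?_)
    rw [norm_mul, norm_pow, hξ, one_pow, mul_one, Complex.norm_real, Real.norm_of_nonneg]
    have := hAU i
    rw [sub_nonneg]; exact_mod_cast this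
  refine hb.trans ?_
  rw [Finset.sum_sub_distrib, Finset.sum_const, Finset.card_range, nsmul_eq_mul]
  have hcard' : (M : ℝ) * M ≤ ∑ i ∈ Finset.range d, ((A i).card : ℝ) + N := by exact_mod_cast hcard
  have hU' : (U : ℝ) = M * (c + 3 * N + 2) := by rw [hU]; push_cast; ring
  have hM' : (M : ℝ) = d * c + 1 := by exact_mod_cast hc
  have hMr : (Fintype.card L : ℝ) ^ s = M := by rw [hM]; push_cast; rfl
  rw [hMr, hU']
  have hM1 : (1 : ℝ) ≤ M := by exact_mod_cast (by omega : 1 ≤ M)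
  have hN0 : (0 : ℝ) ≤ N := by positivity
  have e1 : (d : ℝ) * (M * (c + 3 * N + 2)) = M * (d * c + 1) - M + M * (d * (3 * N + 2)) := by ring
  rw [← hM'] at e1
  rw [e1]
  nlinarith

end


/-- the trace `x + x ^ Q + ... + x ^ (Q ^ (m - 1))`. -/
def wlTr (L : Type*) {E : Type*} [Fintype L] [Field E] (m : ℕ) (x : E) : E :=
  ∑ i ∈ Finset.range m, x ^ (Fintype.card L ^ i)

/-- the character sum over the degree `m` extension. -/
noncomputable def wlS {L : Type*} (E : Type*) [Field L] [Fintype L] [Field E] [Algebra L E]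
    (χ : MulChar L ℂ) (ψ : AddChar L ℂ) (G : L[X]) (m : ℕ) : ℂ :=
  ∑ x ∈ wlOm L E m, χ (wlInv L ((aeval x G) ^ wlNm L m)) * ψ (wlInv L (wlTr L m x))

section
variable {L E : Type*} [Field L] [Fintype L] [Field E] [Algebra L E]

theorem wl_tr_sub (m : ℕ) (z : E) :
    wlTr L m (z ^ Fintype.card L - z) = z ^ (Fintype.card L ^ m) - z := by
  rw [wlTr]
  induction m with
  | zero => simp
  | succ m ih => rw [Finset.sum_range_succ, ih, wl_frob_sub, ← pow_mul, ← pow_succ']; ring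

theorem wl_tr_fixed {m : ℕ} {x : E} (hx : x ^ (Fintype.card L ^ m) = x) :
    (wlTr L m x) ^ Fintype.card L = wlTr L m x := by
  have h1 := wl_frob_sum (L := L) (Finset.range m) (fun i => x ^ (Fintype.card L ^ i)) 1
  rw [pow_one] at h1
  rw [wlTr, h1]
  have h2 : ∀ i, (x ^ (Fintype.card L ^ i)) ^ Fintype.card L = x ^ (Fintype.card L ^ (i + 1)) := by
    intro i; rw [← pow_mul, ← pow_succ]
  simp_rw [h2]
  have h3 := Finset.sum_range_succ (fun i => x ^ (Fintype.card L ^ i)) m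
  have h4 := Finset.sum_range_succ' (fun i => x ^ (Fintype.card L ^ i)) m
  rw [h3, hx] at h4
  simp only [pow_zero, pow_one] at h4
  exact (add_right_cancel h4).symm

theorem wl_fiber_card [IsAlgClosed E] [DecidableEq E] {m : ℕ} (hm : 0 < m) (x : E) :
    ((wlOm L E m).filter (fun z => z ^ Fintype.card L - z = x)).card =
      if wlTr L m x = 0 then Fintype.card L else 0 := by
  have hQ1 := wl_card_gt (L := L)
  split_ifs with h
  · obtain ⟨z0, hz0⟩ : ∃ z0 : E, z0 ^ Fintype.card L - z0 = x := by
      have hdeg : (X ^ Fintype.card L - X - C x : E[X]).degree ≠ 0 := by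
        rw [degree_sub_C]
        · rw [degree_eq_natDegree (FiniteField.X_pow_card_sub_X_ne_zero E hQ1),
            FiniteField.X_pow_card_sub_X_natDegree_eq E hQ1]
          exact_mod_cast (by omega)
        · rw [degree_eq_natDegree (FiniteField.X_pow_card_sub_X_ne_zero E hQ1),
            FiniteField.X_pow_card_sub_X_natDegree_eq E hQ1]
          exact_mod_cast (by omega)
      obtain ⟨z0, hz0⟩ := IsAlgClosed.exists_root _ hdeg
      refine ⟨z0, ?_⟩
      simpa [sub_eq_zero] using hz0
    have : (wlOm L E m).filter (fun z => z ^ Fintype.card L - z = x) =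
        (wlOm L E 1).image (fun t => z0 + t) := by
      ext z
      rw [Finset.mem_filter, wl_mem_Om hm, Finset.mem_image]
      constructor
      · rintro ⟨-, h2⟩
        refine ⟨z - z0, ?_, by ring⟩
        rw [wl_mem_Om one_pos, wl_frob_sub, pow_one]
        rw [← hz0] at h2
        linear_combination h2
      · rintro ⟨t, ht, rfl⟩
        rw [wl_mem_Om one_pos] at ht
        have h2 : (z0 + t) ^ Fintype.card L - (z0 + t) = x := by
          have := wl_frob_add (L := L) 1 z0 t
          rw [pow_one] at this ht
          rw [this, ht, ← hz0]; ring
        refine ⟨?_, h2⟩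
        rw [← h2, wl_tr_sub] at h
        exact sub_eq_zero.mp h
    rw [this, Finset.card_image_of_injective _ (add_right_injective z0), wl_card_Om one_pos, pow_one]
  · rw [Finset.card_eq_zero, Finset.filter_eq_empty_iff]
    intro z hz hzx
    rw [wl_mem_Om hm] at hz
    apply h
    rw [← hzx, wl_tr_sub, hz, sub_self]

theorem wl_hp_comp [IsAlgClosed E] (G : L[X]) (l : ℕ)
    (h : ∃ (β : E) (e : ℕ) (G' : E[X]),
      G.map (algebraMap L E) = (X - C β) ^ e * G' ∧ G'.eval β ≠ 0 ∧ ¬ l ∣ e) :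
    ∃ (β : E) (e : ℕ) (G' : E[X]),
      (G.comp (X ^ Fintype.card L - X)).map (algebraMap L E) = (X - C β) ^ e * G' ∧
        G'.eval β ≠ 0 ∧ ¬ l ∣ e := by
  obtain ⟨β, e, G', h1, h2, h3⟩ := h
  have hQ1 := wl_card_gt (L := L)
  have hQ0 : (Fintype.card L : E) = 0 := by
    have : (Fintype.card L : L) = 0 := FiniteField.cast_card_eq_zero L
    rw [← map_natCast (algebraMap L E), this, map_zero]
  have hdeg : (X ^ Fintype.card L - X - C β : E[X]).degree ≠ 0 := by
    rw [degree_sub_C]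
    · rw [degree_eq_natDegree (FiniteField.X_pow_card_sub_X_ne_zero E hQ1),
        FiniteField.X_pow_card_sub_X_natDegree_eq E hQ1]
      exact_mod_cast (by omega)
    · rw [degree_eq_natDegree (FiniteField.X_pow_card_sub_X_ne_zero E hQ1),
        FiniteField.X_pow_card_sub_X_natDegree_eq E hQ1]
      exact_mod_cast (by omega)
  obtain ⟨z, hz⟩ := IsAlgClosed.exists_root _ hdeg
  obtain ⟨u, hu⟩ := dvd_iff_isRoot.mpr hz
  have hzβ : z ^ Fintype.card L - z = β := by simpa [sub_eq_zero] using hz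
  have hu0 : u.eval z ≠ 0 := by
    have := congrArg (fun P => (derivative P).eval z) hu
    simp at this
    rw [← this, derivative_X_pow]; simp [hQ0]
  refine ⟨z, e, u ^ e * G'.comp (X ^ Fintype.card L - X), ?_, ?_, h3⟩
  · rw [Polynomial.map_comp, h1, mul_comp, pow_comp, sub_comp, X_comp, C_comp]
    simp only [Polynomial.map_sub, Polynomial.map_pow, map_X]
    rw [hu, mul_pow, mul_assoc]
  · rw [eval_mul, eval_pow, eval_comp]
    apply mul_ne_zero (pow_ne_zero _ hu0)
    simpa [hzβ] using h2

theorem wl_sum_bound [IsAlgClosed E] (χ : MulChar L ℂ) (hχ : χ ≠ 1) (F : L[X]) (hF0 : F ≠ 0)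
    (hp : ∀ l : ℕ, l.Prime → l ∣ orderOf χ → ∃ (β : E) (e : ℕ) (G : E[X]),
      F.map (algebraMap L E) = (X - C β) ^ e * G ∧ G.eval β ≠ 0 ∧ ¬ l ∣ e) :
    ∃ (K : ℝ) (s0 : ℕ), ∀ s ≥ s0,
      ‖∑ ψ : AddChar L ℂ, wlS E χ ψ F (2 * s)‖ ≤ K * (Fintype.card L : ℝ) ^ s := by
  classical
  have hQ1 := wl_card_gt (L := L)
  obtain ⟨K, s0, hK⟩ := wl_char_bound (E := E) χ hχ (F.comp (X ^ Fintype.card L - X))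
    (by
      rw [Ne, comp_eq_zero_iff]
      rintro (h | ⟨-, h⟩)
      · exact hF0 h
      · have := congrArg natDegree h
        rw [FiniteField.X_pow_card_sub_X_natDegree_eq L hQ1, natDegree_C] at this
        omega)
    (fun l hl hld => wl_hp_comp F l (hp l hl hld))
  refine ⟨K, s0 + 1, fun s hs => ?_⟩
  have hm : 0 < 2 * s := by omega
  refine le_of_eq_of_le ?_ (hK s (by omega))
  congr 1
  have h1 : ∑ z ∈ wlOm L E (2 * s), χ (wlInv L ((aeval z (F.comp (X ^ Fintype.card L - X)))
      ^ wlNm L (2 * s))) = ∑ x ∈ wlOm L E (2 * s),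
      ((if wlTr L (2 * s) x = 0 then Fintype.card L else 0 : ℕ) : ℂ) *
      χ (wlInv L ((aeval x F) ^ wlNm L (2 * s))) := by
    rw [← Finset.sum_fiberwise_of_maps_to (s := wlOm L E (2 * s)) (t := wlOm L E (2 * s))
      (g := fun z => z ^ Fintype.card L - z)]
    · refine Finset.sum_congr rfl fun x _ => ?_
      rw [← wl_fiber_card hm x, ← nsmul_eq_mul, ← Finset.sum_const]
      refine Finset.sum_congr rfl fun z hz => ?_
      rw [Finset.mem_filter] at hz
      rw [aeval_comp]
      simp [← hz.2]
    · intro z hz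
      rw [wl_mem_Om hm] at hz ⊢
      rw [wl_frob_sub, hz, ← pow_mul, mul_comm, pow_mul, hz]
  rw [h1]
  simp only [wlS]
  rw [Finset.sum_comm]
  refine Finset.sum_congr rfl fun x hx => ?_
  rw [wl_mem_Om hm] at hx
  rw [← Finset.mul_sum, AddChar.sum_apply_eq_ite, mul_comm]
  congr 1
  have hsp := wl_inv_spec (wl_tr_fixed hx)
  have : wlInv L (wlTr L (2 * s) x) = 0 ↔ wlTr L (2 * s) x = 0 := by
    rw [← map_eq_zero (algebraMap L E), hsp]
  simp [this]

end


theorem wl_multiset_fin {α : Type*} (m : Multiset α) (D : ℕ) (h : m.card = D) :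
    ∃ ω : Fin D → α, Multiset.map ω Finset.univ.val = m := by
  induction m using Quot.inductionOn with
  | _ l =>
    subst h
    refine ⟨fun i => l.get i, ?_⟩
    have h2 := Fin.univ_val_map (fun i : Fin l.length => l.get i)
    refine h2.trans ?_
    rw [List.ofFn_get]
    rfl

theorem wl_newton (A S : ℕ → ℂ) (D : ℕ) (hA0 : A 0 = 1) (hAD : ∀ k, D < k → A k = 0)
    (hrec : ∀ k : ℕ, 0 < k → (k : ℂ) * A k = ∑ a ∈ Finset.range k, A a * S (k - a)) :
    ∃ ω : Fin D → ℂ, ∀ k, 0 < k → S k = - ∑ i, ω i ^ k := by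
  classical
  set P : ℂ[X] := X ^ D + ∑ k ∈ Finset.range D, C (A (D - k)) * X ^ k with hP
  have hlow : (∑ k ∈ Finset.range D, C (A (D - k)) * X ^ k : ℂ[X]).degree < (D : ℕ) := by
    refine (degree_sum_le _ _).trans_lt ?_
    refine (Finset.sup_lt_iff (WithBot.bot_lt_coe D)).mpr ?_
    intro k hk
    refine (degree_C_mul_X_pow_le _ _).trans_lt ?_
    exact WithBot.coe_lt_coe.mpr (Finset.mem_range.mp hk)
  have hmon : P.Monic := monic_X_pow_add hlow
  have hdeg : P.natDegree = D := by
    rw [hP, natDegree_add_eq_left_of_degree_lt, natDegree_X_pow]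
    rwa [degree_X_pow]
  have hcoeff : ∀ k ≤ D, P.coeff k = A (D - k) := by
    intro k hk
    rw [hP, coeff_add, coeff_X_pow, finsetSum_coeff]
    simp only [coeff_C_mul, coeff_X_pow]
    rcases hk.eq_or_lt with rfl | hk
    · rw [Finset.sum_eq_zero, if_pos rfl]
      · simp [hA0]
      · intro j hj
        rw [if_neg, mul_zero]
        exact (Finset.mem_range.mp hj).ne'
    · rw [if_neg hk.ne, Finset.sum_eq_single k]
      · simp
      · intro j _ hj
        rw [if_neg hj.symm, mul_zero]
      · intro h; exact absurd (Finset.mem_range.mpr hk) h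
  have hcard : P.roots.card = P.natDegree :=
    ((IsAlgClosed.splits P).natDegree_eq_card_roots).symm
  obtain ⟨ω, hω⟩ : ∃ ω : Fin D → ℂ, Multiset.map ω Finset.univ.val = P.roots := by
    exact wl_multiset_fin P.roots D (by rw [hcard, hdeg])
  have hAe : ∀ k, A k = (-1) ^ k * MvPolynomial.aeval ω (MvPolynomial.esymm (Fin D) ℂ k) := by
    intro k
    rw [MvPolynomial.aeval_esymm_eq_multiset_esymm, hω]
    by_cases hk : k ≤ D
    · have h1 := coeff_eq_esymm_roots_of_card hcard (k := D - k) (by omega)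
      rw [hcoeff _ (by omega), hdeg, hmon.leadingCoeff, one_mul] at h1
      rwa [show D - (D - k) = k by omega] at h1
    · rw [hAD k (by omega), Multiset.esymm, Multiset.powersetCard_eq_empty, Multiset.map_zero,
        Multiset.sum_zero, mul_zero]
      rw [hcard, hdeg]; omega
  refine ⟨ω, fun k => ?_⟩
  induction k using Nat.strong_induction_on with
  | _ k ih =>
    intro hk
    have hN := congrArg (MvPolynomial.aeval ω) (MvPolynomial.mul_esymm_eq_sum (Fin D) ℂ k)
    rw [Finset.sum_filter, Finset.Nat.sum_antidiagonal_eq_sum_range_succ_mk,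
      Finset.sum_range_succ, if_neg (lt_irrefl _), add_zero] at hN
    rw [Finset.sum_congr rfl (fun a ha => if_pos (Finset.mem_range.mp ha))] at hN
    simp only [map_mul, map_sum, map_pow, map_neg, map_one, map_natCast, MvPolynomial.psum,
      MvPolynomial.aeval_X] at hN
    have h1 := hrec k hk
    have h2 : (k : ℂ) * A k = - ∑ a ∈ Finset.range k, A a * ∑ i, ω i ^ (k - a) := by
      have : (k : ℂ) * A k =
          (-1) ^ k * (k * MvPolynomial.aeval ω (MvPolynomial.esymm (Fin D) ℂ k)) := by
        rw [hAe k]; ring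
      rw [this, hN, ← mul_assoc, ← pow_add, show k + (k + 1) = 2 * k + 1 by ring, pow_succ, pow_mul]
      simp only [even_two, Even.neg_pow, one_pow, one_mul, neg_mul]
      congr 1
      refine Finset.sum_congr rfl fun a _ => ?_
      rw [hAe a]
    rw [h2] at h1
    obtain ⟨k', rfl⟩ : ∃ k', k = k' + 1 := ⟨k - 1, by omega⟩
    rw [Finset.sum_range_succ', Finset.sum_range_succ', hA0, one_mul, one_mul] at h1
    have h3 : ∀ a ∈ Finset.range k', A (a + 1) * S (k' + 1 - (a + 1)) =
        - (A (a + 1) * ∑ i, ω i ^ (k' + 1 - (a + 1))) := by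
      intro a ha
      have := Finset.mem_range.mp ha
      rw [ih _ (by omega) (by omega)]; ring
    rw [Finset.sum_congr rfl h3, Finset.sum_neg_distrib] at h1
    simp only [Nat.sub_zero] at h1
    linear_combination -h1

theorem wl_roots_bound {ι : Type*} [Fintype ι] (ω : ι → ℂ) (b K : ℝ) (s0 : ℕ) (hb : 0 < b)
    (h : ∀ s ≥ s0, ‖∑ i, ω i ^ (2 * s)‖ ≤ K * b ^ s) (i0 : ι) : ‖ω i0‖ ^ 2 ≤ b := by
  classical
  by_cases h0 : ω i0 = 0
  · rw [h0]; simp [hb.le]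
  set z : ι → ℂ := fun i => ω i ^ 2 with hz
  set T : Finset ℂ := (Finset.univ.image z).erase (z i0) with hT
  set P : ℂ[X] := ∏ v ∈ T, (X - C v) with hP
  have hP0 : P.eval (z i0) ≠ 0 := by
    rw [hP, eval_prod, Finset.prod_ne_zero_iff]
    intro v hv
    rw [eval_sub, eval_X, eval_C, sub_ne_zero]
    exact (Finset.ne_of_mem_erase hv).symm
  have hPz : ∀ i, z i ≠ z i0 → P.eval (z i) = 0 := by
    intro i hi
    rw [hP, eval_prod]
    apply Finset.prod_eq_zero (i := z i)
    · exact Finset.mem_erase.mpr ⟨hi, Finset.mem_image_of_mem _ (Finset.mem_univ i)⟩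
    · simp
  set n0 : ℕ := (Finset.univ.filter (fun i => z i = z i0)).card with hn0
  have hn0' : 0 < n0 := Finset.card_pos.mpr ⟨i0, by simp⟩
  have hsum : ∀ s, ∑ i, P.eval (z i) * z i ^ s = n0 * (P.eval (z i0) * z i0 ^ s) := by
    intro s
    rw [← Finset.sum_filter_add_sum_filter_not Finset.univ (fun i => z i = z i0)]
    rw [Finset.sum_eq_zero (s := Finset.univ.filter (fun i => ¬ z i = z i0)), add_zero]
    · rw [Finset.sum_congr rfl (g := fun _ => P.eval (z i0) * z i0 ^ s), Finset.sum_const,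
        nsmul_eq_mul]
      intro i hi
      rw [(Finset.mem_filter.mp hi).2]
    · intro i hi
      rw [hPz i (Finset.mem_filter.mp hi).2, zero_mul]
  set K' : ℝ := ∑ n ∈ Finset.range (P.natDegree + 1), ‖P.coeff n‖ * (K * b ^ n) with hK'
  have hbd : ∀ s ≥ s0, ‖∑ i, P.eval (z i) * z i ^ s‖ ≤ K' * b ^ s := by
    intro s hs
    have : ∑ i, P.eval (z i) * z i ^ s =
        ∑ n ∈ Finset.range (P.natDegree + 1), P.coeff n * ∑ i, ω i ^ (2 * (n + s)) := by
      simp_rw [eval_eq_sum_range, Finset.sum_mul, Finset.mul_sum]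
      rw [Finset.sum_comm]
      refine Finset.sum_congr rfl fun n _ => Finset.sum_congr rfl fun i _ => ?_
      rw [hz]; ring
    rw [this, hK', Finset.sum_mul]
    refine (norm_sum_le _ _).trans (Finset.sum_le_sum fun n _ => ?_)
    rw [norm_mul, mul_assoc, mul_assoc, ← pow_add]
    exact mul_le_mul_of_nonneg_left (h _ (by omega)) (norm_nonneg _)
  by_contra hcon
  push Not at hcon
  set ρ : ℝ := ‖ω i0‖ ^ 2 / b with hρ
  have hρ1 : 1 < ρ := by rw [hρ, one_lt_div hb]; exact hcon
  have ht := tendsto_pow_atTop_atTop_of_one_lt hρ1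
  set c : ℝ := n0 * ‖P.eval (z i0)‖ with hc
  have hcpos : 0 < c := by
    have : 0 < ‖P.eval (z i0)‖ := norm_pos_iff.mpr hP0
    have h2 : (0 : ℝ) < n0 := by exact_mod_cast hn0'
    positivity
  obtain ⟨s, hs, hs1⟩ := ((ht.eventually_gt_atTop (K' / c)).and
    (Filter.eventually_ge_atTop s0)).exists
  have h5 := hbd s hs1
  rw [hsum, norm_mul, norm_mul, ← mul_assoc, norm_pow, Complex.norm_natCast] at h5
  rw [← hc] at h5
  have h6 : ‖z i0‖ = ρ * b := by
    rw [hz, hρ, div_mul_cancel₀ _ hb.ne']; simp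
  rw [h6, mul_pow, ← mul_assoc] at h5
  have h7 := le_of_mul_le_mul_right h5 (pow_pos hb s)
  rw [div_lt_iff₀ hcpos] at hs
  linarith


/-- the polynomial with roots the first `j` conjugates of `x`. -/
noncomputable def wlcE (L : Type*) {E : Type*} [Fintype L] [Field E] (j : ℕ) (x : E) : E[X] :=
  ∏ i ∈ Finset.range j, (X - C (x ^ (Fintype.card L ^ i)))

/-- descent of `wlcE` to `L`. -/
noncomputable def wlc (L : Type*) {E : Type*} [Field L] [Fintype L] [Field E] [Algebra L E]
    (j : ℕ) (x : E) : L[X] :=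
  Function.invFun (Polynomial.map (algebraMap L E)) (wlcE L j x)

theorem wlMon_finite (L : Type*) [Field L] [Fintype L] (k : ℕ) :
    {g : L[X] | g.Monic ∧ g.natDegree = k}.Finite := by
  refine (Set.finite_range (fun v : Fin (k + 1) → L => ∑ i : Fin (k + 1), C (v i) * X ^ (i : ℕ))).subset ?_
  rintro g ⟨-, hg⟩
  refine ⟨fun i => g.coeff i, ?_⟩
  have h := g.as_sum_range_C_mul_X_pow
  rw [hg] at h
  conv_rhs => rw [h]
  exact Fin.sum_univ_eq_sum_range (fun i => C (g.coeff i) * X ^ i) (k + 1)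

/-- monic polynomials of degree `k`. -/
noncomputable def wlMon (L : Type*) [Field L] [Fintype L] (k : ℕ) : Finset L[X] :=
  (wlMon_finite L k).toFinset

section
variable {L E : Type*} [Field L] [Fintype L] [Field E] [Algebra L E]

theorem mem_wlMon {k : ℕ} {g : L[X]} : g ∈ wlMon L k ↔ g.Monic ∧ g.natDegree = k := by
  simp [wlMon]

theorem wlcE_monic (j : ℕ) (x : E) : (wlcE L j x).Monic :=
  monic_prod_of_monic _ _ fun _ _ => monic_X_sub_C _

theorem wlcE_natDegree (j : ℕ) (x : E) : (wlcE L j x).natDegree = j := by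
  rw [wlcE, natDegree_prod _ _ (fun _ _ => X_sub_C_ne_zero _)]
  simp only [natDegree_X_sub_C]
  simp

theorem wlc_map {j : ℕ} {x : E} (hx : x ^ (Fintype.card L ^ j) = x) :
    (wlc L j x).map (algebraMap L E) = wlcE L j x := by
  apply Function.invFun_eq
  have h1 : (wlcE L j x).map (FiniteField.frobeniusAlgHom L E : E →+* E) = wlcE L j x := by
    rw [wlcE, Polynomial.map_prod]
    simp only [Polynomial.map_sub, map_X, map_C, RingHom.coe_coe, FiniteField.coe_frobeniusAlgHom]
    have h2 : ∀ i, (x ^ (Fintype.card L ^ i)) ^ Fintype.card L = x ^ (Fintype.card L ^ (i + 1)) := by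
      intro i; rw [← pow_mul, ← pow_succ]
    simp_rw [h2]
    have h3 := Finset.prod_range_succ (fun i => X - C (x ^ (Fintype.card L ^ i))) j
    have h4 := Finset.prod_range_succ' (fun i => X - C (x ^ (Fintype.card L ^ i))) j
    rw [h3, hx] at h4
    simp only [pow_zero, pow_one] at h4
    exact (mul_right_cancel₀ (X_sub_C_ne_zero x) h4).symm
  have h2 : wlcE L j x ∈ Polynomial.lifts (algebraMap L E) := by
    rw [lifts_iff_coeff_lifts]
    intro n
    refine ⟨_, wl_inv_spec (L := L) ?_⟩
    have := congrArg (fun P => P.coeff n) h1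
    simpa [coeff_map] using this
  exact (mem_lifts _).mp h2

theorem wlc_monic {j : ℕ} {x : E} (hx : x ^ (Fintype.card L ^ j) = x) : (wlc L j x).Monic := by
  have h := wlcE_monic (L := L) j x
  rw [← wlc_map hx] at h
  exact monic_of_injective (algebraMap L E).injective h

theorem wlc_natDegree {j : ℕ} {x : E} (hx : x ^ (Fintype.card L ^ j) = x) :
    (wlc L j x).natDegree = j := by
  have h := wlcE_natDegree (L := L) j x
  rwa [← wlc_map hx, natDegree_map] at h

theorem wl_iterate (i : ℕ) (x : E) :
    (fun y : E => y ^ Fintype.card L)^[i] x = x ^ (Fintype.card L ^ i) := by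
  induction i with
  | zero => simp
  | succ i ih => rw [Function.iterate_succ_apply', ih, ← pow_mul, ← pow_succ]

theorem wlcE_minpoly {x : E} (hIntg : IsIntegral L x)
    (hδ : 0 < Function.minimalPeriod (fun y : E => y ^ Fintype.card L) x) :
    wlcE L (Function.minimalPeriod (fun y : E => y ^ Fintype.card L) x) x =
      (minpoly L x).map (algebraMap L E) := by
  set δ := Function.minimalPeriod (fun y : E => y ^ Fintype.card L) x with hδd
  have hper : x ^ (Fintype.card L ^ δ) = x := by
    rw [← wl_iterate]; exact Function.iterate_minimalPeriod
  apply eq_of_monic_of_associated (wlcE_monic _ _) ((minpoly.monic hIntg).map _)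
  apply associated_of_dvd_dvd
  · rw [wlcE]
    apply Finset.prod_dvd_of_coprime
    · intro i hi j hj hij
      apply isCoprime_X_sub_C_of_isUnit_sub
      apply IsUnit.mk0
      rw [sub_ne_zero]
      intro h
      apply hij
      rw [← wl_iterate, ← wl_iterate] at h
      refine Function.iterate_injOn_Iio_minimalPeriod ?_ ?_ h
      · simpa using hi
      · simpa using hj
    · intro i _
      rw [dvd_iff_isRoot, IsRoot, eval_map_algebraMap, ← wl_aeval_frob, minpoly.aeval,
        zero_pow (pow_ne_zero _ Fintype.card_ne_zero)]
  · rw [← wlc_map hper, map_dvd_map']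
    apply minpoly.dvd
    rw [← eval_map_algebraMap, wlc_map hper, wlcE, eval_prod]
    apply Finset.prod_eq_zero (Finset.mem_range.mpr hδ)
    simp

theorem wlcE_mul {x : E} {δ : ℕ} (hper : x ^ (Fintype.card L ^ δ) = x) (t : ℕ) :
    wlcE L (δ * t) x = wlcE L δ x ^ t := by
  have hpt : ∀ t, x ^ (Fintype.card L ^ (δ * t)) = x := by
    intro t
    induction t with
    | zero => simp
    | succ t ih => rw [Nat.mul_succ, pow_add, pow_mul, ih, hper]
  induction t with
  | zero => simp [wlcE]
  | succ t ih =>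
    rw [Nat.mul_succ, wlcE, Finset.prod_range_add]
    rw [wlcE] at ih
    rw [ih, pow_succ]
    congr 1
    rw [wlcE]
    refine Finset.prod_congr rfl fun i _ => ?_
    rw [pow_add (Fintype.card L), pow_mul x, hpt]

theorem wl_minpoly_pow_dvd {x : E} (hIntg : IsIntegral L x) (g : L[X]) (hg : g ≠ 0) (t : ℕ) :
    minpoly L x ^ t ∣ g ↔ t ≤ rootMultiplicity x (g.map (algebraMap L E)) := by
  have hg' : g.map (algebraMap L E) ≠ 0 :=
    (Polynomial.map_ne_zero_iff (algebraMap L E).injective).mpr hg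
  constructor
  · intro h
    rw [le_rootMultiplicity_iff hg']
    have h1 : (X - C x) ∣ (minpoly L x).map (algebraMap L E) := by
      rw [dvd_iff_isRoot, IsRoot, eval_map_algebraMap, minpoly.aeval]
    refine (pow_dvd_pow_of_dvd h1 t).trans ?_
    rw [← Polynomial.map_pow]
    exact Polynomial.map_dvd _ h
  · intro h
    have hirr := minpoly.irreducible hIntg
    have hfin : FiniteMultiplicity (minpoly L x) g := FiniteMultiplicity.of_prime_left hirr.prime hg
    obtain ⟨h', hge, hndvd⟩ := hfin.exists_eq_pow_mul_and_not_dvd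
    set e := multiplicity (minpoly L x) g with he
    have h'0 : h'.map (algebraMap L E) ≠ 0 := by
      rw [Polynomial.map_ne_zero_iff (algebraMap L E).injective]
      rintro rfl
      exact hndvd (dvd_zero _)
    have hm0 : (minpoly L x).map (algebraMap L E) ≠ 0 :=
      ((minpoly.monic hIntg).map _).ne_zero
    have hm1 : rootMultiplicity x ((minpoly L x).map (algebraMap L E)) ≤ 1 := by
      apply rootMultiplicity_le_one_of_separable
      exact (PerfectField.separable_of_irreducible hirr).map
    have hr0 : rootMultiplicity x (h'.map (algebraMap L E)) = 0 := by
      apply rootMultiplicity_eq_zero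
      rw [IsRoot, eval_map_algebraMap]
      intro h
      exact hndvd (minpoly.dvd _ _ h)
    have hμ : rootMultiplicity x (g.map (algebraMap L E)) ≤ e := by
      have h2 : g.map (algebraMap L E) =
          (minpoly L x).map (algebraMap L E) ^ e * h'.map (algebraMap L E) := by
        rw [← Polynomial.map_pow, ← Polynomial.map_mul, ← hge]
      rw [h2, rootMultiplicity_mul (mul_ne_zero (pow_ne_zero _ hm0) h'0), hr0, add_zero]
      classical
      rw [← count_roots, roots_pow, Multiset.count_nsmul, count_roots]
      nlinarith
    rw [hge]
    exact (pow_dvd_pow _ (h.trans hμ)).trans (dvd_mul_right _ _)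

theorem wl_periodic_of_root {g : L[X]} (hg : g ≠ 0) {x : E} (hx : aeval x g = 0) :
    0 < Function.minimalPeriod (fun y : E => y ^ Fintype.card L) x := by
  have hg' : g.map (algebraMap L E) ≠ 0 :=
    (Polynomial.map_ne_zero_iff (algebraMap L E).injective).mpr hg
  have hmem : ∀ i : ℕ, x ^ (Fintype.card L ^ i) ∈ (g.rootSet E) := by
    intro i
    rw [mem_rootSet]
    refine ⟨hg, ?_⟩
    rw [← wl_aeval_frob, hx, zero_pow (pow_ne_zero _ Fintype.card_ne_zero)]
  have : ∃ i j : ℕ, i < j ∧ x ^ (Fintype.card L ^ i) = x ^ (Fintype.card L ^ j) := by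
    obtain ⟨i, j, hij, h⟩ := Finite.exists_ne_map_eq_of_infinite
      (fun i : ℕ => (⟨x ^ (Fintype.card L ^ i), hmem i⟩ : g.rootSet E))
    have h' : x ^ (Fintype.card L ^ i) = x ^ (Fintype.card L ^ j) := congrArg Subtype.val h
    rcases lt_or_gt_of_ne hij with h1 | h1
    · exact ⟨i, j, h1, h'⟩
    · exact ⟨j, i, h1, h'.symm⟩
  obtain ⟨i, j, hij, h⟩ := this
  apply Function.minimalPeriod_pos_of_mem_periodicPts
  refine ⟨j - i, by omega, ?_⟩
  rw [Function.IsPeriodicPt, Function.IsFixedPt, wl_iterate]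
  have h1 : (x ^ (Fintype.card L ^ (j - i)) - x) ^ (Fintype.card L ^ i) = 0 := by
    rw [wl_frob_sub, ← pow_mul, ← pow_add, show j - i + i = j by omega, h, sub_self]
  exact sub_eq_zero.mp (pow_eq_zero_iff (pow_ne_zero _ Fintype.card_ne_zero) |>.mp h1)

theorem wl_count_x [DecidableEq E] [DecidableEq L[X]] {k : ℕ} {g : L[X]} (hg : g ∈ wlMon L k) {x : E}
    (hx : aeval x g = 0) [DecidablePred fun a => x ∈ wlOm L E (k - a) ∧ wlc L (k - a) x ∣ g] :
    ((Finset.range k).filter (fun a => x ∈ wlOm L E (k - a) ∧ wlc L (k - a) x ∣ g)).card =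
      rootMultiplicity x (g.map (algebraMap L E)) := by
  rw [mem_wlMon] at hg
  obtain ⟨hgm, hgk⟩ := hg
  have hIntg : IsIntegral L x := ⟨g, hgm, by rwa [← aeval_def]⟩
  have hδ := wl_periodic_of_root hgm.ne_zero hx
  have hmp := wlcE_minpoly hIntg hδ
  set δ := Function.minimalPeriod (fun y : E => y ^ Fintype.card L) x with hδd
  have hper : x ^ (Fintype.card L ^ δ) = x := by
    rw [← wl_iterate]; exact Function.iterate_minimalPeriod
  set μ := rootMultiplicity x (g.map (algebraMap L E)) with hμ
  have hperiff : ∀ j, x ^ (Fintype.card L ^ j) = x ↔ δ ∣ j := by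
    intro j
    rw [← wl_iterate]
    exact Function.isPeriodicPt_iff_minimalPeriod_dvd
  have hdvd : ∀ t, wlc L (δ * t) x ∣ g ↔ t ≤ μ := by
    intro t
    rw [← wl_minpoly_pow_dvd hIntg g hgm.ne_zero, ← map_dvd_map' (algebraMap L E),
      wlc_map ((hperiff _).mpr (dvd_mul_right _ _)), wlcE_mul hper, hmp,
      ← Polynomial.map_pow, map_dvd_map']
  have hle : ∀ t ≤ μ, δ * t ≤ k := by
    intro t ht
    have h1 := natDegree_le_of_dvd ((hdvd t).mpr ht) hgm.ne_zero
    rwa [wlc_natDegree ((hperiff _).mpr (dvd_mul_right _ _)), hgk] at h1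
  have : (Finset.range k).filter (fun a => x ∈ wlOm L E (k - a) ∧ wlc L (k - a) x ∣ g) =
      (Finset.Icc 1 μ).image (fun t => k - δ * t) := by
    ext a
    rw [Finset.mem_filter, Finset.mem_image, Finset.mem_range]
    constructor
    · rintro ⟨ha, h1, h2⟩
      rw [wl_mem_Om (by omega), hperiff] at h1
      obtain ⟨t, ht⟩ := h1
      rw [ht, hdvd] at h2
      refine ⟨t, ?_, by omega⟩
      rw [Finset.mem_Icc]
      refine ⟨?_, h2⟩
      rcases Nat.eq_zero_or_pos t with rfl | h
      · omega
      · exact h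
    · rintro ⟨t, ht, rfl⟩
      rw [Finset.mem_Icc] at ht
      have h1 := hle t ht.2
      have h2 : 0 < δ * t := Nat.mul_pos hδ (by omega)
      have h3 : k - (k - δ * t) = δ * t := by omega
      rw [h3, wl_mem_Om h2, hperiff, hdvd]
      exact ⟨by omega, dvd_mul_right _ _, ht.2⟩
  rw [this, Finset.card_image_of_injOn]
  · simp
  · intro t ht t' ht' h
    simp only [Finset.coe_Icc, Set.mem_Icc] at ht ht'
    have h1 := hle t ht.2
    have h2 := hle t' ht'.2
    have h3 : δ * t = δ * t' := by simp only at h; omega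
    exact Nat.eq_of_mul_eq_mul_left hδ h3

theorem wl_count [IsAlgClosed E] {k : ℕ} {g : L[X]} (hg : g ∈ wlMon L k) :
    ∑ a ∈ Finset.range k, ∑ x ∈ wlOm L E (k - a),
      (open Classical in if wlc L (k - a) x ∣ g then (1 : ℂ) else 0) = k := by
  classical
  obtain ⟨hgm, hgk⟩ := mem_wlMon.mp hg
  have hg' : g.map (algebraMap L E) ≠ 0 := (hgm.map _).ne_zero
  set R := (g.map (algebraMap L E)).roots.toFinset with hR
  have hmemR : ∀ x, x ∈ R ↔ aeval x g = 0 := by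
    intro x
    rw [hR, Multiset.mem_toFinset, mem_roots hg', IsRoot, eval_map_algebraMap]
  have h1 : ∀ a ∈ Finset.range k, ∑ x ∈ wlOm L E (k - a), (if wlc L (k - a) x ∣ g then (1 : ℂ) else 0)
      = ∑ x ∈ R, if x ∈ wlOm L E (k - a) ∧ wlc L (k - a) x ∣ g then (1 : ℂ) else 0 := by
    intro a ha
    rw [Finset.mem_range] at ha
    rw [← Finset.sum_filter, ← Finset.sum_filter]
    congr 1
    ext x
    rw [Finset.mem_filter, Finset.mem_filter, hmemR]
    constructor
    · rintro ⟨h1, h2⟩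
      refine ⟨?_, h1, h2⟩
      rw [wl_mem_Om (by omega)] at h1
      have h3 : aeval x (wlc L (k - a) x) = 0 := by
        rw [← eval_map_algebraMap, wlc_map h1, wlcE, eval_prod]
        apply Finset.prod_eq_zero (Finset.mem_range.mpr (by omega : 0 < k - a))
        simp
      obtain ⟨u, hu⟩ := h2
      rw [hu, map_mul, h3, zero_mul]
    · rintro ⟨-, h1, h2⟩
      exact ⟨h1, h2⟩
  rw [Finset.sum_congr rfl h1, Finset.sum_comm]
  have h2 : ∀ x ∈ R, ∑ a ∈ Finset.range k,
      (if x ∈ wlOm L E (k - a) ∧ wlc L (k - a) x ∣ g then (1 : ℂ) else 0) =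
      ((g.map (algebraMap L E)).roots.count x : ℂ) := by
    intro x hx
    rw [← Finset.sum_filter, Finset.sum_const, wl_count_x hg ((hmemR x).mp hx), count_roots]
    simp
  rw [Finset.sum_congr rfl h2, ← Nat.cast_sum, Multiset.toFinset_sum_count_eq,
    ← (IsAlgClosed.splits _).natDegree_eq_card_roots, natDegree_map, hgk]

theorem wl_recurrence [IsAlgClosed E] (Λ : L[X] → ℂ)
    (hΛ : ∀ g h : L[X], g.Monic → h.Monic → Λ (g * h) = Λ g * Λ h) (k : ℕ) :
    (k : ℂ) * ∑ g ∈ wlMon L k, Λ g = ∑ a ∈ Finset.range k,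
      (∑ g ∈ wlMon L a, Λ g) * ∑ x ∈ wlOm L E (k - a), Λ (wlc L (k - a) x) := by
  classical
  have h1 : (k : ℂ) * ∑ g ∈ wlMon L k, Λ g = ∑ a ∈ Finset.range k, ∑ x ∈ wlOm L E (k - a),
      ∑ g ∈ wlMon L k, if wlc L (k - a) x ∣ g then Λ g else 0 := by
    rw [Finset.mul_sum]
    have : ∀ g ∈ wlMon L k, (k : ℂ) * Λ g = ∑ a ∈ Finset.range k, ∑ x ∈ wlOm L E (k - a),
        if wlc L (k - a) x ∣ g then Λ g else 0 := by
      intro g hg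
      rw [← wl_count (E := E) hg, Finset.sum_mul]
      refine Finset.sum_congr rfl fun a _ => ?_
      rw [Finset.sum_mul]
      refine Finset.sum_congr rfl fun x _ => ?_
      rw [ite_mul, one_mul, zero_mul]
    rw [Finset.sum_congr rfl this, Finset.sum_comm]
    refine Finset.sum_congr rfl fun a _ => ?_
    rw [Finset.sum_comm]
  rw [h1]
  refine Finset.sum_congr rfl fun a ha => ?_
  rw [Finset.mem_range] at ha
  rw [Finset.mul_sum]
  refine Finset.sum_congr rfl fun x hx => ?_
  rw [wl_mem_Om (by omega)] at hx
  have hm := wlc_monic hx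
  have hd := wlc_natDegree hx
  rw [Finset.sum_mul, ← Finset.sum_filter]
  symm
  refine Finset.sum_bij (fun h _ => h * wlc L (k - a) x) ?_ ?_ ?_ ?_
  · intro h hh
    rw [mem_wlMon] at hh
    rw [Finset.mem_filter, mem_wlMon, Monic.natDegree_mul hh.1 hm, hh.2, hd]
    exact ⟨⟨hh.1.mul hm, by omega⟩, dvd_mul_left _ _⟩
  · intro h _ h' _ heq
    exact mul_right_cancel₀ hm.ne_zero heq
  · intro g hg
    rw [Finset.mem_filter, mem_wlMon] at hg
    obtain ⟨⟨hgm, hgk⟩, u, hu⟩ := hg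
    have hum : u.Monic := hm.of_mul_monic_left (hu ▸ hgm)
    refine ⟨u, ?_, by rw [hu, mul_comm]⟩
    rw [mem_wlMon]
    refine ⟨hum, ?_⟩
    rw [hu, Monic.natDegree_mul hm hum, hd] at hgk
    omega
  · intro h hh
    rw [hΛ _ _ (mem_wlMon.mp hh).1 hm]

end


/-- the resultant of `F` and `g`, computed in `E`. -/
noncomputable def wlPr {L : Type*} (E : Type*) [Field L] [Field E] [Algebra L E] (F g : L[X]) : E :=
  ((F.map (algebraMap L E)).roots.map (fun b => aeval b g)).prod

/-- the weight function on monic polynomials. -/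
noncomputable def wlLam {L : Type*} (E : Type*) [Field L] [Field E] [Algebra L E]
    (χ : MulChar L ℂ) (ψ : AddChar L ℂ) (F g : L[X]) : ℂ :=
  χ (wlInv L (wlPr E F g)) * ψ (- g.nextCoeff)

theorem wl_sum_self_inj {α : Type*} (s : Finset α) (f : α → α) (w : α → ℂ)
    (hm : ∀ x ∈ s, f x ∈ s) (hi : Set.InjOn f s) : ∑ x ∈ s, w (f x) = ∑ x ∈ s, w x := by
  classical
  rw [← Finset.sum_image hi]
  congr 1
  apply Finset.eq_of_subset_of_card_le
  · intro y hy
    obtain ⟨x, hx, rfl⟩ := Finset.mem_image.mp hy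
    exact hm x hx
  · rw [Finset.card_image_of_injOn hi]

section
variable {L E : Type*} [Field L] [Fintype L] [Field E] [Algebra L E]

theorem wlInv_mul {y z : E} (hy : y ^ Fintype.card L = y) (hz : z ^ Fintype.card L = z) :
    wlInv L (y * z) = wlInv L y * wlInv L z := by
  apply (algebraMap L E).injective
  rw [map_mul, wl_inv_spec hy, wl_inv_spec hz, wl_inv_spec]
  rw [mul_pow, hy, hz]

theorem wlPr_mul (F g h : L[X]) : wlPr E F (g * h) = wlPr E F g * wlPr E F h := by
  simp only [wlPr, map_mul, Multiset.prod_map_mul]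

theorem wlPr_fixed [IsAlgClosed E] (F g : L[X]) : wlPr E F g ^ Fintype.card L = wlPr E F g := by
  have h1 := (IsAlgClosed.splits (F.map (algebraMap L E))).roots_map
    (FiniteField.frobeniusAlgHom L E : E →+* E)
  rw [Polynomial.map_map, AlgHom.comp_algebraMap] at h1
  conv_rhs => rw [wlPr, h1, Multiset.map_map]
  rw [wlPr, ← Multiset.prod_map_pow]
  congr 1
  refine Multiset.map_congr rfl fun b _ => ?_
  have := wl_aeval_frob g 1 b
  rw [pow_one] at this
  rw [this]
  simp [FiniteField.coe_frobeniusAlgHom]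

theorem wlLam_mul [IsAlgClosed E] (χ : MulChar L ℂ) (ψ : AddChar L ℂ) (F g h : L[X])
    (hg : g.Monic) (hh : h.Monic) :
    wlLam E χ ψ F (g * h) = wlLam E χ ψ F g * wlLam E χ ψ F h := by
  rw [wlLam, wlPr_mul, wlInv_mul (wlPr_fixed F g) (wlPr_fixed F h), map_mul,
    hg.nextCoeff_mul hh, neg_add, AddChar.map_add_eq_mul, wlLam, wlLam]
  ring

theorem wlLam_one (χ : MulChar L ℂ) (ψ : AddChar L ℂ) (F : L[X]) :
    wlLam E χ ψ F 1 = 1 := by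
  have h1 : wlPr E F 1 = algebraMap L E 1 := by simp [wlPr]
  rw [wlLam, h1, wlInv_algebraMap, ← C_1, nextCoeff_C_eq_zero]
  simp

theorem wlLam_c [IsAlgClosed E] (χ : MulChar L ℂ) (ψ : AddChar L ℂ) (F : L[X]) (hF : F.Monic)
    {j : ℕ} {x : E} (hx : x ^ (Fintype.card L ^ j) = x) :
    wlLam E χ ψ F (wlc L j x) =
      χ (wlInv L ((aeval x (C ((-1) ^ F.natDegree) * F)) ^ wlNm L j)) * ψ (wlInv L (wlTr L j x)) := by
  have h1 : - (wlc L j x).nextCoeff = wlInv L (wlTr L j x) := by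
    apply (algebraMap L E).injective
    rw [wl_inv_spec (wl_tr_fixed hx), map_neg, ← nextCoeff_map (algebraMap L E).injective,
      wlc_map hx, wlcE, prod_X_sub_C_nextCoeff, neg_neg, wlTr]
  have h2 : ∀ y : E, ((F.map (algebraMap L E)).roots.map (fun b => b - y)).prod =
      aeval y (C ((-1) ^ F.natDegree) * F) := by
    intro y
    have h3 := (IsAlgClosed.splits (F.map (algebraMap L E))).eval_eq_prod_roots_of_monic (hF.map _) y
    have h4 := (IsAlgClosed.splits (F.map (algebraMap L E))).natDegree_eq_card_roots
    rw [natDegree_map] at h4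
    rw [map_mul, aeval_C, ← eval_map_algebraMap, h3, h4]
    have h5 : (fun b => b - y) = fun b : E => (-1) * (y - b) := by
      funext b; ring
    rw [h5, Multiset.prod_map_mul, Multiset.map_const', Multiset.prod_replicate]
    simp
  have h3 : wlPr E F (wlc L j x) = (aeval x (C ((-1) ^ F.natDegree) * F)) ^ wlNm L j := by
    have h4 : ∀ b : E, aeval b (wlc L j x) = ∏ i ∈ Finset.range j, (b - x ^ (Fintype.card L ^ i)) := by
      intro b
      rw [← eval_map_algebraMap, wlc_map hx, wlcE, eval_prod]
      simp
    rw [wlPr]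
    simp_rw [h4]
    rw [Multiset.prod_map_prod, wlNm, ← Finset.prod_pow_eq_pow_sum]
    refine Finset.prod_congr rfl fun i _ => ?_
    rw [h2, wl_aeval_frob]
  rw [wlLam, h3, h1]

theorem wlPr_congr (F R0 g h : L[X]) (hFR : ∀ b : E, aeval b F = 0 → aeval b R0 = 0)
    (hd : R0 ∣ g - h) : wlPr E F g = wlPr E F h := by
  rw [wlPr, wlPr]
  congr 1
  refine Multiset.map_congr rfl fun b hb => ?_
  have h1 := isRoot_of_mem_roots hb
  rw [IsRoot, eval_map_algebraMap] at h1
  obtain ⟨u, hu⟩ := hd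
  rw [← sub_eq_zero, ← map_sub, hu, map_mul, hFR b h1, zero_mul]

theorem wl_vanish_psi (χ : MulChar L ℂ) (ψ : AddChar L ℂ) (hψ : ψ ≠ 1) (F R0 : L[X])
    (hR0 : R0.Monic)
    (hFR : ∀ b : E, aeval b F = 0 → aeval b R0 = 0) (k : ℕ) (hk : R0.natDegree < k) :
    ∑ g ∈ wlMon L k, wlLam E χ ψ F g = 0 := by
  obtain ⟨c0, hc0⟩ := AddChar.ne_one_iff.mp hψ
  set c := - c0 with hc
  set r : L[X] := C c * (R0 * X ^ (k - 1 - R0.natDegree)) with hr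
  have hmon : (R0 * X ^ (k - 1 - R0.natDegree)).Monic := hR0.mul (monic_X_pow _)
  have hnd : (R0 * X ^ (k - 1 - R0.natDegree)).natDegree = k - 1 := by
    rw [hR0.natDegree_mul (monic_X_pow _), natDegree_X_pow]; omega
  have hrdeg : r.degree < (k : ℕ) := by
    rw [hr, C_mul']
    refine (degree_smul_le _ _).trans_lt ?_
    rw [degree_eq_natDegree hmon.ne_zero, hnd]
    exact_mod_cast (by omega : k - 1 < k)
  have hrc : r.coeff (k - 1) = c := by
    rw [hr, coeff_C_mul]
    have := hmon.coeff_natDegree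
    rw [hnd] at this
    rw [this, mul_one]
  have hmem : ∀ g ∈ wlMon L k, g + r ∈ wlMon L k := by
    intro g hg
    rw [mem_wlMon] at hg ⊢
    have h1 : r.degree < g.degree := by
      rw [degree_eq_natDegree hg.1.ne_zero, hg.2]; exact hrdeg
    exact ⟨hg.1.add_of_left h1, by rw [natDegree_add_eq_left_of_degree_lt h1, hg.2]⟩
  have h1 := wl_sum_self_inj (wlMon L k) (fun g => g + r) (wlLam E χ ψ F) hmem
    (fun g _ g' _ h => add_right_cancel h)
  have h2 : ∀ g ∈ wlMon L k, wlLam E χ ψ F (g + r) = ψ c0 * wlLam E χ ψ F g := by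
    intro g hg
    have hg' := hmem g hg
    rw [mem_wlMon] at hg hg'
    rw [wlLam, wlLam, wlPr_congr F R0 (g + r) g hFR]
    · rw [nextCoeff_of_natDegree_pos (by omega), nextCoeff_of_natDegree_pos (by omega), hg.2, hg'.2,
        coeff_add, hrc, hc, neg_add, neg_neg, AddChar.map_add_eq_mul]
      ring
    · rw [hr, add_sub_cancel_left]
      exact ⟨C c * X ^ (k - 1 - R0.natDegree), by ring⟩
  rw [Finset.sum_congr rfl h2, ← Finset.mul_sum] at h1
  by_contra hne
  exact hc0 (mul_right_cancel₀ hne (by rw [h1, one_mul]))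

theorem wl_vanish_one [IsAlgClosed E] (χ : MulChar L ℂ) (F R0 : L[X]) (hF : F.Monic)
    (hR0 : R0.Monic) (hFR : ∀ b : E, aeval b F = 0 ↔ aeval b R0 = 0)
    (u : L[X]) (hu0 : χ (wlInv L (wlPr E F u)) ≠ 0) (hu1 : χ (wlInv L (wlPr E F u)) ≠ 1)
    (k : ℕ) (hk : R0.natDegree ≤ k) :
    ∑ g ∈ wlMon L k, wlLam E χ 1 F g = 0 := by
  have hcop : IsCoprime R0 u := by
    rw [isCoprime_iff_aeval_ne_zero_of_isAlgClosed L E]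
    intro b
    by_contra hcon
    push Not at hcon
    apply hu0
    have h1 : wlPr E F u = algebraMap L E 0 := by
      rw [map_zero, wlPr]
      apply Multiset.prod_eq_zero
      rw [Multiset.mem_map]
      refine ⟨b, ?_, hcon.2⟩
      rw [mem_roots (hF.map _).ne_zero, IsRoot, eval_map_algebraMap, hFR]
      exact hcon.1
    rw [h1, wlInv_algebraMap]
    exact MulChar.map_nonunit χ not_isUnit_zero
  set φ : L[X] → L[X] := fun g => g + ((u * g) %ₘ R0 - g %ₘ R0) with hφ
  have hmem : ∀ g ∈ wlMon L k, φ g ∈ wlMon L k := by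
    intro g hg
    rw [mem_wlMon] at hg ⊢
    have h1 : ((u * g) %ₘ R0 - g %ₘ R0).degree < g.degree := by
      refine (degree_sub_le _ _).trans_lt ?_
      have h2 : R0.degree ≤ g.degree := by
        rw [degree_eq_natDegree hg.1.ne_zero, degree_eq_natDegree hR0.ne_zero, hg.2]
        exact_mod_cast hk
      exact max_lt ((degree_modByMonic_lt _ hR0).trans_le h2) ((degree_modByMonic_lt _ hR0).trans_le h2)
    exact ⟨hg.1.add_of_left h1, by rw [hφ]; simp only; rw [natDegree_add_eq_left_of_degree_lt h1, hg.2]⟩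
  have hdv : ∀ g, R0 ∣ φ g - u * g := by
    intro g
    have h1 := modByMonic_add_div g R0
    have h2 := modByMonic_add_div (u * g) R0
    refine ⟨g /ₘ R0 - (u * g) /ₘ R0, ?_⟩
    simp only [hφ]
    linear_combination h2 - h1
  have hinj : Set.InjOn φ (wlMon L k) := by
    intro g _ g' _ h
    have h1 : R0 ∣ u * (g - g') := by
      have h2 := dvd_sub (hdv g') (hdv g)
      rw [h] at h2
      convert h2 using 1
      ring
    have h2 := hcop.dvd_of_dvd_mul_left h1
    have h3 := modByMonic_eq_of_dvd_sub hR0 h2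
    have h4 : (u * g) %ₘ R0 = (u * g') %ₘ R0 :=
      modByMonic_eq_of_dvd_sub hR0 (by rw [← mul_sub]; exact h1)
    simp only [hφ] at h
    rw [h3, h4] at h
    exact add_right_cancel h
  have h1 := wl_sum_self_inj (wlMon L k) φ (wlLam E χ 1 F) hmem hinj
  have h2 : ∀ g ∈ wlMon L k, wlLam E χ 1 F (φ g) =
      χ (wlInv L (wlPr E F u)) * wlLam E χ 1 F g := by
    intro g _
    rw [wlLam, wlLam, wlPr_congr F R0 (φ g) (u * g) (fun b => (hFR b).mp) (hdv g), wlPr_mul,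
      wlInv_mul (wlPr_fixed F u) (wlPr_fixed F g), map_mul]
    simp
  rw [Finset.sum_congr rfl h2, ← Finset.mul_sum] at h1
  by_contra hne
  exact hu1 (mul_right_cancel₀ hne (by rw [h1, one_mul]))

end


section
variable {L E : Type*} [Field L] [Fintype L] [Field E] [Algebra L E]

theorem wl_exists_u [IsAlgClosed E] (χ : MulChar L ℂ) (hχ : χ ≠ 1) (F : L[X]) (hF : F ≠ 0)
    (hp : ∀ l : ℕ, l.Prime → l ∣ orderOf χ → ∃ (β : E) (e : ℕ) (G : E[X]),
      F.map (algebraMap L E) = (X - C β) ^ e * G ∧ G.eval β ≠ 0 ∧ ¬ l ∣ e) :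
    ∃ (j : ℕ) (x : E), x ^ (Fintype.card L ^ j) = x ∧
      χ (wlInv L ((aeval x F) ^ wlNm L j)) ≠ 0 ∧ χ (wlInv L ((aeval x F) ^ wlNm L j)) ≠ 1 := by
  classical
  by_contra hcon
  push Not at hcon
  obtain ⟨K, s0, hK⟩ := wl_char_bound χ hχ F hF hp
  have hQ := wl_card_gt (L := L)
  have hQ' : (1 : ℝ) < Fintype.card L := by exact_mod_cast hQ
  obtain ⟨t, ht⟩ := pow_unbounded_of_one_lt (K + F.natDegree + 1) hQ'
  set s := max (max t s0) 1 with hs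
  have hs1 : 0 < 2 * s := by omega
  have h1 := hK s (by omega)
  have h2 : (Fintype.card L : ℝ) ^ t ≤ (Fintype.card L : ℝ) ^ s :=
    pow_le_pow_right₀ hQ'.le (by omega)
  have h3 : ∑ x ∈ wlOm L E (2 * s), χ (wlInv L ((aeval x F) ^ wlNm L (2 * s))) =
      (((wlOm L E (2 * s)).filter (fun x => aeval x F ≠ 0)).card : ℂ) := by
    rw [Finset.card_filter]
    push_cast
    refine Finset.sum_congr rfl fun x hx => ?_
    rw [wl_mem_Om hs1] at hx
    have hfix : (aeval x F) ^ (Fintype.card L ^ (2 * s)) = aeval x F := by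
      rw [wl_aeval_frob, hx]
    have hspec := wl_inv_spec (wl_norm_fixed hfix)
    split_ifs with h
    · apply hcon _ x hx
      intro h0
      by_cases hz : wlInv L ((aeval x F) ^ wlNm L (2 * s)) = 0
      · rw [hz, map_zero] at hspec
        exact h (eq_zero_of_pow_eq_zero hspec.symm)
      · have := (IsUnit.mk0 _ hz).map χ
        rw [h0] at this
        exact not_isUnit_zero this
    · push Not at h
      have hnm : wlNm L (2 * s) ≠ 0 := by
        intro h0
        have := wlNm_mul (L := L) (2 * s)
        rw [h0, mul_zero, zero_add] at this
        have h5 := Nat.one_lt_pow (n := 2 * s) (by omega) hQ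
        omega
      have h0 : wlInv L ((0 : E)) = 0 := by
        rw [← map_zero (algebraMap L E), wlInv_algebraMap]
      rw [h, zero_pow hnm, h0]
      simpa using MulChar.map_nonunit χ not_isUnit_zero
  have h4 : ((wlOm L E (2 * s)).filter (fun x => ¬ aeval x F ≠ 0)).card ≤ F.natDegree := by
    calc _ ≤ ((F.map (algebraMap L E)).roots.toFinset).card := by
          apply Finset.card_le_card
          intro x hx
          rw [Finset.mem_filter] at hx
          rw [Multiset.mem_toFinset, mem_roots (by rwa [Polynomial.map_ne_zero_iff (algebraMap L E).injective]),
            IsRoot, eval_map_algebraMap]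
          simpa using hx.2
      _ ≤ _ := (Multiset.toFinset_card_le _).trans ((card_roots' _).trans natDegree_map_le)
  have h5 := Finset.card_filter_add_card_filter_not (s := wlOm L E (2 * s)) (fun x => aeval x F ≠ 0)
  rw [wl_card_Om hs1] at h5
  rw [h3, Complex.norm_natCast] at h1
  set c := ((wlOm L E (2 * s)).filter (fun x => aeval x F ≠ 0)).card
  have h6 : ((Fintype.card L : ℝ) ^ s) ^ 2 ≤ c + F.natDegree := by
    rw [← pow_mul, mul_comm]
    have : Fintype.card L ^ (2 * s) ≤ c + F.natDegree := by omega
    exact_mod_cast this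
  set y := (Fintype.card L : ℝ) ^ s
  have hy1 : 1 ≤ y := one_le_pow₀ hQ'.le
  have hd : (0 : ℝ) ≤ F.natDegree := by positivity
  nlinarith

theorem wl_Om_one [IsAlgClosed E] [DecidableEq E] :
    wlOm L E 1 = Finset.univ.image (algebraMap L E) := by
  symm
  apply Finset.eq_of_subset_of_card_le
  · intro x hx
    obtain ⟨a, -, rfl⟩ := Finset.mem_image.mp hx
    rw [wl_mem_Om one_pos, pow_one, ← map_pow, FiniteField.pow_card]
  · rw [wl_card_Om one_pos, Finset.card_image_of_injective _ (algebraMap L E).injective]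
    simp

theorem wlS_one [IsAlgClosed E] (χ : MulChar L ℂ) (ψ : AddChar L ℂ) (G : L[X]) :
    wlS E χ ψ G 1 = ∑ a : L, χ (G.eval a) * ψ a := by
  classical
  rw [wlS, wl_Om_one, Finset.sum_image (fun a _ b _ h => (algebraMap L E).injective h)]
  refine Finset.sum_congr rfl fun a _ => ?_
  rw [aeval_algebraMap_apply, wlNm, wlTr]
  simp [wlInv_algebraMap]

/-- Weil bound for mixed character sums. -/
theorem wl_weil [IsAlgClosed E] (χ : MulChar L ℂ) (hχ : χ ≠ 1) (ψ : AddChar L ℂ) (F R0 : L[X])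
    (hF : F.Monic) (hR0 : R0.Monic) (hFR : ∀ b : E, aeval b F = 0 ↔ aeval b R0 = 0)
    (hp : ∀ l : ℕ, l.Prime → l ∣ orderOf χ → ∃ (β : E) (e : ℕ) (G : E[X]),
      F.map (algebraMap L E) = (X - C β) ^ e * G ∧ G.eval β ≠ 0 ∧ ¬ l ∣ e) :
    ‖∑ a : L, χ (F.eval a) * ψ a‖ ≤ R0.natDegree * Real.sqrt (Fintype.card L) := by
  classical
  set ε : L := (-1) ^ F.natDegree with hε
  have hε0 : ε ≠ 0 := pow_ne_zero _ (by simp)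
  set G : L[X] := C ε * F with hG
  have hG0 : G ≠ 0 := mul_ne_zero (C_ne_zero.mpr hε0) hF.ne_zero
  have hpG : ∀ l : ℕ, l.Prime → l ∣ orderOf χ → ∃ (β : E) (e : ℕ) (G' : E[X]),
      G.map (algebraMap L E) = (X - C β) ^ e * G' ∧ G'.eval β ≠ 0 ∧ ¬ l ∣ e := by
    intro l hl hlo
    obtain ⟨β, e, G', h1, h2, h3⟩ := hp l hl hlo
    refine ⟨β, e, C (algebraMap L E ε) * G', ?_, ?_, h3⟩
    · rw [hG, Polynomial.map_mul, h1, map_C]; ring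
    · rw [eval_mul, eval_C]
      exact mul_ne_zero (by simpa using hε0) h2
  obtain ⟨j, x, hx, hx0, hx1⟩ := wl_exists_u χ hχ G hG0 hpG
  have hc : ∀ (ψ : AddChar L ℂ) (j : ℕ) (x : E), x ^ (Fintype.card L ^ j) = x →
      wlLam E χ ψ F (wlc L j x) =
      χ (wlInv L ((aeval x G) ^ wlNm L j)) * ψ (wlInv L (wlTr L j x)) :=
    fun ψ j x hx => wlLam_c χ ψ F hF hx
  have hu : χ (wlInv L (wlPr E F (wlc L j x))) = χ (wlInv L ((aeval x G) ^ wlNm L j)) := by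
    have := hc 1 j x hx
    rw [wlLam] at this
    simpa using this
  have hvan : ∀ ψ : AddChar L ℂ, ∀ k, R0.natDegree < k → ∑ g ∈ wlMon L k, wlLam E χ ψ F g = 0 := by
    intro ψ k hk
    by_cases hψ : ψ = 1
    · rw [hψ]
      exact wl_vanish_one χ F R0 hF hR0 hFR (wlc L j x) (by rwa [hu]) (by rwa [hu]) k hk.le
    · exact wl_vanish_psi χ ψ hψ F R0 hR0 (fun b => (hFR b).mp) k hk
  have hmon0 : wlMon L 0 = {1} := by
    ext g
    rw [mem_wlMon, Finset.mem_singleton]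
    constructor
    · rintro ⟨h1, h2⟩
      exact h1.natDegree_eq_zero.mp h2
    · rintro rfl
      exact ⟨monic_one, natDegree_one⟩
  have hN : ∀ ψ : AddChar L ℂ, ∃ ω : Fin R0.natDegree → ℂ, ∀ k, 0 < k →
      wlS E χ ψ G k = - ∑ i, ω i ^ k := by
    intro ψ
    apply wl_newton (fun k => ∑ g ∈ wlMon L k, wlLam E χ ψ F g) (fun k => wlS E χ ψ G k)
    · simp only [hmon0, Finset.sum_singleton, wlLam_one]
    · exact hvan ψ
    · intro k hk
      have := wl_recurrence (E := E) (wlLam E χ ψ F)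
        (fun g h hg hh => wlLam_mul χ ψ F g h hg hh) k
      rw [this]
      refine Finset.sum_congr rfl fun a ha => ?_
      rw [Finset.mem_range] at ha
      congr 1
      rw [wlS]
      refine Finset.sum_congr rfl fun x hx => ?_
      rw [wl_mem_Om (by omega)] at hx
      rw [hc ψ _ x hx]
  choose ω hω using hN
  obtain ⟨K, s0, hK⟩ := wl_sum_bound χ hχ G hG0 hpG
  have hQ := wl_card_gt (L := L)
  have hroot : ∀ (ψ : AddChar L ℂ) i, ‖ω ψ i‖ ≤ Real.sqrt (Fintype.card L) := by
    intro ψ i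
    apply Real.le_sqrt_of_sq_le
    refine wl_roots_bound (fun p : AddChar L ℂ × Fin R0.natDegree => ω p.1 p.2) _ K (s0 + 1)
      (by exact_mod_cast (by omega)) ?_ (ψ, i)
    intro s hs
    rw [Fintype.sum_prod_type]
    have h1 := hK s (by omega)
    rw [Finset.sum_congr rfl (fun ψ _ => hω ψ (2 * s) (by omega)), Finset.sum_neg_distrib,
      norm_neg] at h1
    exact h1
  have h1 := hω ψ 1 one_pos
  rw [wlS_one] at h1
  have h2 : ∑ a : L, χ (G.eval a) * ψ a = χ ε * ∑ a : L, χ (F.eval a) * ψ a := by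
    rw [Finset.mul_sum]
    refine Finset.sum_congr rfl fun a _ => ?_
    rw [hG, eval_mul, eval_C, map_mul, mul_assoc]
  have h3 : ‖χ ε‖ = 1 := by
    have : (χ ε) ^ (Fintype.card L - 1) = 1 := by
      rw [← map_pow, FiniteField.pow_card_sub_one_eq_one ε hε0, map_one]
    exact Complex.norm_eq_one_of_pow_eq_one this (by omega)
  rw [h2] at h1
  calc ‖∑ a : L, χ (F.eval a) * ψ a‖ = ‖χ ε * ∑ a : L, χ (F.eval a) * ψ a‖ := by
        rw [norm_mul, h3, one_mul]
    _ = ‖∑ i, ω ψ i‖ := by rw [h1, norm_neg]; simp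
    _ ≤ ∑ i, ‖ω ψ i‖ := norm_sum_le _ _
    _ ≤ ∑ i : Fin R0.natDegree, Real.sqrt (Fintype.card L) := Finset.sum_le_sum fun i _ => hroot ψ i
    _ = _ := by simp

end


section
variable {L E : Type*} [Field L] [Fintype L] [Field E] [Algebra L E]

/-- multiplicity of a root of `g` in `X^a P^b R^c`. -/
theorem wl_hp_aux [IsAlgClosed E] (g P R : L[X]) (hg : g.Monic) (hgi : Irreducible g)
    (hgX : g ≠ X) (k : ℕ) (hk : 0 < k) (hPR : IsCoprime P R) (hgP : g ∣ P)
    (h1 : g ^ k ∣ P * R) (h2 : ¬ g ^ (k + 1) ∣ P * R) (a b c l : ℕ) (hl : l.Prime)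
    (hlk : ¬ l ∣ k) (hlb : ¬ l ∣ b) :
    ∃ (β : E) (e : ℕ) (G : E[X]),
      (X ^ a * P ^ b * R ^ c).map (algebraMap L E) = (X - C β) ^ e * G ∧ G.eval β ≠ 0 ∧ ¬ l ∣ e := by
  have hgR : ¬ g ∣ R := fun h => hgi.not_isUnit (hPR.isUnit_of_dvd' hgP h)
  have hgk : g ^ k ∣ P := by
    have : IsCoprime (g ^ k) R := ((hgi.coprime_iff_not_dvd).mpr hgR).pow_left
    exact this.dvd_of_dvd_mul_right h1
  obtain ⟨h, rfl⟩ := hgk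
  have hgh : ¬ g ∣ h := by
    rintro ⟨u, rfl⟩
    exact h2 ⟨u * R, by ring⟩
  obtain ⟨β, hβ⟩ := IsAlgClosed.exists_aeval_eq_zero E g (degree_pos_of_irreducible hgi).ne'
  have hmin : g = minpoly L β := minpoly.eq_of_irreducible_of_monic hgi hβ hg
  have hne : ∀ u : L[X], ¬ g ∣ u → aeval β u ≠ 0 := by
    intro u hu h0
    exact hu (hmin ▸ minpoly.dvd L β h0)
  have hβ0 : β ≠ 0 := by
    rintro rfl
    apply hgX
    rw [hmin, minpoly.zero]
  have hsep : (g.map (algebraMap L E)).Separable := (PerfectField.separable_of_irreducible hgi).map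
  have hroot : (g.map (algebraMap L E)).IsRoot β := by
    rw [IsRoot, eval_map_algebraMap, hβ]
  obtain ⟨g', hg'⟩ := dvd_iff_isRoot.mpr hroot
  have hg'β : g'.eval β ≠ 0 := by
    intro h0
    obtain ⟨w, hw⟩ := dvd_iff_isRoot.mpr h0
    have hsq := hsep.squarefree (X - C β) ⟨w, by rw [hg', hw]; ring⟩
    exact not_isUnit_X_sub_C β hsq
  refine ⟨β, k * b, X ^ a * g' ^ (k * b) * (h.map (algebraMap L E)) ^ b *
    (R.map (algebraMap L E)) ^ c, ?_, ?_, ?_⟩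
  · rw [Polynomial.map_mul, Polynomial.map_mul, Polynomial.map_pow, Polynomial.map_pow,
      Polynomial.map_pow, Polynomial.map_mul, Polynomial.map_pow, hg', map_X]
    generalize X - C β = y
    ring
  · simp only [eval_mul, eval_pow, eval_X, eval_map_algebraMap]
    exact mul_ne_zero (mul_ne_zero (mul_ne_zero (pow_ne_zero _ hβ0) (pow_ne_zero _ hg'β))
      (pow_ne_zero _ (hne h hgh))) (pow_ne_zero _ (hne R hgR))
  · rw [hl.dvd_mul]; tauto

theorem wl_hp_zero (P R : L[X]) (hP : P ≠ 0) (hR : R ≠ 0) (a b c l : ℕ)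
    (hla : ¬ l ∣ a) (hlb : l ∣ b) (hlc : l ∣ c) :
    ∃ (β : E) (e : ℕ) (G : E[X]),
      (X ^ a * P ^ b * R ^ c).map (algebraMap L E) = (X - C β) ^ e * G ∧ G.eval β ≠ 0 ∧ ¬ l ∣ e := by
  have key : ∀ P : L[X], P ≠ 0 → ∃ v h, P = X ^ v * h ∧ h.eval 0 ≠ 0 := by
    intro P hP
    obtain ⟨h, h1, h2⟩ := exists_eq_pow_rootMultiplicity_mul_and_not_dvd P hP 0
    refine ⟨_, h, by simpa using h1, ?_⟩
    rwa [dvd_iff_isRoot] at h2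
  obtain ⟨v, h, rfl, hh⟩ := key P hP
  obtain ⟨w, r, rfl, hr⟩ := key R hR
  refine ⟨0, a + v * b + w * c, h.map (algebraMap L E) ^ b * r.map (algebraMap L E) ^ c, ?_, ?_, ?_⟩
  · simp only [Polynomial.map_mul, Polynomial.map_pow, map_X, map_zero, sub_zero]
    ring
  · have h0 : ∀ u : L[X], (u.map (algebraMap L E)).eval 0 = algebraMap L E (u.eval 0) := by
      intro u
      rw [← map_zero (algebraMap L E), eval_map_apply]
    simp only [eval_mul, eval_pow, h0]
    exact mul_ne_zero (pow_ne_zero _ (by simpa using hh)) (pow_ne_zero _ (by simpa using hr))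
  · intro hd
    apply hla
    rw [add_assoc] at hd
    exact (Nat.dvd_add_left (dvd_add (hlb.mul_left _) (hlc.mul_left _))).mp hd

theorem wl_generator (χ1 χ2 : MulChar L ℂ) (hne : ¬ (χ1 = 1 ∧ χ2 = 1)) :
    ∃ (χ : MulChar L ℂ) (a b : ℕ), χ ≠ 1 ∧ 0 < a ∧ 0 < b ∧ χ1 = χ ^ a ∧ χ2 = χ ^ b ∧
      ∀ l : ℕ, l.Prime → l ∣ orderOf χ → l ∣ b → ¬ l ∣ a := by
  obtain ⟨φ⟩ := MulChar.mulEquiv_units L ℂ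
  have hcyc : IsCyclic (MulChar L ℂ) := isCyclic_of_surjective φ.symm φ.symm.surjective
  set H := Subgroup.closure {χ1, χ2} with hH
  obtain ⟨⟨χ, hχ⟩, hgen⟩ := IsCyclic.exists_generator (α := H)
  have hmem : ∀ y ∈ H, y ∈ Submonoid.powers χ := by
    intro y hy
    obtain ⟨z, hz⟩ := hgen ⟨y, hy⟩
    rw [mem_powers_iff_mem_zpowers]
    exact ⟨z, by simpa using congrArg Subtype.val hz⟩
  obtain ⟨a, ha⟩ := hmem χ1 (Subgroup.subset_closure (by simp))
  obtain ⟨b, hb⟩ := hmem χ2 (Subgroup.subset_closure (by simp))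
  have hd := orderOf_pos χ
  simp only at ha hb
  refine ⟨χ, a + orderOf χ, b + orderOf χ, ?_, by omega, by omega, ?_, ?_, ?_⟩
  · rintro rfl
    apply hne
    rw [← ha, ← hb]; simp
  · rw [pow_add, pow_orderOf_eq_one, mul_one, ha]
  · rw [pow_add, pow_orderOf_eq_one, mul_one, hb]
  · intro l hl hlo hlb hla
    rw [Nat.dvd_add_left hlo] at hla hlb
    have hle : H ≤ Subgroup.zpowers (χ ^ l) := by
      rw [hH, Subgroup.closure_le]
      intro y hy
      rcases hy with rfl | rfl
      · obtain ⟨u, rfl⟩ := hla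
        rw [← ha, pow_mul]
        exact Subgroup.npow_mem_zpowers _ _
      · obtain ⟨u, rfl⟩ := hlb
        rw [← hb, pow_mul]
        exact Subgroup.npow_mem_zpowers _ _
    obtain ⟨z, hz⟩ := hle hχ
    have hz' : χ ^ ((l : ℤ) * z - 1) = 1 := by
      rw [zpow_sub, zpow_mul, zpow_natCast, zpow_one]
      simp only at hz
      rw [hz, mul_inv_cancel]
    have h1 := (orderOf_dvd_iff_zpow_eq_one).mpr hz'
    have h2 : (l : ℤ) ∣ (l : ℤ) * z - 1 := (by exact_mod_cast hlo : (l : ℤ) ∣ (orderOf χ : ℤ)).trans h1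
    have h3 : (l : ℤ) ∣ 1 := by
      have := dvd_sub (Dvd.intro z rfl : (l : ℤ) ∣ l * z) h2
      simpa using this
    have h4 : l ∣ 1 := by exact_mod_cast h3
    exact hl.one_lt.ne' (Nat.dvd_one.mp h4)

theorem wl_norm_le_one (χ : MulChar L ℂ) (a : L) : ‖χ a‖ ≤ 1 := by
  by_cases h : a = 0
  · rw [h, MulChar.map_nonunit χ not_isUnit_zero]; simp
  · have : (χ a) ^ (Fintype.card L - 1) = 1 := by
      rw [← map_pow, FiniteField.pow_card_sub_one_eq_one a h, map_one]
    exact (Complex.norm_eq_one_of_pow_eq_one this (by have := wl_card_gt (L := L); omega)).le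

theorem wl_add_norm (ψ : AddChar L ℂ) (a : L) : ‖ψ a‖ = 1 := AddChar.norm_apply ψ a

/-- the number of excluded points. -/
theorem wl_bad_card [DecidableEq L] (R : L[X]) (hR : R ≠ 0) :
    (Finset.univ.filter (fun a : L => R.eval a = 0)).card ≤ R.natDegree := by
  refine le_trans (Finset.card_le_card (t := R.roots.toFinset) ?_)
    ((Multiset.toFinset_card_le _).trans (card_roots' _))
  intro a ha
  rw [Finset.mem_filter] at ha
  rw [Multiset.mem_toFinset, mem_roots hR]
  exact ha.2

theorem wl_apply_monic (f1 f2 : L[X]) (hf1 : f1.Monic) (hf2 : f2.Monic) (hcop : IsCoprime f1 f2)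
    (k : ℕ) (g : L[X]) (hk : 0 < k) (hg : g.Monic) (hgi : Irreducible g) (hgX : g ≠ X)
    (hgcd : Nat.gcd k (Fintype.card L - 1) = 1) (hd1 : g ^ k ∣ f1 * f2)
    (hd2 : ¬ g ^ (k + 1) ∣ f1 * f2) (χ1 χ2 : MulChar L ℂ) (ψ : AddChar L ℂ)
    (hne : ¬ (χ1 = 1 ∧ χ2 = 1 ∧ ψ = 1)) :
    ‖∑ a : L, χ1 a * χ2 (f1.eval a / f2.eval a) * ψ a‖ ≤
      (1 + f1.natDegree + f2.natDegree : ℕ) * Real.sqrt (Fintype.card L) := by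
  classical
  have hQ := wl_card_gt (L := L)
  have hR0 : (X * f1 * f2).Monic := (monic_X.mul hf1).mul hf2
  have hR0d : (X * f1 * f2).natDegree = 1 + f1.natDegree + f2.natDegree := by
    rw [(monic_X.mul hf1).natDegree_mul hf2, monic_X.natDegree_mul hf1, natDegree_X]
  by_cases h12 : χ1 = 1 ∧ χ2 = 1
  · obtain ⟨rfl, rfl⟩ := h12
    have hψ : ψ ≠ 1 := by tauto
    have h1 : ∀ a : L, (1 : MulChar L ℂ) a * (1 : MulChar L ℂ) (f1.eval a / f2.eval a) * ψ a =
        ψ a - if (X * f1 * f2).eval a = 0 then ψ a else 0 := by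
      intro a
      by_cases ha : (X * f1 * f2).eval a = 0
      · rw [if_pos ha, sub_self]
        simp only [eval_mul, eval_X, mul_eq_zero] at ha
        have h0 : ∀ χ : MulChar L ℂ, χ 0 = 0 := fun χ => MulChar.map_nonunit χ not_isUnit_zero
        rcases ha with (ha | ha) | ha
        · rw [ha, h0]; simp
        · rw [ha, zero_div, h0]; simp
        · rw [ha, div_zero, h0]; simp
      · rw [if_neg ha, sub_zero]
        simp only [eval_mul, eval_X, mul_eq_zero, not_or] at ha
        rw [MulChar.one_apply (IsUnit.mk0 _ ha.1.1),
          MulChar.one_apply (IsUnit.mk0 _ (div_ne_zero ha.1.2 ha.2))]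
        simp
    rw [Finset.sum_congr rfl fun a _ => h1 a, Finset.sum_sub_distrib,
      AddChar.sum_eq_zero_of_ne_one hψ, zero_sub, norm_neg, ← Finset.sum_filter]
    have h2 : ‖∑ a ∈ Finset.univ.filter (fun a : L => (X * f1 * f2).eval a = 0), ψ a‖ ≤
        ∑ a ∈ Finset.univ.filter (fun a : L => (X * f1 * f2).eval a = 0), (1 : ℝ) :=
      norm_sum_le_of_le _ (fun a _ => (wl_add_norm ψ a).le)
    have h3 := wl_bad_card (X * f1 * f2) hR0.ne_zero
    rw [hR0d] at h3
    have h3' : ((Finset.univ.filter (fun a : L => (X * f1 * f2).eval a = 0)).card : ℝ) ≤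
      ((1 + f1.natDegree + f2.natDegree : ℕ) : ℝ) := Nat.cast_le.mpr h3
    rw [Finset.sum_const, nsmul_eq_mul, mul_one] at h2
    refine h2.trans (h3'.trans ?_)
    apply le_mul_of_one_le_right (Nat.cast_nonneg _)
    rw [Real.one_le_sqrt]
    exact_mod_cast hQ.le
  · obtain ⟨χ, a, b, hχ, ha, hb, rfl, rfl, hl⟩ := wl_generator χ1 χ2 h12
    have hd := orderOf_pos χ
    set c := b * (2 * orderOf χ - 1) with hc
    have hcpos : 0 < c := Nat.mul_pos hb (by omega)
    have hinv : χ ^ c = (χ ^ b)⁻¹ := by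
      rw [eq_inv_iff_mul_eq_one, ← pow_add]
      have : c + b = orderOf χ * (2 * b) := by
        rw [hc]
        obtain ⟨t, ht⟩ : ∃ t, 2 * orderOf χ = t + 1 := ⟨2 * orderOf χ - 1, by omega⟩
        rw [show 2 * orderOf χ - 1 = t by omega]
        calc b * t + b = b * (t + 1) := by ring
          _ = _ := by rw [← ht]; ring
      rw [this, pow_mul, pow_orderOf_eq_one, one_pow]
    have hlc : ∀ l : ℕ, l.Prime → l ∣ orderOf χ → l ∣ c → l ∣ b := by
      intro l hlp hlo hc'
      rcases (hlp.dvd_mul).mp hc' with h | h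
      · exact h
      · exfalso
        have h2 : l ∣ 2 * orderOf χ := hlo.mul_left _
        have h3 := (Nat.dvd_sub h2 h)
        rw [show 2 * orderOf χ - (2 * orderOf χ - 1) = 1 by omega] at h3
        exact hlp.one_lt.ne' (Nat.dvd_one.mp h3)
    have hF : (X ^ a * f1 ^ b * f2 ^ c).Monic := ((monic_X_pow a).mul (hf1.pow b)).mul (hf2.pow c)
    have hw := wl_weil (E := AlgebraicClosure L) χ hχ ψ (X ^ a * f1 ^ b * f2 ^ c) (X * f1 * f2)
      hF hR0 ?_ ?_
    · rw [hR0d] at hw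
      convert hw using 4 with x
      rw [eval_mul, eval_mul, eval_pow, eval_pow, eval_pow, eval_X, map_mul, map_mul, map_pow, map_pow,
        map_pow, ← MulChar.pow_apply' χ ha.ne', ← MulChar.pow_apply' χ hb.ne',
        ← MulChar.pow_apply' χ hcpos.ne', hinv, MulChar.inv_apply', div_eq_mul_inv, map_mul]
      ring
    · intro β
      simp only [map_mul, map_pow, aeval_X, mul_eq_zero, pow_eq_zero_iff ha.ne',
        pow_eq_zero_iff hb.ne', pow_eq_zero_iff hcpos.ne']
    · intro l hlp hlo
      by_cases hlb : l ∣ b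
      · exact wl_hp_zero f1 f2 hf1.ne_zero hf2.ne_zero a b c l (hl l hlp hlo hlb) hlb
          (hlb.mul_right _)
      · have hlk : ¬ l ∣ k := by
          intro hlk
          have h1 : l ∣ Nat.gcd k (Fintype.card L - 1) :=
            Nat.dvd_gcd hlk (hlo.trans (MulChar.orderOf_dvd_card_sub_one L χ))
          rw [hgcd] at h1
          exact hlp.one_lt.ne' (Nat.dvd_one.mp h1)
        have hgp : Prime g := hgi.prime
        have hgd : g ∣ f1 * f2 := (dvd_pow_self g hk.ne').trans hd1
        rcases hgp.dvd_or_dvd hgd with h | h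
        · exact wl_hp_aux g f1 f2 hg hgi hgX k hk hcop h hd1 hd2 a b c l hlp hlk hlb
        · have := wl_hp_aux (E := AlgebraicClosure L) g f2 f1 hg hgi hgX k hk hcop.symm h
            (by rwa [mul_comm]) (by rwa [mul_comm]) a c b l hlp hlk
            (fun h => hlb (hlc l hlp hlo h))
          rwa [mul_right_comm] at this

theorem wl_apply (f1 f2 : L[X]) (hf1 : f1 ≠ 0) (hf2 : f2 ≠ 0) (hcop : IsCoprime f1 f2)
    (k : ℕ) (g : L[X]) (hk : 0 < k) (hg : g.Monic) (hgi : Irreducible g) (hgX : g ≠ X)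
    (hgcd : Nat.gcd k (Fintype.card L - 1) = 1) (hd1 : g ^ k ∣ f1 * f2)
    (hd2 : ¬ g ^ (k + 1) ∣ f1 * f2) (χ1 χ2 : MulChar L ℂ) (ψ : AddChar L ℂ)
    (hne : ¬ (χ1 = 1 ∧ χ2 = 1 ∧ ψ = 1)) :
    ‖∑ a : L, χ1 a * χ2 (f1.eval a / f2.eval a) * ψ a‖ ≤
      (1 + f1.natDegree + f2.natDegree : ℕ) * Real.sqrt (Fintype.card L) := by
  have key : ∀ f : L[X], f ≠ 0 → ∃ (u : L) (f' : L[X]), u ≠ 0 ∧ f'.Monic ∧ f = C u * f' := by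
    intro f hf
    have h0 : f.leadingCoeff ≠ 0 := leadingCoeff_ne_zero.mpr hf
    refine ⟨f.leadingCoeff, f * C f.leadingCoeff⁻¹, h0, monic_mul_leadingCoeff_inv hf, ?_⟩
    rw [mul_comm f, ← mul_assoc, ← C_mul, mul_inv_cancel₀ h0, C_1, one_mul]
  obtain ⟨u, p, hu, hp, rfl⟩ := key f1 hf1
  obtain ⟨v, r, hv, hr, rfl⟩ := key f2 hf2
  have hCu : IsUnit (C u) := isUnit_C.mpr (IsUnit.mk0 _ hu)
  have hCv : IsUnit (C v) := isUnit_C.mpr (IsUnit.mk0 _ hv)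
  have hcop' : IsCoprime p r := (hcop.of_mul_left_right).of_mul_right_right
  have hass : Associated (p * r) (C u * p * (C v * r)) := by
    refine ⟨(hCu.mul hCv).unit, ?_⟩
    rw [IsUnit.unit_spec]; ring
  have h := wl_apply_monic p r hp hr hcop' k g hk hg hgi hgX hgcd
    (hass.dvd_iff_dvd_right.mpr hd1) (fun h => hd2 (hass.dvd_iff_dvd_right.mp h)) χ1 χ2 ψ hne
  rw [natDegree_C_mul hu, natDegree_C_mul hv]
  refine le_trans ?_ h
  have h2 : ∑ a : L, χ1 a * χ2 ((C u * p).eval a / (C v * r).eval a) * ψ a =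
      χ2 (u / v) * ∑ a : L, χ1 a * χ2 (p.eval a / r.eval a) * ψ a := by
    rw [Finset.mul_sum]
    refine Finset.sum_congr rfl fun a _ => ?_
    rw [eval_mul, eval_mul, eval_C, eval_C, mul_div_mul_comm, map_mul]
    ring
  rw [h2, norm_mul]
  exact mul_le_of_le_one_left (norm_nonneg _) (wl_norm_le_one _ _)

end


theorem wl_sieve_step {G : Type*} [CommGroup G] [Fintype G] (H : Subgroup G) (hH : H ≠ ⊥) :
    ∃ (c : G → ℂ) (θ : ℝ), 0 < θ ∧ c 1 = θ ∧ ∑ g, ‖c g‖ ≤ 2 * θ ∧ (∀ g, c g ≠ 0 → g ∈ H) ∧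
      ∀ ev : G →* ℂ, (∀ g ∈ H, ev g = 1) → ∑ g, c g * ev g = 0 := by
  classical
  set h := Fintype.card H with hh
  have hh1 : 1 < h := by
    rw [hh, ← Nat.card_eq_fintype_card]
    exact (Subgroup.one_lt_card_iff_ne_bot H).mpr hH
  have hhR : (1 : ℝ) < h := by exact_mod_cast hh1
  have hcard : (Finset.univ.filter (fun g => g ∈ H)).card = h := by
    rw [hh, Fintype.card_subtype]
  set c : G → ℂ := fun g => (if g = 1 then 1 else 0) - (if g ∈ H then (h : ℂ)⁻¹ else 0) with hc
  have hhC : (h : ℂ) ≠ 0 := by exact_mod_cast (by omega : h ≠ 0)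
  have hinv : (h : ℝ)⁻¹ < 1 := inv_lt_one_of_one_lt₀ hhR
  refine ⟨c, 1 - (h : ℝ)⁻¹, by linarith, ?_, ?_, ?_, ?_⟩
  · simp [hc, H.one_mem]
  · have h1 : ∀ g, ‖c g‖ = (if g = 1 then (1 - 2 * (h : ℝ)⁻¹) else 0) +
        (if g ∈ H then (h : ℝ)⁻¹ else 0) := by
      intro g
      by_cases hg : g = 1
      · subst hg
        simp only [hc, H.one_mem, if_true]
        have : (1 : ℂ) - (h : ℂ)⁻¹ = ((1 - (h : ℝ)⁻¹ : ℝ) : ℂ) := by push_cast; rfl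
        rw [this, Complex.norm_real, Real.norm_eq_abs, abs_of_pos (by linarith)]
        ring
      · by_cases hgH : g ∈ H
        · simp [hc, hg, hgH]
        · simp [hc, hg, hgH]
    rw [Finset.sum_congr rfl fun g _ => h1 g, Finset.sum_add_distrib, Finset.sum_ite_eq',
      ← Finset.sum_filter, Finset.sum_const, hcard, nsmul_eq_mul, mul_inv_cancel₀ (by positivity)]
    simp only [Finset.mem_univ, if_true]
    linarith
  · intro g hg
    by_contra hgH
    apply hg
    have : g ≠ 1 := fun h => hgH (h ▸ H.one_mem)
    simp [hc, this, hgH]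
  · intro ev hev
    have h1 : ∀ g, c g * ev g = (if g = 1 then 1 else 0) - (if g ∈ H then (h : ℂ)⁻¹ else 0) := by
      intro g
      by_cases hgH : g ∈ H
      · rw [hev g hgH, mul_one]
      · have : g ≠ 1 := fun h => hgH (h ▸ H.one_mem)
        simp [hc, this, hgH]
    rw [Finset.sum_congr rfl fun g _ => h1 g, Finset.sum_sub_distrib, Finset.sum_ite_eq',
      ← Finset.sum_filter, Finset.sum_const, hcard, nsmul_eq_mul, mul_inv_cancel₀ hhC]
    simp

theorem wl_sieve {G ι : Type*} [CommGroup G] [Fintype G] (S : Finset ι) (H : ι → Subgroup G)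
    (hH : ∀ i ∈ S, H i ≠ ⊥) (hind : S.SupIndep H) :
    ∃ (c : G → ℂ) (θ : ℝ), 0 < θ ∧ c 1 = θ ∧ ∑ g, ‖c g‖ ≤ 2 ^ S.card * θ ∧
      (∀ g, c g ≠ 0 → g ∈ S.sup H) ∧
      ∀ ev : G →* ℂ, (∃ i ∈ S, ∀ g ∈ H i, ev g = 1) → ∑ g, c g * ev g = 0 := by
  classical
  induction S using Finset.induction_on with
  | empty =>
    refine ⟨fun g => if g = 1 then 1 else 0, 1, one_pos, by simp, ?_, ?_, ?_⟩
    · simp [apply_ite norm]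
    · intro g hg
      have : g = 1 := by by_contra h; simp [h] at hg
      rw [this]; exact Subgroup.one_mem _
    · rintro ev ⟨i, hi, -⟩; simp at hi
  | insert i S hiS ih =>
    obtain ⟨c, θ, hθ, hc1, hcn, hcs, hce⟩ := ih (fun j hj => hH j (Finset.mem_insert_of_mem hj))
      (hind.subset (Finset.subset_insert _ _))
    obtain ⟨d, η, hη, hd1, hdn, hds, hde⟩ := wl_sieve_step (H i) (hH i (Finset.mem_insert_self _ _))
    have hdis : Disjoint (H i) (S.sup H) :=
      hind (Finset.subset_insert _ _) (Finset.mem_insert_self _ _) hiS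
    have hconv : ∀ ev : G →* ℂ, ∑ g, (∑ h, d h * c (h⁻¹ * g)) * ev g =
        (∑ h, d h * ev h) * ∑ g, c g * ev g := by
      intro ev
      simp_rw [Finset.sum_mul]
      rw [Finset.sum_comm]
      refine Finset.sum_congr rfl fun h _ => ?_
      rw [Finset.mul_sum]
      refine Fintype.sum_equiv (Equiv.mulLeft h⁻¹) _ _ fun g => ?_
      have : ev g = ev h * ev (h⁻¹ * g) := by rw [← map_mul]; simp
      simp only [Equiv.coe_mulLeft]
      rw [this]; ring
    refine ⟨fun g => ∑ h, d h * c (h⁻¹ * g), η * θ, mul_pos hη hθ, ?_, ?_, ?_, ?_⟩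
    · simp only
      rw [Finset.sum_eq_single 1]
      · simp [hd1, hc1]
      · intro h _ hh
        by_contra hne
        obtain ⟨h1, h2⟩ := mul_ne_zero_iff.mp hne
        have h3 := hcs _ h2
        rw [mul_one] at h3
        have h4 := (S.sup H).inv_mem h3
        rw [inv_inv] at h4
        exact hh ((Subgroup.disjoint_def.mp hdis) (hds h h1) h4)
      · simp
    · calc ∑ g, ‖∑ h, d h * c (h⁻¹ * g)‖ ≤ ∑ g, ∑ h, ‖d h‖ * ‖c (h⁻¹ * g)‖ :=
            Finset.sum_le_sum fun g _ => (norm_sum_le _ _).trans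
              (Finset.sum_le_sum fun h _ => (norm_mul _ _).le)
        _ = ∑ h, ‖d h‖ * ∑ g, ‖c g‖ := by
            rw [Finset.sum_comm]
            refine Finset.sum_congr rfl fun h _ => ?_
            rw [Finset.mul_sum]
            exact Fintype.sum_equiv (Equiv.mulLeft h⁻¹) _ _ fun g => by simp
        _ = (∑ h, ‖d h‖) * ∑ g, ‖c g‖ := by rw [Finset.sum_mul]
        _ ≤ (2 * η) * (2 ^ S.card * θ) := by
            apply mul_le_mul hdn hcn (Finset.sum_nonneg fun _ _ => norm_nonneg _)
            positivity
        _ = _ := by rw [Finset.card_insert_of_notMem hiS]; ring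
    · intro g hg
      obtain ⟨h, -, hh⟩ := Finset.exists_ne_zero_of_sum_ne_zero hg
      obtain ⟨h1, h2⟩ := mul_ne_zero_iff.mp hh
      rw [Finset.sup_insert]
      have h3 : g = h * (h⁻¹ * g) := by simp
      rw [h3]
      exact Subgroup.mul_mem_sup (hds h h1) (hcs _ h2)
    · rintro ev ⟨j, hj, hj2⟩
      simp only
      rw [hconv]
      rcases Finset.mem_insert.mp hj with rfl | hj
      · rw [hde ev hj2, zero_mul]
      · rw [hce ev ⟨j, hj, hj2⟩, mul_zero]


section
variable {L : Type*} [Field L] [Fintype L]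

theorem wl_prim [Fintype (MulChar L ℂ)] : ∃ (c : MulChar L ℂ → ℂ) (θ : ℝ), 0 < θ ∧ c 1 = θ ∧
    ∑ χ, ‖c χ‖ ≤ 2 ^ (Fintype.card L - 1).primeFactors.card * θ ∧
    ∀ α : L, ∑ χ, c χ * χ α ≠ 0 → α ≠ 0 ∧ orderOf α = Fintype.card L - 1 := by
  classical
  set N := Fintype.card L - 1 with hN
  have hNpos : 0 < N := by have := wl_card_gt (L := L); omega
  obtain ⟨φ⟩ := MulChar.mulEquiv_units L ℂ
  have hcyc : IsCyclic (MulChar L ℂ) := isCyclic_of_surjective φ.symm φ.symm.surjective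
  have hpowN : ∀ χ : MulChar L ℂ, χ ^ N = 1 := fun χ =>
    orderOf_dvd_iff_pow_eq_one.mp (MulChar.orderOf_dvd_card_sub_one L χ)
  set H : ℕ → Subgroup (MulChar L ℂ) := fun p => (powMonoidHom (N / p)).range with hH
  have hcardM : Nat.card (MulChar L ℂ) = N := by
    rw [Nat.card_congr φ.toEquiv, Nat.card_units, Nat.card_eq_fintype_card]
  have htor : ∀ p ∈ N.primeFactors, ∀ x ∈ H p, x ^ p = 1 := by
    rintro p hp x ⟨y, rfl⟩
    simp only [powMonoidHom_apply]
    rw [← pow_mul, Nat.div_mul_cancel (Nat.dvd_of_mem_primeFactors hp), hpowN]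
  have hs1 : ∀ i ∈ N.primeFactors, H i ≠ ⊥ := by
    intro p hp hbot
    have hpp := Nat.prime_of_mem_primeFactors hp
    have hpN := Nat.dvd_of_mem_primeFactors hp
    obtain ⟨χ, hχ⟩ := IsCyclic.exists_ofOrder_eq_natCard (α := MulChar L ℂ)
    rw [hcardM] at hχ
    have : χ ^ (N / p) ∈ H p := ⟨χ, rfl⟩
    rw [hbot, Subgroup.mem_bot] at this
    have hd := orderOf_dvd_of_pow_eq_one this
    rw [hχ] at hd
    have h5 : 0 < N / p := Nat.div_pos (Nat.le_of_dvd hNpos hpN) hpp.pos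
    exact absurd (Nat.le_of_dvd h5 hd) (not_le.mpr (Nat.div_lt_self hNpos hpp.one_lt))
  have hs2 : (N.primeFactors).SupIndep H := by
    intro t ht p hp hpt
    rw [Subgroup.disjoint_def]
    intro x hx1 hx2
    have key : ∀ t : Finset ℕ, t ⊆ N.primeFactors → ∀ x ∈ t.sup H, x ^ (∏ i ∈ t, i) = 1 := by
      intro t
      induction t using Finset.induction_on with
      | empty => intro _ x hx; simpa using hx
      | insert i t hit ih =>
        intro hs x hx
        rw [Finset.sup_insert, Subgroup.mem_sup] at hx
        obtain ⟨y, hy, z, hz, rfl⟩ := hx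
        rw [Finset.prod_insert hit, mul_pow, pow_mul, htor i (hs (Finset.mem_insert_self _ _)) y hy,
          mul_comm i, pow_mul z, ih (fun j hj => hs (Finset.mem_insert_of_mem hj)) z hz]
        simp
    have h5 := orderOf_dvd_of_pow_eq_one (htor p hp x hx1)
    have h6 := orderOf_dvd_of_pow_eq_one (key t ht x hx2)
    have hcop : Nat.Coprime p (∏ i ∈ t, i) := by
      apply Nat.Coprime.prod_right
      intro i hi
      rw [Nat.coprime_primes (Nat.prime_of_mem_primeFactors hp)
        (Nat.prime_of_mem_primeFactors (ht hi))]
      rintro rfl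
      exact hpt hi
    have h7 := Nat.dvd_gcd h5 h6
    rw [hcop.gcd_eq_one, Nat.dvd_one, orderOf_eq_one_iff] at h7
    exact h7
  obtain ⟨c, θ, hθ, h1, h2, -, h3⟩ := wl_sieve N.primeFactors H hs1 hs2
  refine ⟨c, θ, hθ, h1, h2, fun α hα => ?_⟩
  have hα0 : α ≠ 0 := by
    rintro rfl
    apply hα
    exact Finset.sum_eq_zero fun χ _ => by
      rw [MulChar.map_nonunit χ not_isUnit_zero, mul_zero]
  refine ⟨hα0, ?_⟩
  apply orderOf_eq_of_pow_and_pow_div_prime hNpos (FiniteField.pow_card_sub_one_eq_one α hα0)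
  intro p hp hpN hone
  apply hα
  let ev : MulChar L ℂ →* ℂ :=
    { toFun := fun χ => χ α
      map_one' := MulChar.one_apply (IsUnit.mk0 _ hα0)
      map_mul' := fun χ χ' => MulChar.mul_apply χ χ' α }
  apply h3 ev
  refine ⟨p, Nat.mem_primeFactors.mpr ⟨hp, hpN, hNpos.ne'⟩, ?_⟩
  rintro _ ⟨χ, rfl⟩
  have hne : N / p ≠ 0 := (Nat.div_pos (Nat.le_of_dvd hNpos hpN) hp.pos).ne'
  change (χ ^ (N / p)) α = 1
  rw [MulChar.pow_apply' χ hne, ← map_pow, hone, map_one]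

end


section
variable {K L : Type*} [Field K] [Fintype K] [Field L] [Fintype L] [Algebra K L]

/-- the Frobenius as a linear endomorphism. -/
noncomputable def wlFr (K L : Type*) [Field K] [Fintype K] [Field L] [Algebra K L] : Module.End K L :=
  (FiniteField.frobeniusAlgHom K L).toLinearMap

theorem wlFr_pow (i : ℕ) (x : L) : ((wlFr K L) ^ i) x = x ^ (Fintype.card K ^ i) := by
  induction i generalizing x with
  | zero => simp
  | succ i ih =>
    rw [pow_succ, Module.End.mul_apply, ih]
    change (x ^ Fintype.card K) ^ _ = _
    rw [← pow_mul, ← pow_succ']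

theorem wlFr_minpoly : minpoly K (wlFr K L) = X ^ Module.finrank K L - 1 :=
  FiniteField.minpoly_frobeniusAlgHom K L

theorem wlFr_aeval (n : ℕ) (hn : Module.finrank K L = n) :
    aeval (wlFr K L) (X ^ n - 1 : K[X]) = 0 := by
  rw [← hn, ← wlFr_minpoly]; exact minpoly.aeval _ _

/-- characters factoring through `U(Frob)`. -/
noncomputable def wlPull (U : K[X]) : AddChar L ℂ →* AddChar L ℂ where
  toFun ψ := ψ.compAddMonoidHom (aeval (wlFr K L) U).toAddMonoidHom
  map_one' := rfl
  map_mul' _ _ := rfl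

theorem wlPull_apply (U : K[X]) (ψ : AddChar L ℂ) (x : L) :
    wlPull U ψ x = ψ (aeval (wlFr K L) U x) := rfl

theorem wlPull_comp (U V : K[X]) (ψ : AddChar L ℂ) : wlPull U (wlPull V ψ) = wlPull (U * V) ψ := by
  ext x
  rw [wlPull_apply, wlPull_apply, wlPull_apply, mul_comm, map_mul, Module.End.mul_apply]

theorem wlPull_add (U V : K[X]) (ψ : AddChar L ℂ) : wlPull (U + V) ψ = wlPull U ψ * wlPull V ψ := by
  ext x
  rw [AddChar.mul_apply, wlPull_apply, wlPull_apply, wlPull_apply, map_add, LinearMap.add_apply,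
    AddChar.map_add_eq_mul]

theorem wlPull_one (ψ : AddChar L ℂ) : wlPull (1 : K[X]) ψ = ψ := by
  ext x
  rw [wlPull_apply, map_one, Module.End.one_apply]

theorem wl_normal_of (n : ℕ) (hn : Module.finrank K L = n) (hn0 : 0 < n) (α : L)
    (h : ∀ P V : K[X], P.Monic → Irreducible P → P * V = X ^ n - 1 → aeval (wlFr K L) V α ≠ 0) :
    LinearIndependent K (fun i : Fin n => α ^ Fintype.card K ^ (i : ℕ)) ∧
    Submodule.span K (Set.range fun i : Fin n => α ^ Fintype.card K ^ (i : ℕ)) = ⊤ := by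
  classical
  have hX : (X ^ n - 1 : K[X]) ≠ 0 := X_pow_sub_C_ne_zero hn0 1
  have hXd : (X ^ n - 1 : K[X]).natDegree = n := natDegree_X_pow_sub_C (r := (1 : K))
  have hli : LinearIndependent K (fun i : Fin n => α ^ Fintype.card K ^ (i : ℕ)) := by
    rw [Fintype.linearIndependent_iff]
    intro a ha
    set U : K[X] := ∑ i : Fin n, C (a i) * X ^ (i : ℕ) with hU
    have hUα : aeval (wlFr K L) U α = 0 := by
      rw [← ha, hU, map_sum, LinearMap.sum_apply]
      refine Finset.sum_congr rfl fun i _ => ?_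
      rw [map_mul, aeval_C, map_pow, aeval_X, Module.End.mul_apply, wlFr_pow,
        Module.algebraMap_end_apply]
    have hUd : U.degree < n := by
      rw [hU]
      refine (degree_sum_le _ _).trans_lt ?_
      rw [Finset.sup_lt_iff (by exact_mod_cast WithBot.bot_lt_coe n)]
      intro i _
      exact (degree_C_mul_X_pow_le _ _).trans_lt (by exact_mod_cast i.2)
    have hU0 : U = 0 := by
      by_contra hU0
      set D := EuclideanDomain.gcd U (X ^ n - 1) with hD
      have hDα : aeval (wlFr K L) D α = 0 := by
        rw [hD, EuclideanDomain.gcd_eq_gcd_ab, map_add, LinearMap.add_apply, mul_comm U, map_mul,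
          map_mul, Module.End.mul_apply, hUα, wlFr_aeval n hn]
        simp
      obtain ⟨M, hM⟩ := EuclideanDomain.gcd_dvd_right U (X ^ n - 1)
      have hDU : D.degree < n := (degree_le_of_dvd (EuclideanDomain.gcd_dvd_left _ _) hU0).trans_lt hUd
      rw [← hD] at hM
      have hM0 : M ≠ 0 := by rintro rfl; rw [mul_zero] at hM; exact hX hM
      have hMu : ¬ IsUnit M := by
        intro hu
        have h1 := congrArg degree hM
        rw [degree_mul, degree_eq_zero_of_isUnit hu, add_zero, degree_eq_natDegree hX, hXd] at h1
        rw [← h1] at hDU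
        exact lt_irrefl _ hDU
      obtain ⟨P, hP, hPM⟩ := WfDvdMonoid.exists_irreducible_factor hMu hM0
      have hass : Associated (normalize P) P := normalize_associated P
      obtain ⟨M', hM'⟩ := hass.dvd.trans hPM
      refine h (normalize P) (D * M') (monic_normalize hP.ne_zero) (hass.irreducible_iff.mpr hP) ?_ ?_
      · rw [hM, hM']; ring
      · rw [mul_comm, map_mul, Module.End.mul_apply, hDα, map_zero]
    intro i
    have := congrArg (fun p => coeff p (i : ℕ)) hU0
    simp only [hU, finsetSum_coeff, coeff_C_mul, coeff_X_pow, coeff_zero] at this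
    rw [Finset.sum_eq_single i] at this
    · simpa using this
    · intro j _ hj
      rw [if_neg (fun h => hj (Fin.ext h.symm)), mul_zero]
    · simp
  refine ⟨hli, ?_⟩
  have : Nonempty (Fin n) := ⟨⟨0, hn0⟩⟩
  exact hli.span_eq_top_of_card_eq_finrank (by simp [hn])

theorem wl_norm_sieve [DecidableEq K] (n : ℕ) (hn : Module.finrank K L = n) (hn0 : 0 < n) :
    ∃ (c : AddChar L ℂ → ℂ) (θ : ℝ), 0 < θ ∧ c 1 = θ ∧
    ∑ ψ, ‖c ψ‖ ≤ 2 ^ (UniqueFactorizationMonoid.normalizedFactors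
      (X ^ n - 1 : K[X])).toFinset.card * θ ∧
    ∀ α : L, ∑ ψ, c ψ * ψ α ≠ 0 →
      LinearIndependent K (fun i : Fin n => α ^ Fintype.card K ^ (i : ℕ)) ∧
      Submodule.span K (Set.range fun i : Fin n => α ^ Fintype.card K ^ (i : ℕ)) = ⊤ := by
  classical
  have hX : (X ^ n - 1 : K[X]) ≠ 0 := X_pow_sub_C_ne_zero hn0 1
  have hXd : (X ^ n - 1 : K[X]).natDegree = n := natDegree_X_pow_sub_C (r := (1 : K))
  set S := (UniqueFactorizationMonoid.normalizedFactors (X ^ n - 1 : K[X])).toFinset with hS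
  have hmem : ∀ P, P ∈ S ↔ Irreducible P ∧ P.Monic ∧ P ∣ X ^ n - 1 := by
    intro P
    rw [hS, Multiset.mem_toFinset, Polynomial.mem_normalizedFactors_iff hX]
  have hmul : ∀ P ∈ S, P * ((X ^ n - 1) / P) = X ^ n - 1 := fun P hP =>
    EuclideanDomain.mul_div_cancel' ((hmem P).mp hP).1.ne_zero ((hmem P).mp hP).2.2
  set H : K[X] → Subgroup (AddChar L ℂ) := fun P => (wlPull ((X ^ n - 1) / P)).range with hH
  have htor : ∀ P ∈ S, ∀ x ∈ H P, wlPull P x = 1 := by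
    rintro P hP x ⟨y, rfl⟩
    rw [wlPull_comp, hmul P hP]
    ext z
    rw [wlPull_apply, wlFr_aeval n hn]
    simp
  have hs1 : ∀ i ∈ S, H i ≠ ⊥ := by
    intro P hP hbot
    have hV0 : aeval (wlFr K L) ((X ^ n - 1) / P) ≠ 0 := by
      intro h0
      have hd := minpoly.dvd K _ h0
      rw [wlFr_minpoly, hn] at hd
      have hne : (X ^ n - 1) / P ≠ 0 := by
        intro h; have := hmul P hP; rw [h, mul_zero] at this; exact hX this.symm
      have h5 := natDegree_le_of_dvd hd hne
      have h6 := congrArg natDegree (hmul P hP)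
      rw [natDegree_mul ((hmem P).mp hP).1.ne_zero hne] at h6
      have h7 := ((hmem P).mp hP).1.natDegree_pos
      omega
    obtain ⟨x, hx⟩ : ∃ x, aeval (wlFr K L) ((X ^ n - 1) / P) x ≠ 0 := by
      by_contra hcon
      push Not at hcon
      exact hV0 (LinearMap.ext hcon)
    obtain ⟨ψ, hψ⟩ := AddChar.exists_apply_ne_zero.mpr hx
    have : wlPull ((X ^ n - 1) / P) ψ ∈ H P := ⟨ψ, rfl⟩
    rw [hbot, Subgroup.mem_bot] at this
    apply hψ
    rw [← wlPull_apply, this, AddChar.one_apply]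
  have hs2 : (S).SupIndep H := by
    intro t ht P hP hPt
    rw [Subgroup.disjoint_def]
    intro x hx1 hx2
    have key : ∀ t : Finset K[X], t ⊆ S → ∀ x ∈ t.sup H, wlPull (∏ i ∈ t, i) x = 1 := by
      intro t
      induction t using Finset.induction_on with
      | empty =>
        intro _ x hx
        rw [Finset.prod_empty, wlPull_one]
        simpa using hx
      | insert i t hit ih =>
        intro hs x hx
        rw [Finset.sup_insert, Subgroup.mem_sup] at hx
        obtain ⟨y, hy, z, hz, rfl⟩ := hx
        rw [Finset.prod_insert hit, map_mul, ← wlPull_comp i _ z, mul_comm i, ← wlPull_comp,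
          htor i (hs (Finset.mem_insert_self _ _)) y hy,
          ih (fun j hj => hs (Finset.mem_insert_of_mem hj)) z hz]
        simp
    have hcop : IsCoprime P (∏ i ∈ t, i) := by
      apply IsCoprime.prod_right
      intro i hi
      obtain ⟨hPi, hPm, -⟩ := (hmem P).mp hP
      obtain ⟨hii, him, -⟩ := (hmem i).mp (ht hi)
      rw [hPi.coprime_iff_not_dvd]
      intro hd
      have := eq_of_monic_of_associated hPm him (hPi.associated_of_dvd hii hd)
      exact hPt (this ▸ hi)
    obtain ⟨a, b, hab⟩ := hcop
    rw [← wlPull_one (K := K) x, ← hab, wlPull_add, ← wlPull_comp, ← wlPull_comp, htor P hP x hx1,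
      key t ht x hx2]
    simp
  obtain ⟨c, θ, hθ, h1, h2, -, h3⟩ := wl_sieve S H hs1 hs2
  refine ⟨c, θ, hθ, h1, h2, fun α hα => wl_normal_of n hn hn0 α ?_⟩
  intro P V hPm hPi hPV h0
  apply hα
  let ev : AddChar L ℂ →* ℂ :=
    { toFun := fun ψ => ψ α
      map_one' := rfl
      map_mul' := fun ψ ψ' => rfl }
  have hPS : P ∈ S := (hmem P).mpr ⟨hPi, hPm, ⟨V, hPV.symm⟩⟩
  have hV : (X ^ n - 1) / P = V :=
    mul_left_cancel₀ hPi.ne_zero ((hmul P hPS).trans hPV.symm)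
  apply h3 ev
  refine ⟨P, hPS, ?_⟩
  rintro _ ⟨ψ, rfl⟩
  change wlPull ((X ^ n - 1) / P) ψ α = 1
  rw [wlPull_apply, hV, h0, AddChar.map_zero_eq_one]

end


theorem wl_prod3 {A B C R : Type*} [Fintype A] [Fintype B] [Fintype C] [CommSemiring R]
    (f : A → R) (g : B → R) (h : C → R) :
    ∑ t : A × B × C, f t.1 * (g t.2.1 * h t.2.2) = (∑ x, f x) * ((∑ x, g x) * ∑ x, h x) := by
  rw [Fintype.sum_prod_type, Finset.sum_mul]
  refine Finset.sum_congr rfl fun x _ => ?_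
  dsimp only
  rw [← Finset.mul_sum, Fintype.sum_prod_type, Finset.sum_mul]
  congr 1
  refine Finset.sum_congr rfl fun y _ => ?_
  dsimp only
  rw [← Finset.mul_sum]

theorem wl_Wnat (N : ℕ) (hN : N ≠ 0) : 2 ^ N.primeFactors.card ≤ Wnat N := by
  have h := congrArg Multiset.card (Nat.divisors_filter_squarefree hN)
  rw [Multiset.card_map] at h
  have h2 : Wnat N = (UniqueFactorizationMonoid.normalizedFactors N).toFinset.powerset.card := h
  rw [h2, Finset.card_powerset]
  apply le_of_eq
  congr 2
  ext p
  rw [Nat.mem_primeFactors, Multiset.mem_toFinset, UniqueFactorizationMonoid.mem_normalizedFactors_iff' hN]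
  simp [Nat.irreducible_iff_nat_prime, hN]

theorem wl_Wpoly {K : Type} [Field K] [Fintype K] [DecidableEq K] (U : K[X]) (hU : U ≠ 0) :
    2 ^ (UniqueFactorizationMonoid.normalizedFactors U).toFinset.card ≤ Wpoly U := by
  classical
  set S := (UniqueFactorizationMonoid.normalizedFactors U).toFinset with hS
  have hmem : ∀ P, P ∈ S ↔ Irreducible P ∧ P.Monic ∧ P ∣ U := by
    intro P
    rw [hS, Multiset.mem_toFinset, Polynomial.mem_normalizedFactors_iff hU]
  have hfin : Finite {h : K[X] // h.Monic ∧ Squarefree h ∧ h ∣ U} := by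
    have hf : Finite (degreeLT K (U.natDegree + 1)) :=
      Finite.of_equiv _ (degreeLTEquiv K (U.natDegree + 1)).symm.toEquiv
    apply Finite.of_injective (β := degreeLT K (U.natDegree + 1))
      (fun h => ⟨h.1, by
        rw [mem_degreeLT]
        refine (degree_le_of_dvd h.2.2.2 hU).trans_lt ?_
        rw [degree_eq_natDegree hU]
        exact_mod_cast Nat.lt_succ_self _⟩)
    intro a b hab
    exact Subtype.ext (Subtype.mk.inj hab)
  have hcop : ∀ P ∈ S, ∀ R ∈ S, P ≠ R → IsCoprime P R := by
    intro P hP R hR hne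
    obtain ⟨hPi, hPm, -⟩ := (hmem P).mp hP
    obtain ⟨hii, him, -⟩ := (hmem R).mp hR
    rw [hPi.coprime_iff_not_dvd]
    intro hd
    exact hne (eq_of_monic_of_associated hPm him (hPi.associated_of_dvd hii hd))
  have hdvd : ∀ T ∈ S.powerset, ∀ P ∈ S, (P ∣ ∏ i ∈ T, i) → P ∈ T := by
    intro T hT P hP hd
    rw [Finset.mem_powerset] at hT
    by_contra hPT
    have h1 : IsCoprime P (∏ i ∈ T, i) :=
      IsCoprime.prod_right fun i hi => hcop P hP i (hT hi) (fun h => hPT (h ▸ hi))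
    exact ((hmem P).mp hP).1.not_isUnit (h1.isUnit_of_dvd' dvd_rfl hd)
  rw [← Finset.card_powerset, ← Nat.card_eq_finsetCard, Wpoly]
  apply Nat.card_le_card_of_injective (fun T : S.powerset =>
    (⟨∏ i ∈ T.1, i, ?_⟩ : {h : K[X] // h.Monic ∧ Squarefree h ∧ h ∣ U}))
  · rintro ⟨T, hT⟩ ⟨T', hT'⟩ h
    have h' : ∏ i ∈ T, i = ∏ i ∈ T', i := congrArg Subtype.val h
    apply Subtype.ext
    have hTs := Finset.mem_powerset.mp hT
    have hTs' := Finset.mem_powerset.mp hT'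
    ext P
    constructor
    · intro hP
      exact hdvd T' hT' P (hTs hP) (h' ▸ Finset.dvd_prod_of_mem _ hP)
    · intro hP
      exact hdvd T hT P (hTs' hP) (h' ▸ Finset.dvd_prod_of_mem _ hP)
  · have hT := Finset.mem_powerset.mp T.2
    refine ⟨monic_prod_of_monic _ _ fun i hi => ((hmem i).mp (hT hi)).2.1, ?_, ?_⟩
    · apply Finset.squarefree_prod_of_pairwise_isCoprime
      · intro i hi j hj hij
        exact (hcop i (hT hi) j (hT hj) hij).isRelPrime
      · intro i hi
        exact ((hmem i).mp (hT hi)).1.squarefree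
    · apply Finset.prod_dvd_of_coprime
      · intro i hi j hj hij
        exact hcop i (hT hi) j (hT hj) hij
      · intro i hi
        exact ((hmem i).mp (hT hi)).2.2

theorem wl_final_ineq (Q D m w : ℝ) (hD : 1 ≤ D) (hDm : D ≤ m) (hw : 1 ≤ w) (hQ : 1 < Q)
    (h : m * w ≤ Real.sqrt Q) : (w - 1) * (D * Real.sqrt Q) < Q - D := by
  set y := Real.sqrt Q with hy
  have hyy : y * y = Q := Real.mul_self_sqrt (by linarith)
  have hy1 : 1 < y := by rw [hy, Real.lt_sqrt] <;> linarith
  have h1 : D * w ≤ y := (mul_le_mul_of_nonneg_right hDm (by linarith)).trans h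
  have h2 : (D * w) * y ≤ y * y := mul_le_mul_of_nonneg_right h1 (by linarith)
  have h3 : D < D * y := by nlinarith
  nlinarith

theorem wl_main {L : Type} [Field L] [Fintype L] [Fintype (MulChar L ℂ)] (f1 f2 : L[X]) (hf1 : f1 ≠ 0) (hf2 : f2 ≠ 0)
    (hcop : IsCoprime f1 f2)
    (k : ℕ) (g : L[X]) (hk : 0 < k) (hg : g.Monic) (hgi : Irreducible g) (hgX : g ≠ X)
    (hgcd : Nat.gcd k (Fintype.card L - 1) = 1) (hd1 : g ^ k ∣ f1 * f2)
    (hd2 : ¬ g ^ (k + 1) ∣ f1 * f2) (c1 : MulChar L ℂ → ℂ) (c3 : AddChar L ℂ → ℂ)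
    (θ1 θ3 w1 w3 : ℝ) (hθ1 : 0 < θ1) (hθ3 : 0 < θ3) (h11 : c1 1 = θ1) (h31 : c3 1 = θ3)
    (h1 : ∑ χ, ‖c1 χ‖ ≤ w1 * θ1) (h3 : ∑ ψ, ‖c3 ψ‖ ≤ w3 * θ3)
    (hlt : (w1 ^ 2 * w3 - 1) * (((1 + f1.natDegree + f2.natDegree : ℕ) : ℝ) *
      Real.sqrt (Fintype.card L)) < Fintype.card L - ((1 + f1.natDegree + f2.natDegree : ℕ) : ℝ)) :
    ∃ α : L, ∑ χ, c1 χ * χ α ≠ 0 ∧ ∑ χ, c1 χ * χ (f1.eval α / f2.eval α) ≠ 0 ∧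
      ∑ ψ, c3 ψ * ψ α ≠ 0 := by
  classical
  set D : ℕ := 1 + f1.natDegree + f2.natDegree with hD
  set B : ℝ := (D : ℝ) * Real.sqrt (Fintype.card L) with hB
  have hB0 : 0 ≤ B := by positivity
  by_contra hcon
  push Not at hcon
  set I := MulChar L ℂ × MulChar L ℂ × AddChar L ℂ
  set c : I → ℂ := fun t => c1 t.1 * c1 t.2.1 * c3 t.2.2 with hc
  set s : I → ℂ := fun t => ∑ a : L, t.1 a * t.2.1 (f1.eval a / f2.eval a) * t.2.2 a with hs
  have hsum0 : ∑ t : I, c t * s t = 0 := by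
    have h5 : ∑ t : I, c t * s t = ∑ a : L, (∑ χ, c1 χ * χ a) *
        ((∑ χ, c1 χ * χ (f1.eval a / f2.eval a)) * ∑ ψ, c3 ψ * ψ a) := by
      have h6 : ∀ t : I, c t * s t = ∑ a : L, c1 t.1 * t.1 a *
          ((c1 t.2.1 * t.2.1 (f1.eval a / f2.eval a)) * (c3 t.2.2 * t.2.2 a)) := by
        intro t
        rw [hs, hc]
        beta_reduce
        rw [Finset.mul_sum]
        exact Finset.sum_congr rfl fun a _ => by ring
      rw [Finset.sum_congr rfl fun t _ => h6 t, Finset.sum_comm]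
      refine Finset.sum_congr rfl fun a _ => ?_
      exact wl_prod3 (fun χ : MulChar L ℂ => c1 χ * χ a)
        (fun χ : MulChar L ℂ => c1 χ * χ (f1.eval a / f2.eval a))
        (fun ψ : AddChar L ℂ => c3 ψ * ψ a)
    rw [h5]
    refine Finset.sum_eq_zero fun a _ => ?_
    by_cases ha : ∑ χ, c1 χ * χ a = 0
    · rw [ha, zero_mul]
    by_cases hb : ∑ χ, c1 χ * χ (f1.eval a / f2.eval a) = 0
    · rw [hb, zero_mul, mul_zero]
    · rw [hcon a ha hb, mul_zero, mul_zero]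
  have hcn : ∑ t : I, ‖c t‖ ≤ (w1 * θ1) * ((w1 * θ1) * (w3 * θ3)) := by
    have h5 : ∑ t : I, ‖c t‖ = (∑ χ, ‖c1 χ‖) * ((∑ χ, ‖c1 χ‖) * ∑ ψ, ‖c3 ψ‖) := by
      rw [← wl_prod3 (fun χ => ‖c1 χ‖) (fun χ => ‖c1 χ‖) (fun ψ => ‖c3 ψ‖)]
      refine Finset.sum_congr rfl fun t _ => ?_
      rw [hc]
      beta_reduce
      rw [norm_mul, norm_mul, mul_assoc]
    rw [h5]
    have p1 : 0 ≤ ∑ χ, ‖c1 χ‖ := Finset.sum_nonneg fun _ _ => norm_nonneg _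
    have p3 : 0 ≤ ∑ ψ, ‖c3 ψ‖ := Finset.sum_nonneg fun _ _ => norm_nonneg _
    have hw : 0 ≤ w1 * θ1 := p1.trans h1
    exact mul_le_mul h1 (mul_le_mul h1 h3 p3 hw) (mul_nonneg p1 p3) hw
  have hmain : ((Fintype.card L : ℝ) - D) ≤ ‖s 1‖ := by
    have h5 : ∀ a : L, (1 : MulChar L ℂ) a * (1 : MulChar L ℂ) (f1.eval a / f2.eval a) *
        (1 : AddChar L ℂ) a = if ¬ (X * f1 * f2).eval a = 0 then 1 else 0 := by
      intro a
      by_cases ha : (X * f1 * f2).eval a = 0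
      · rw [if_neg (not_not.mpr ha)]
        simp only [eval_mul, eval_X, mul_eq_zero] at ha
        have h0 : ∀ χ : MulChar L ℂ, χ 0 = 0 := fun χ => MulChar.map_nonunit χ not_isUnit_zero
        rcases ha with (ha | ha) | ha
        · rw [ha, h0]; simp
        · rw [ha, zero_div, h0]; simp
        · rw [ha, div_zero, h0]; simp
      · rw [if_pos ha]
        simp only [eval_mul, eval_X, mul_eq_zero, not_or] at ha
        rw [MulChar.one_apply (IsUnit.mk0 _ ha.1.1),
          MulChar.one_apply (IsUnit.mk0 _ (div_ne_zero ha.1.2 ha.2))]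
        simp
    have h6 : s 1 = ((Finset.univ.filter (fun a : L => ¬ (X * f1 * f2).eval a = 0)).card : ℂ) := by
      rw [Finset.card_filter]
      push_cast
      exact Finset.sum_congr rfl fun a _ => h5 a
    have hR : X * f1 * f2 ≠ 0 := mul_ne_zero (mul_ne_zero X_ne_zero hf1) hf2
    have h7 := wl_bad_card (X * f1 * f2) hR
    rw [natDegree_mul (mul_ne_zero X_ne_zero hf1) hf2, natDegree_mul X_ne_zero hf1, natDegree_X,
      ← hD] at h7
    have h8 := Finset.card_filter_add_card_filter_not (s := (Finset.univ : Finset L))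
      (fun a => (X * f1 * f2).eval a = 0)
    rw [Finset.card_univ] at h8
    rw [h6, Complex.norm_natCast]
    have h9 : (Fintype.card L : ℝ) ≤ D +
        (Finset.univ.filter (fun a : L => ¬ (X * f1 * f2).eval a = 0)).card := by
      exact_mod_cast (by omega)
    linarith
  have hbound : ∀ t : I, t ≠ 1 → ‖s t‖ ≤ B := by
    rintro ⟨χ1, χ2, ψ⟩ ht
    refine wl_apply f1 f2 hf1 hf2 hcop k g hk hg hgi hgX hgcd hd1 hd2 χ1 χ2 ψ ?_
    rintro ⟨rfl, rfl, rfl⟩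
    exact ht rfl
  set Θ := θ1 * (θ1 * θ3) with hΘ
  have hΘ0 : 0 < Θ := by positivity
  have hc1 : ‖c 1‖ = Θ := by
    change ‖c1 1 * c1 1 * c3 1‖ = Θ
    rw [h11, h31, norm_mul, norm_mul, Complex.norm_real, Complex.norm_real, Real.norm_eq_abs,
      Real.norm_eq_abs, abs_of_pos hθ1, abs_of_pos hθ3, hΘ]
    ring
  rw [← Finset.add_sum_erase _ _ (Finset.mem_univ (1 : I))] at hsum0 hcn
  have h7 : ‖c 1 * s 1‖ ≤ (∑ t ∈ Finset.univ.erase (1 : I), ‖c t‖) * B := by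
    rw [eq_neg_of_add_eq_zero_left hsum0, norm_neg, Finset.sum_mul]
    refine norm_sum_le_of_le _ fun t ht => ?_
    rw [norm_mul]
    exact mul_le_mul_of_nonneg_left (hbound t (Finset.ne_of_mem_erase ht)) (norm_nonneg _)
  rw [norm_mul, hc1] at h7
  rw [hc1] at hcn
  have h8 : ∑ t ∈ Finset.univ.erase (1 : I), ‖c t‖ ≤ (w1 ^ 2 * w3 - 1) * Θ := by
    rw [hΘ] at hcn ⊢; linarith
  have h9 : Θ * ‖s 1‖ ≤ Θ * ((w1 ^ 2 * w3 - 1) * B) := by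
    refine h7.trans ((mul_le_mul_of_nonneg_right h8 hB0).trans (le_of_eq (by ring)))
  have h10 := le_of_mul_le_mul_left h9 hΘ0
  linarith


theorem wl_ratEval {F : Type} [Field F] (f1 f2 : F[X]) (hf2 : f2 ≠ 0) (a : F)
    (h2 : f2.eval a ≠ 0) :
    ratEval (algebraMap F[X] (RatFunc F) f1 / algebraMap F[X] (RatFunc F) f2) a =
      f1.eval a / f2.eval a := by
  set x := algebraMap F[X] (RatFunc F) f1 / algebraMap F[X] (RatFunc F) f2 with hx
  have hd : x.denom ∣ f2 := RatFunc.denom_div_dvd f1 f2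
  have h3 : x.denom.eval a ≠ 0 := by
    intro h0
    obtain ⟨r, hr⟩ := hd
    apply h2
    rw [hr, eval_mul, h0, zero_mul]
  have h4 : x.num * f2 = f1 * x.denom := by
    apply RatFunc.algebraMap_injective F
    have h5 := RatFunc.num_div_denom x
    have h6 : algebraMap F[X] (RatFunc F) f2 ≠ 0 := RatFunc.algebraMap_ne_zero hf2
    have h7 : algebraMap F[X] (RatFunc F) x.denom ≠ 0 :=
      RatFunc.algebraMap_ne_zero (RatFunc.denom_ne_zero x)
    rw [map_mul, map_mul]
    rw [← div_eq_div_iff h7 h6, h5]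
  have h8 := congrArg (eval a) h4
  rw [eval_mul, eval_mul] at h8
  rw [ratEval, RatFunc.eval, eval₂_id, eval₂_id, div_eq_div_iff h3 h2, h8]

theorem stmt1 (q n m₁ m₂ : ℕ) (hq : IsPrimePow q) (hn : 3 ≤ n)
    (hm₁ : 0 < m₁) (hm₂ : 0 < m₂)
    (K L : Type) [Field K] [Field L] [Fintype K] [Fintype L] [Algebra K L]
    (hK : Fintype.card K = q) (hL : Fintype.card L = q ^ n)
    (h : (q : ℝ) ^ ((n : ℝ) / 2) ≥
      (m₁ + m₂ + 1) * (Wnat (q ^ n - 1) : ℝ) ^ 2 * Wpoly ((X : Polynomial K) ^ n - 1)) :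
    ∀ f ∈ Upsilon L m₁ m₂, ∃ α : L,
      IsPrimitiveElem α ∧ IsNormalElem K n α ∧ IsPrimitiveElem (ratEval f α) := by

  classical
  intro f hf
  obtain ⟨f1, f2, hf2, rfl, hd1, hd2, hcop, k, g, hk, hg, hgi, hgX, hgcd, hdv, hndv⟩ := hf
  have hf1 : f1 ≠ 0 := by
    rintro rfl
    apply hndv
    rw [zero_mul]
    exact dvd_zero _
  haveI : Fintype (MulChar L ℂ) := Fintype.ofFinite _
  have hq2 : 2 ≤ q := hq.two_le
  have hfr : Module.finrank K L = n := by
    have h1 := Module.card_eq_pow_finrank (K := K) (V := L)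
    rw [hK, hL] at h1
    exact (Nat.pow_right_injective hq2 h1).symm
  have hQ1 : 1 < q ^ n := Nat.one_lt_pow (by omega) (by omega)
  obtain ⟨c1, θ1, hθ1, h11, h1s, h1⟩ := wl_prim (L := L)
  obtain ⟨c3, θ3, hθ3, h31, h3s, h3⟩ := wl_norm_sieve (K := K) (L := L) n hfr (by omega)
  have hU : (X : K[X]) ^ n - 1 ≠ 0 := (monic_X_pow_sub_C (1 : K) (by omega : n ≠ 0)).ne_zero
  have hW1 := wl_Wnat (q ^ n - 1) (by omega)
  have hW3 := wl_Wpoly ((X : K[X]) ^ n - 1) hU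
  set w1 : ℝ := (Wnat (q ^ n - 1) : ℝ) with hw1
  set w3 : ℝ := (Wpoly ((X : K[X]) ^ n - 1) : ℝ) with hw3
  have hW1' : (2 : ℝ) ^ (q ^ n - 1).primeFactors.card ≤ w1 := by
    rw [hw1]; exact_mod_cast hW1
  have hW3' : (2 : ℝ) ^ (UniqueFactorizationMonoid.normalizedFactors
      ((X : K[X]) ^ n - 1)).toFinset.card ≤ w3 := by
    rw [hw3]; exact_mod_cast hW3
  have hw1' : 1 ≤ w1 := (one_le_pow₀ (by norm_num)).trans hW1'
  have hw3' : 1 ≤ w3 := (one_le_pow₀ (by norm_num)).trans hW3'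
  have hw : 1 ≤ w1 ^ 2 * w3 := one_le_mul_of_one_le_of_one_le (one_le_pow₀ hw1') hw3'
  have hsq : Real.sqrt (Fintype.card L : ℝ) = (q : ℝ) ^ ((n : ℝ) / 2) := by
    rw [hL, Real.sqrt_eq_rpow, Nat.cast_pow, ← Real.rpow_natCast, ← Real.rpow_mul (by positivity)]
    congr 1
    ring
  have hDm : ((1 + f1.natDegree + f2.natDegree : ℕ) : ℝ) ≤ m₁ + m₂ + 1 := by
    exact_mod_cast (by omega)
  have hlt := wl_final_ineq (Fintype.card L) ((1 + f1.natDegree + f2.natDegree : ℕ) : ℝ)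
    (m₁ + m₂ + 1) (w1 ^ 2 * w3) (by exact_mod_cast (by omega)) hDm hw
    (by rw [hL]; exact_mod_cast hQ1) (by rw [hsq]; linarith)
  have hA := h1s.trans (mul_le_mul_of_nonneg_right (by rw [hL]; exact hW1') hθ1.le : _ ≤ w1 * θ1)
  have hB := h3s.trans (mul_le_mul_of_nonneg_right hW3' hθ3.le)
  obtain ⟨α, ha, hb, hc⟩ := wl_main f1 f2 hf1 hf2 hcop k g hk hg hgi hgX hgcd hdv hndv c1 c3
    θ1 θ3 w1 w3 hθ1 hθ3 h11 h31 hA hB hlt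
  refine ⟨α, (h1 α ha).2, h3 α hc, ?_⟩
  obtain ⟨hy0, hy⟩ := h1 _ hb
  have h2 : f2.eval α ≠ 0 := by
    intro h0
    apply hy0
    rw [h0, div_zero]
  rw [wl_ratEval f1 f2 hf2 α h2]
  exact hy
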